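/- arXiv:2011.12812 — 8 statements merged into one kernel-verified Lean document; each statement's English description precedes it below -/
import Mathlib

section
/- Let L > 0 and let W : ℝ → ℝ be a continuous function satisfying W(x)·sign(x) ≥ -L(|x| + 1) for all x ∈ ℝ. Let T > 0, let f : [0, T] → ℝ be continuous, and let u : [0, T] → ℝ be a continuous function satisfying u(t) = -∫₀ᵗ W(u(s)) ds + f(t) for all t ∈ [0, T]. If M > 1 satisfies M ≥ sup_{s ∈ [0,T]} |f(s)| + |u(0)|, then sup_{t ∈ [0,T]} |u(t)| ≤ 1 + (4M + LT)·(1 + T·L·e^{LT}). -/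
theorem one_side (L T M : ℝ) (hL : 0 < L) (hT : 0 < T) (hM : 1 < M)
    (W f u : ℝ → ℝ) (hW : Continuous W)
    (hWs : ∀ x : ℝ, 0 < x → -(L * (x + 1)) ≤ W x)
    (hu : ContinuousOn u (Set.Icc 0 T))
    (huEq : ∀ t ∈ Set.Icc (0:ℝ) T, u t = -(∫ s in (0:ℝ)..t, W (u s)) + f t)
    (hf : ∀ s ∈ Set.Icc (0:ℝ) T, |f s| ≤ M) :
    ∀ t ∈ Set.Icc (0:ℝ) T, u t ≤ 3 * M * Real.exp (L * T) := by
  set w : ℝ → ℝ := Set.IccExtend hT.le ((Set.Icc 0 T).domRestrict u) with hw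
  have hwc : Continuous w := (continuousOn_iff_continuous_domRestrict.1 hu).Icc_extend'
  have hwu : ∀ s ∈ Set.Icc (0:ℝ) T, w s = u s := by
    intro s hs
    rw [hw, Set.IccExtend_of_mem hT.le _ hs]; rfl
  have hg : Continuous (fun s => W (w s)) := hW.comp hwc
  set v : ℝ → ℝ := fun t => -(∫ s in (0:ℝ)..t, W (w s)) with hv
  have hvd : ∀ t, HasDerivAt v (-W (w t)) t := fun t =>
    (intervalIntegral.integral_hasDerivAt_right (hg.intervalIntegrable _ _)
      (hg.stronglyMeasurableAtFilter _ _) hg.continuousAt).neg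
  have hvu : ∀ t ∈ Set.Icc (0:ℝ) T, u t = v t + f t := by
    intro t ht
    rw [huEq t ht]
    simp only [hv]
    congr 2
    apply intervalIntegral.integral_congr
    intro s hs
    rw [Set.uIcc_of_le ht.1] at hs
    simp only [hwu s ⟨hs.1, hs.2.trans ht.2⟩]
  have hBd : ∀ t, HasDerivAt (fun t => 3 * M * Real.exp (L * t) - M - 1 - (M - 1) / 2)
      (3 * M * (Real.exp (L * t) * L)) t := by
    intro t
    have h1 : HasDerivAt (fun t => L * t) L t := by
      simpa using (hasDerivAt_id t).const_mul L
    exact (((h1.exp.const_mul (3 * M)).sub_const M).sub_const 1).sub_const _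
  have key := image_le_of_deriv_right_lt_deriv_boundary (a := 0) (b := T) (f := v)
    (f' := fun t => -W (w t))
    (fun t _ => (hvd t).continuousAt.continuousWithinAt)
    (fun t _ => (hvd t).hasDerivWithinAt)
    (B := fun t => 3 * M * Real.exp (L * t) - M - 1 - (M - 1) / 2)
    (by simp [hv]; linarith) hBd (by
      intro x hx he
      have hx' : x ∈ Set.Icc (0:ℝ) T := ⟨hx.1, hx.2.le⟩
      have h1 := abs_le.1 (hf x hx')
      have h2 := hvu x hx'
      have h3 : 1 ≤ Real.exp (L * x) := Real.one_le_exp (mul_nonneg hL.le hx.1)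
      have h4 : 3 * M ≤ 3 * M * Real.exp (L * x) := le_mul_of_one_le_right (by linarith) h3
      have h5 := hWs (u x) (by linarith)
      rw [hwu x hx']
      have h6 : L * (u x + 1) < L * (3 * M * Real.exp (L * x)) :=
        mul_lt_mul_of_pos_left (by linarith) hL
      linarith)
  intro t ht
  have h1 := abs_le.1 (hf t ht)
  have h2 := hvu t ht
  have h3 := key ht
  have h4 : Real.exp (L * t) ≤ Real.exp (L * T) :=
    Real.exp_le_exp.2 (mul_le_mul_of_nonneg_left ht.2 hL.le)
  have h5 : 3 * M * Real.exp (L * t) ≤ 3 * M * Real.exp (L * T) :=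
    mul_le_mul_of_nonneg_left h4 (by linarith)
  linarith

/-- a priori bound for a scalar integral equation with confining drift. -/
theorem stmt_0 (L T M : ℝ) (hL : 0 < L) (hT : 0 < T) (hM : 1 < M)
    (W f u : ℝ → ℝ) (hW : Continuous W)
    (hWsign : ∀ x : ℝ, -(L * (|x| + 1)) ≤ W x * Real.sign x)
    (hf : ContinuousOn f (Set.Icc 0 T))
    (hu : ContinuousOn u (Set.Icc 0 T))
    (huEq : ∀ t ∈ Set.Icc (0:ℝ) T, u t = -(∫ s in (0:ℝ)..t, W (u s)) + f t)
    (hMge : ∀ s ∈ Set.Icc (0:ℝ) T, |f s| + |u 0| ≤ M) :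
    ∀ t ∈ Set.Icc (0:ℝ) T, |u t| ≤ 1 + (4 * M + L * T) * (1 + T * L * Real.exp (L * T)) := by
  have hfM : ∀ s ∈ Set.Icc (0:ℝ) T, |f s| ≤ M := fun s hs => by
    linarith [hMge s hs, abs_nonneg (u 0)]
  have hup := one_side L T M hL hT hM W f u hW (fun x hx => by
    have := hWsign x
    rw [Real.sign_of_pos hx, abs_of_pos hx] at this
    linarith) hu huEq hfM
  have hlo := one_side L T M hL hT hM (fun x => -W (-x)) (fun t => -f t) (fun t => -u t)
    (by fun_prop) (fun x hx => by
      have := hWsign (-x)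
      rw [Real.sign_of_neg (by linarith), abs_neg, abs_of_pos hx] at this
      linarith) hu.neg (fun t ht => by
        simp only [neg_neg, intervalIntegral.integral_neg]
        rw [huEq t ht]; ring) (fun s hs => by simpa using hfM s hs)
  intro t ht
  have h1 := hup t ht
  have h2 := hlo t ht
  have hE : Real.exp (L * T) ≤ 1 + T * L * Real.exp (L * T) := by
    have h := Real.add_one_le_exp (-(L * T))
    have hp := Real.exp_pos (L * T)
    have hm : Real.exp (-(L * T)) * Real.exp (L * T) = 1 := by
      rw [← Real.exp_add]; simp
    nlinarith
  have hLT : 0 < L * T := mul_pos hL hT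
  have h3 : 3 * M * Real.exp (L * T) ≤ (4 * M + L * T) * (1 + T * L * Real.exp (L * T)) :=
    mul_le_mul (by linarith) hE (Real.exp_pos _).le (by linarith)
  rw [abs_le]
  constructor <;> linarith
end

section
/- Let V be of O'Connell–Yor type, let θ > 0 and N ≥ 1. Define b : ℝᴺ → ℝᴺ by b(x)₁ = -θ - V'(x₁) and b(x)_j = V'(x_{j-1}) - V'(x_j) for 2 ≤ j ≤ N. Then for every continuous f : [0, ∞) → ℝᴺ with f(0) = 0 and every x₀ ∈ ℝᴺ there exists a unique continuous function x : [0, ∞) → ℝᴺ satisfying x(t) = x₀ + ∫₀ᵗ b(x(s)) ds + f(t) for all t ≥ 0 (in particular, the solution exists globally in time, with no finite-time explosion). -/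
/-- A potential `V` is of O'Connell–Yor type. -/
def OConnellYorType (V : ℝ → ℝ) : Prop :=
  ContDiff ℝ (⊤ : ℕ∞) V ∧ (∀ x, 0 ≤ V x) ∧ (∀ x, 0 ≤ deriv (deriv V) x) ∧ (∀ x, deriv V x ≤ 0) ∧
  (∃ c > (0:ℝ), ∃ C > (0:ℝ), ∀ x : ℝ, x ≤ -C → c * x ^ 2 ≤ V x) ∧
  (∃ c₀ > (0:ℝ), ∃ C > (0:ℝ), ∀ x : ℝ,
    c₀ * deriv (deriv V) x ≤ -(deriv (deriv (deriv V)) x) ∧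
    -(deriv (deriv (deriv V)) x) ≤ (1 / c₀) * deriv (deriv V) x + (if -C ≤ x then C else 0))

open Set in
lemma oy_unique (h F x y : ℝ → ℝ) (hc : Continuous h) (ha : Antitone h) (T : ℝ)
    (hx : Continuous x) (hy : Continuous y)
    (ex : ∀ t ∈ Icc 0 T, x t = F t + ∫ s in (0:ℝ)..t, h (x s))
    (ey : ∀ t ∈ Icc 0 T, y t = F t + ∫ s in (0:ℝ)..t, h (y s)) :
    ∀ t ∈ Icc 0 T, x t = y t := by
  let w : ℝ → ℝ := fun t => (∫ s in (0:ℝ)..t, h (x s)) - ∫ s in (0:ℝ)..t, h (y s)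
  have hw : ∀ t, HasDerivAt w (h (x t) - h (y t)) t := fun t =>
    ((hc.comp hx).integral_hasStrictDerivAt 0 t).hasDerivAt.sub
      ((hc.comp hy).integral_hasStrictDerivAt 0 t).hasDerivAt
  have hwe : ∀ t ∈ Icc 0 T, w t = x t - y t := by
    intro t ht
    rw [ex t ht, ey t ht]; simp only [w]; ring
  have hw2 : ∀ t, HasDerivAt (fun t => w t ^ 2) (2 * w t * (h (x t) - h (y t))) t := by
    intro t
    have := (hw t).fun_pow 2
    norm_num at this
    exact this
  have anti : AntitoneOn (fun t => w t ^ 2) (Icc 0 T) := by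
    apply antitoneOn_of_deriv_nonpos (convex_Icc 0 T)
    · exact fun t _ => (hw2 t).continuousAt.continuousWithinAt
    · exact fun t _ => (hw2 t).differentiableAt.differentiableWithinAt
    · intro t ht
      rw [(hw2 t).deriv, hwe t (interior_subset ht)]
      rcases le_total (x t) (y t) with hl | hl
      · have := ha hl
        nlinarith
      · have := ha hl
        nlinarith
  intro t ht
  have h0 : (0:ℝ) ∈ Icc 0 T := ⟨le_rfl, ht.1.trans ht.2⟩
  have := anti h0 ht ht.1
  have hw0 : w 0 = 0 := by simp [w]
  simp only [hw0] at this
  have hz : w t = 0 := by nlinarith [sq_nonneg (w t)]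
  rw [hwe t ht] at hz
  linarith

open Set in
lemma oy_existT (h F : ℝ → ℝ) (hc : Continuous h) (ha : Antitone h) (hpos : ∀ x, 0 ≤ h x)
    (hL : ∀ m, ∃ K : NNReal, LipschitzOnWith K h (Ici m)) (hF : Continuous F)
    (T : ℝ) (hT : 0 < T) :
    ∃ x : ℝ → ℝ, Continuous x ∧
      ∀ t ∈ Icc 0 T, x t = F t + ∫ s in (0:ℝ)..t, h (x s) := by
  obtain ⟨t0, -, hm⟩ := isCompact_Icc.exists_isMinOn (nonempty_Icc.2 hT.le) hF.continuousOn
  set m := F t0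
  have hm' : ∀ t ∈ Icc 0 T, m ≤ F t := fun t ht => hm ht
  obtain ⟨K, hK⟩ := hL m
  let G : ℝ → ℝ → ℝ := fun t z => h (max z 0 + F t)
  let z0 : Icc (0:ℝ) T := ⟨0, le_rfl, hT.le⟩
  have hPL : IsPicardLindelof G z0 (0:ℝ) (⟨h m * T, by have := hpos m; positivity⟩) 0
      ⟨h m, hpos m⟩ K := by
    refine ⟨?_, ?_, ?_, ?_⟩
    · intro t ht
      apply LipschitzOnWith.of_dist_le_mul
      intro u _ v _
      have h1 : max u 0 + F t ∈ Ici m := by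
        have := hm' t ht; have := le_max_right u 0; simp only [mem_Ici]; linarith
      have h2 : max v 0 + F t ∈ Ici m := by
        have := hm' t ht; have := le_max_right v 0; simp only [mem_Ici]; linarith
      refine (hK.dist_le_mul _ h1 _ h2).trans ?_
      gcongr
      rw [Real.dist_eq, Real.dist_eq, add_sub_add_right_eq_sub]
      exact abs_max_sub_max_le_abs u v 0
    · intro z _
      exact (hc.comp (continuous_const.add hF)).continuousOn
    · intro t ht z _
      rw [Real.norm_of_nonneg (hpos _)]
      apply ha
      have := hm' t ht; have := le_max_right z 0; linarith
    · simp [z0, hT.le]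
      exact le_rfl
  obtain ⟨z, hz0, hz⟩ := hPL.exists_eq_forall_mem_Icc_hasDerivWithinAt₀
  have hzc : ContinuousOn z (Icc 0 T) := fun t ht => (hz t ht).continuousWithinAt
  let p : ℝ → ℝ := fun t => max 0 (min t T)
  have hp : Continuous p := by fun_prop
  have hpm : ∀ t, p t ∈ Icc 0 T := fun t =>
    ⟨le_max_left _ _, max_le hT.le (min_le_right _ _)⟩
  have hpe : ∀ t ∈ Icc 0 T, p t = t := fun t ht => by simp [p, ht.1, ht.2]
  have hzp : Continuous (fun t => z (p t)) := hzc.comp_continuous hp hpm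
  have hz0' : z 0 = 0 := hz0
  have hint : ∀ t ∈ Icc 0 T, z t = ∫ s in (0:ℝ)..t, G s (z (p s)) := by
    intro t ht
    have hcG : Continuous fun s => G s (z (p s)) := by
      exact hc.comp ((hzp.max continuous_const).add hF)
    have := intervalIntegral.integral_eq_sub_of_hasDeriv_right_of_le (f := z)
      (f' := fun s => G s (z (p s))) ht.1
      (hzc.mono (Icc_subset_Icc_right ht.2)) ?_ (hcG.intervalIntegrable _ _)
    · rw [this, hz0']; simp
    · intro s hs
      have hs' : s ∈ Icc 0 T := ⟨hs.1.le, hs.2.le.trans ht.2⟩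
      simp only [hpe s hs']
      exact ((hz s hs').hasDerivAt (Icc_mem_nhds hs.1 (hs.2.trans_le ht.2))).hasDerivWithinAt
  have hnn : ∀ t ∈ Icc 0 T, 0 ≤ z t := by
    intro t ht
    rw [hint t ht]
    exact intervalIntegral.integral_nonneg ht.1 fun s _ => hpos _
  refine ⟨fun t => F t + z (p t), hF.add hzp, ?_⟩
  intro t ht
  simp only [hpe t ht]
  rw [hint t ht]
  congr 1
  apply intervalIntegral.integral_congr
  intro s hs
  simp only [G]
  rw [max_eq_left (hnn _ (hpm s)), add_comm]

open Set Filter in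
lemma oy_exist (h F : ℝ → ℝ) (hc : Continuous h) (ha : Antitone h) (hpos : ∀ x, 0 ≤ h x)
    (hL : ∀ m, ∃ K : NNReal, LipschitzOnWith K h (Ici m)) (hF : Continuous F) :
    ∃ x : ℝ → ℝ, Continuous x ∧
      ∀ t, 0 ≤ t → x t = F t + ∫ s in (0:ℝ)..t, h (x s) := by
  choose u huc hu using fun n : ℕ =>
    oy_existT h F hc ha hpos hL hF ((n:ℝ) + 1) (by positivity)
  let X : ℝ → ℝ := fun t => u ⌊max t 0⌋₊ (max t 0)
  have key : ∀ n : ℕ, ∀ t : ℝ, t < n + 1 → X t = u n (max t 0) := by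
    intro n t ht
    set s := max t 0 with hs
    have hs0 : 0 ≤ s := le_max_right _ _
    have hsn : s < n + 1 := max_lt ht (by positivity)
    have hle : ⌊s⌋₊ ≤ n := by
      have : ⌊s⌋₊ < n + 1 := (Nat.floor_lt hs0).2 (by exact_mod_cast hsn)
      omega
    have hle' : (⌊s⌋₊:ℝ) ≤ n := by exact_mod_cast hle
    exact oy_unique h F _ _ hc ha (⌊s⌋₊ + 1) (huc _) (huc n) (hu _)
      (fun r hr => hu n r ⟨hr.1, hr.2.trans (by linarith)⟩) s
      ⟨hs0, (Nat.lt_floor_add_one s).le⟩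
  refine ⟨X, ?_, ?_⟩
  · rw [continuous_iff_continuousAt]
    intro t
    obtain ⟨n, hn⟩ := exists_nat_gt t
    have hc1 : ContinuousAt (fun s => u n (max s 0)) t :=
      ((huc n).comp (continuous_id.max continuous_const)).continuousAt
    refine hc1.congr ?_
    filter_upwards [Iio_mem_nhds hn] with s hs
    exact (key n s (by have : s < n := hs; linarith)).symm
  · intro t ht
    obtain ⟨n, hn⟩ := exists_nat_gt t
    rw [key n t (by linarith), max_eq_left ht, hu n t ⟨ht, by linarith⟩]
    congr 1
    apply intervalIntegral.integral_congr
    intro s hs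
    rw [uIcc_of_le ht] at hs
    simp only
    rw [key n s (by linarith [hs.2]), max_eq_left hs.1]

open Set in
lemma oy_rec (R : ℕ → (ℝ → ℝ) → (ℝ → ℝ) → Prop) (P : (ℝ → ℝ) → Prop)
    (h0 : ∃ a, Continuous a ∧ P a)
    (hs : ∀ k a, Continuous a → ∃ b, Continuous b ∧ R k a b) :
    ∃ X : ℕ → ℝ → ℝ, (∀ k, Continuous (X k)) ∧ P (X 0) ∧ ∀ k, R k (X k) (X (k + 1)) := by
  obtain ⟨a0, hac, hP⟩ := h0
  choose! S hS hR using hs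
  let X : ℕ → ℝ → ℝ := fun n => Nat.rec a0 (fun k a => S k a) n
  have hXc : ∀ k, Continuous (X k) := by
    intro k
    induction k with
    | zero => exact hac
    | succ k ih => exact hS k _ ih
  exact ⟨X, hXc, hP, fun k => hR k _ (hXc k)⟩

/-- global well-posedness of the driven triangular system. -/
theorem stmt_1 (V : ℝ → ℝ) (hV : OConnellYorType V) (θ : ℝ) (hθ : 0 < θ)
    (N : ℕ) (hN : 1 ≤ N)
    (b : (Fin N → ℝ) → (Fin N → ℝ))
    (hb : ∀ x : Fin N → ℝ, ∀ j : Fin N,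
      b x j = if j.1 = 0 then -θ - deriv V (x j)
        else deriv V (x ⟨j.1 - 1, lt_of_le_of_lt (Nat.sub_le j.1 1) j.2⟩) - deriv V (x j))
    (f : ℝ → Fin N → ℝ) (hf : ContinuousOn f (Set.Ici 0)) (hf0 : f 0 = 0)
    (x₀ : Fin N → ℝ) :
    ∃ x : ℝ → Fin N → ℝ,
      (ContinuousOn x (Set.Ici 0) ∧
        ∀ t : ℝ, 0 ≤ t → x t = x₀ + (∫ s in (0:ℝ)..t, b (x s)) + f t) ∧
      ∀ y : ℝ → Fin N → ℝ,
        (ContinuousOn y (Set.Ici 0) ∧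
          ∀ t : ℝ, 0 ≤ t → y t = x₀ + (∫ s in (0:ℝ)..t, b (y s)) + f t) →
        ∀ t : ℝ, 0 ≤ t → y t = x t := by
  obtain ⟨hsm, -, h2, h1, -, c₀, hc₀, C, -, h3⟩ := hV
  have hsm1 : ContDiff ℝ (⊤ : ℕ∞) (deriv V) := (contDiff_infty_iff_deriv.1 hsm).2
  have hsm2 : ContDiff ℝ (⊤ : ℕ∞) (deriv (deriv V)) := (contDiff_infty_iff_deriv.1 hsm1).2
  have hVd : Differentiable ℝ (deriv V) := (contDiff_infty_iff_deriv.1 hsm1).1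
  have hVdd : Differentiable ℝ (deriv (deriv V)) := (contDiff_infty_iff_deriv.1 hsm2).1
  have hVc : Continuous (deriv V) := hVd.continuous
  have hmono : Monotone (deriv V) := monotone_of_deriv_nonneg hVd h2
  have hanti2 : Antitone (deriv (deriv V)) := antitone_of_deriv_nonpos hVdd fun x => by
    have := (h3 x).1
    have := mul_nonneg hc₀.le (h2 x)
    linarith
  let h : ℝ → ℝ := fun x => - deriv V x
  have hc : Continuous h := hVc.neg
  have ha : Antitone h := fun x y hxy => neg_le_neg (hmono hxy)
  have hpos : ∀ x, 0 ≤ h x := fun x => neg_nonneg.2 (h1 x)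
  have hL : ∀ m, ∃ K : NNReal, LipschitzOnWith K h (Set.Ici m) := by
    intro m
    refine ⟨(deriv (deriv V) m).toNNReal, ?_⟩
    apply (convex_Ici m).lipschitzOnWith_of_nnnorm_hasDerivWithin_le
      (f' := fun x => - deriv (deriv V) x)
    · intro x _
      exact (hVd x).hasDerivAt.neg.hasDerivWithinAt
    · intro x hx
      rw [← NNReal.coe_le_coe, coe_nnnorm, norm_neg, Real.coe_toNNReal _ (h2 m),
        Real.norm_of_nonneg (h2 x)]
      exact hanti2 hx
  have hbc : Continuous b := by
    refine continuous_pi fun j => ?_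
    simp only [hb]
    split_ifs <;> fun_prop
  -- coordinatewise data
  let φ : ℕ → ℝ → ℝ := fun k t => if hk : k < N then x₀ ⟨k, hk⟩ + f (max t 0) ⟨k, hk⟩ else 0
  have hφ : ∀ k, Continuous (φ k) := by
    intro k
    simp only [φ]
    split_ifs with hk
    · refine continuous_const.add ((continuous_apply _).comp
        (hf.comp_continuous (continuous_id.max continuous_const) fun t => ?_))
      exact Set.mem_Ici.2 (le_max_right _ _)
    · exact continuous_const
  obtain ⟨X, hXc, hX0, hXs⟩ := oy_rec
    (fun k a c => ∀ t, 0 ≤ t → c t = (φ (k+1) t + ∫ s in (0:ℝ)..t, deriv V (a s))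
      + ∫ s in (0:ℝ)..t, h (c s))
    (fun c => ∀ t, 0 ≤ t → c t = (φ 0 t + ∫ s in (0:ℝ)..t, -θ) + ∫ s in (0:ℝ)..t, h (c s))
    (oy_exist h _ hc ha hpos hL ((hφ 0).add
      (intervalIntegral.continuous_primitive (fun _ _ => by simp) 0)))
    (fun k a hac => oy_exist h _ hc ha hpos hL ((hφ (k+1)).add
      (intervalIntegral.continuous_primitive
        (fun _ _ => (hVc.comp hac).intervalIntegrable _ _) 0)))
  have coord : ∀ y : ℝ → Fin N → ℝ, Continuous y → ∀ t, 0 ≤ t → ∀ k (hk : k < N),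
      (x₀ + (∫ s in (0:ℝ)..t, b (y s)) + f t) ⟨k, hk⟩ =
      (φ k t + ∫ s in (0:ℝ)..t, if k = 0 then -θ else
        deriv V (y s ⟨k - 1, lt_of_le_of_lt (Nat.sub_le k 1) hk⟩))
      + ∫ s in (0:ℝ)..t, h (y s ⟨k, hk⟩) := by
    intro y hy t ht k hk
    have e1 := ContinuousLinearMap.intervalIntegral_comp_comm
      (ContinuousLinearMap.proj (R := ℝ) (φ := fun _ : Fin N => ℝ) ⟨k, hk⟩)
      ((hbc.comp hy).intervalIntegrable (μ := MeasureTheory.volume) 0 t)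
    simp only [ContinuousLinearMap.proj_apply, Function.comp_apply] at e1
    have e2 : ∫ s in (0:ℝ)..t, b (y s) ⟨k, hk⟩ =
        (∫ s in (0:ℝ)..t, if k = 0 then -θ else
        deriv V (y s ⟨k - 1, lt_of_le_of_lt (Nat.sub_le k 1) hk⟩))
        + ∫ s in (0:ℝ)..t, h (y s ⟨k, hk⟩) := by
      rw [← intervalIntegral.integral_add]
      · congr 1
        funext s
        rw [hb]
        simp only [h]
        split_ifs <;> ring
      · apply Continuous.intervalIntegrable
        split_ifs <;> fun_prop
      · apply Continuous.intervalIntegrable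
        fun_prop
    simp only [Pi.add_apply]
    rw [← e1, e2]
    simp only [φ, hk, dif_pos, max_eq_left ht]
    ring
  let x : ℝ → Fin N → ℝ := fun t j => X j.1 t
  have hxc : Continuous x := continuous_pi fun j => hXc j.1
  have hxe : ∀ t : ℝ, 0 ≤ t → x t = x₀ + (∫ s in (0:ℝ)..t, b (x s)) + f t := by
    intro t ht
    funext ⟨k, hk⟩
    rw [coord x hxc t ht k hk]
    cases k with
    | zero => simpa [x] using hX0 t ht
    | succ k => simpa [x] using hXs k t ht
  refine ⟨x, ⟨hxc.continuousOn, hxe⟩, ?_⟩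
  rintro y ⟨hyc, hye⟩
  let Y : ℝ → Fin N → ℝ := fun t => y (max t 0)
  have hYc : Continuous Y :=
    hyc.comp_continuous (continuous_id.max continuous_const) fun t =>
      Set.mem_Ici.2 (le_max_right _ _)
  have hYy : ∀ t, 0 ≤ t → Y t = y t := fun t ht => by simp only [Y, max_eq_left ht]
  have hYe : ∀ t : ℝ, 0 ≤ t → Y t = x₀ + (∫ s in (0:ℝ)..t, b (Y s)) + f t := by
    intro t ht
    rw [hYy t ht, hye t ht]
    congr 2
    apply intervalIntegral.integral_congr
    intro s hs
    rw [Set.uIcc_of_le ht] at hs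
    simp only [hYy s hs.1]
  have main : ∀ k (hk : k < N), ∀ t, 0 ≤ t → Y t ⟨k, hk⟩ = x t ⟨k, hk⟩ := by
    intro k
    induction k with
    | zero =>
      intro hk t ht
      refine oy_unique h (fun t => φ 0 t + ∫ s in (0:ℝ)..t, -θ) (fun t => Y t ⟨0, hk⟩)
        (fun t => x t ⟨0, hk⟩) hc ha t (by fun_prop) (by fun_prop) ?_ ?_ t ⟨ht, le_rfl⟩
      · intro r hr
        have := congrFun (hYe r hr.1) ⟨0, hk⟩
        rw [coord Y hYc r hr.1] at this
        simpa using this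
      · intro r hr
        exact hX0 r hr.1
    | succ k ih =>
      intro hk t ht
      refine oy_unique h (fun t => φ (k+1) t + ∫ s in (0:ℝ)..t, deriv V (X k s))
        (fun t => Y t ⟨k+1, hk⟩)
        (fun t => x t ⟨k+1, hk⟩) hc ha t (by fun_prop) (by fun_prop) ?_ ?_ t ⟨ht, le_rfl⟩
      · intro r hr
        have := congrFun (hYe r hr.1) ⟨k+1, hk⟩
        rw [coord Y hYc r hr.1] at this
        refine this.trans ?_
        congr 2
        apply intervalIntegral.integral_congr
        intro s hs
        rw [Set.uIcc_of_le hr.1] at hs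
        have := ih (by omega) s hs.1
        simp only [Nat.add_sub_cancel, Nat.succ_ne_zero, if_false]
        rw [this]
      · intro r hr
        exact hXs k r hr.1
  intro t ht
  rw [← hYy t ht]
  funext ⟨k, hk⟩
  exact main k hk t ht
end

section
/- Let V : ℝ → ℝ be twice continuously differentiable, let θ ∈ ℝ and N ≥ 1, and define ω : ℝᴺ → ℝ by ω(x) = exp(-∑_{j=1}^N (θ·x_j + V(x_j))). Then ω satisfies the formal adjoint equation L*ω = 0 pointwise; explicitly, for every x ∈ ℝᴺ: (1/2)·(∂₁²ω)(x) + (1/2)·∑_{j=2}^N ((∂_j - ∂_{j-1})²ω)(x) + (1/2)·(∂_N²ω)(x) + ∂₁[(θ + V'(x₁))·ω(x)] - ∑_{j=2}^N ∂_j[(V'(x_{j-1}) - V'(x_j))·ω(x)] = 0, where ∂_j denotes the partial derivative in the j-th coordinate and (∂_j - ∂_{j-1})² = ∂_j² - 2∂_j∂_{j-1} + ∂_{j-1}². -/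
/-- Partial derivative in the `j`-th coordinate of a function on `Fin N → ℝ`. -/
noncomputable def pd {N : ℕ} (j : Fin N) (g : (Fin N → ℝ) → ℝ) (x : Fin N → ℝ) : ℝ :=
  deriv (fun y => g (Function.update x j y)) (x j)

/-- Predecessor index in `Fin N` (clamped at `0`). -/
def fpred {N : ℕ} (j : Fin N) : Fin N := ⟨j.1 - 1, lt_of_le_of_lt (Nat.sub_le j.1 1) j.2⟩

lemma pd_of_hasDerivAt {N : ℕ} {j : Fin N} {g : (Fin N → ℝ) → ℝ} {x : Fin N → ℝ} {d : ℝ}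
    (h : HasDerivAt (fun y => g (Function.update x j y)) d (x j)) : pd j g x = d := h.deriv

lemma hasDerivAt_coord {N : ℕ} (W : ℝ → ℝ) (hW : Differentiable ℝ W) (i j : Fin N)
    (x : Fin N → ℝ) :
    HasDerivAt (fun y => W (Function.update x j y i)) (if i = j then deriv W (x j) else 0)
      (x j) := by
  by_cases h : i = j
  · subst h
    simpa using (hW (x i)).hasDerivAt
  · simpa [h] using hasDerivAt_const (x j) (W (x i))

lemma hasDerivAt_om (V : ℝ → ℝ) (hV : Differentiable ℝ V) (θ : ℝ) (N : ℕ)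
    (ω : (Fin N → ℝ) → ℝ)
    (hω : ∀ x : Fin N → ℝ, ω x = Real.exp (-(∑ j, (θ * x j + V (x j)))))
    (x : Fin N → ℝ) (j : Fin N) :
    HasDerivAt (fun y => ω (Function.update x j y)) (-(θ + deriv V (x j)) * ω x) (x j) := by
  simp only [hω]
  have hW : Differentiable ℝ (fun t => θ * t + V t) := by fun_prop
  have h := (HasDerivAt.fun_sum (u := Finset.univ)
    (fun i _ => hasDerivAt_coord (fun t => θ * t + V t) hW i j x)).fun_neg.exp
  have hd : deriv (fun t => θ * t + V t) (x j) = θ + deriv V (x j) := by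
    have := ((hasDerivAt_id (x j)).const_mul θ).fun_add (hV (x j)).hasDerivAt
    simpa using this.deriv
  convert h using 1
  simp [hd]
  ring

lemma pd_mul_om (V : ℝ → ℝ) (hV : Differentiable ℝ V) (θ : ℝ) (N : ℕ)
    (ω : (Fin N → ℝ) → ℝ)
    (hω : ∀ x : Fin N → ℝ, ω x = Real.exp (-(∑ j, (θ * x j + V (x j)))))
    (x : Fin N → ℝ) (j : Fin N) (f : (Fin N → ℝ) → ℝ) (d : ℝ)
    (hf : HasDerivAt (fun y => f (Function.update x j y)) d (x j)) :
    pd j (fun y => f y * ω y) x = (d - f x * (θ + deriv V (x j))) * ω x := by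
  have h := hf.fun_mul (hasDerivAt_om V hV θ N ω hω x j)
  simp only [Function.update_eq_self] at h
  exact (pd_of_hasDerivAt (g := fun y => f y * ω y) h).trans (by ring)

/-- the product density `ω` solves the formal adjoint equation `L*ω = 0`. -/
theorem stmt_3 (V : ℝ → ℝ) (hV : ContDiff ℝ 2 V) (θ : ℝ) (N : ℕ) (hN : 1 ≤ N)
    (ω : (Fin N → ℝ) → ℝ)
    (hω : ∀ x : Fin N → ℝ, ω x = Real.exp (-(∑ j, (θ * x j + V (x j)))))
    (x : Fin N → ℝ) :
    (1 / 2) * pd ⟨0, hN⟩ (pd ⟨0, hN⟩ ω) x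
      + (1 / 2) * (∑ j : Fin N, if j.1 = 0 then 0 else
          (pd j (pd j ω) x - 2 * pd j (pd (fpred j) ω) x
            + pd (fpred j) (pd (fpred j) ω) x))
      + (1 / 2) * pd ⟨N - 1, by omega⟩ (pd ⟨N - 1, by omega⟩ ω) x
      + pd ⟨0, hN⟩ (fun y => (θ + deriv V (y ⟨0, hN⟩)) * ω y) x
      - (∑ j : Fin N, if j.1 = 0 then 0 else
          pd j (fun y => (deriv V (y (fpred j)) - deriv V (y j)) * ω y) x) = 0 := by
  have hV1 : Differentiable ℝ V := hV.differentiable (by norm_num)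
  have hV2 : Differentiable ℝ (deriv V) := by
    have : ContDiff ℝ (1 + 1) V := by simpa [one_add_one_eq_two] using hV
    exact (contDiff_succ_iff_deriv.1 this).2.2.differentiable (by norm_num)
  have h1 : ∀ i : Fin N, pd i ω = fun y => (-(θ + deriv V (y i))) * ω y := fun i =>
    funext fun y => pd_of_hasDerivAt (hasDerivAt_om V hV1 θ N ω hω y i)
  have h2 : ∀ i j : Fin N, pd j (pd i ω) x =
      (-(if i = j then deriv (deriv V) (x j) else 0)
        + (θ + deriv V (x i)) * (θ + deriv V (x j))) * ω x := by
    intro i j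
    rw [h1 i, pd_mul_om V hV1 θ N ω hω x j (fun y => -(θ + deriv V (y i))) _
      ((hasDerivAt_coord (deriv V) hV2 i j x).const_add θ).fun_neg]
    ring
  have h3 : ∀ i : Fin N, pd i (fun y => (θ + deriv V (y i)) * ω y) x =
      (deriv (deriv V) (x i) - (θ + deriv V (x i)) * (θ + deriv V (x i))) * ω x := by
    intro i
    rw [pd_mul_om V hV1 θ N ω hω x i (fun y => (θ + deriv V (y i))) _
      ((hasDerivAt_coord (deriv V) hV2 i i x).const_add θ)]
    simp
  have h4 : ∀ i j : Fin N, i ≠ j →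
      pd j (fun y => (deriv V (y i) - deriv V (y j)) * ω y) x =
      (-deriv (deriv V) (x j)
        - (deriv V (x i) - deriv V (x j)) * (θ + deriv V (x j))) * ω x := by
    intro i j hij
    rw [pd_mul_om V hV1 θ N ω hω x j (fun y => deriv V (y i) - deriv V (y j)) _
      ((hasDerivAt_coord (deriv V) hV2 i j x).fun_sub (hasDerivAt_coord (deriv V) hV2 j j x))]
    simp [hij]
  obtain ⟨n, rfl⟩ : ∃ n, N = n + 1 := ⟨N - 1, by omega⟩
  have hp : ∀ i : Fin n, fpred i.succ = i.castSucc := fun i => by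
    ext; simp [fpred]
  have hne : ∀ i : Fin n, i.castSucc ≠ i.succ := fun i => by
    simp [Fin.ext_iff]
  have h0 : (⟨0, hN⟩ : Fin (n + 1)) = 0 := rfl
  have hl : (⟨n + 1 - 1, by omega⟩ : Fin (n + 1)) = Fin.last n := rfl
  rw [h0, hl, h3 0]
  simp only [Fin.sum_univ_succ, Fin.val_succ, hp, h2, h4 _ _ (hne _), hne, Fin.val_zero,
    if_true, if_false, Nat.succ_ne_zero]
  have tel := (Fin.sum_univ_succ (fun j : Fin (n + 1) => (-(deriv (deriv V) (x j))
    + (θ + deriv V (x j)) * (θ + deriv V (x j))) * ω x)).symm.trans (Fin.sum_univ_castSucc _)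
  have e1 : ∀ a b c : Fin n → ℝ, ∑ i, (a i - 2 * b i + c i)
      = ∑ i, a i - 2 * ∑ i, b i + ∑ i, c i := by
    intro a b c
    rw [Finset.sum_add_distrib, Finset.sum_sub_distrib, Finset.mul_sum]
  rw [e1]
  have e2 : ∑ i : Fin n, (-deriv (deriv V) (x i.succ)
        - (deriv V (x i.castSucc) - deriv V (x i.succ)) * (θ + deriv V (x i.succ))) * ω x
      = ∑ i : Fin n, (-(deriv (deriv V) (x i.succ))
          + (θ + deriv V (x i.succ)) * (θ + deriv V (x i.succ))) * ω x
        - ∑ i : Fin n, (-0 + (θ + deriv V (x i.castSucc)) * (θ + deriv V (x i.succ))) * ω x := by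
    rw [← Finset.sum_sub_distrib]
    exact Finset.sum_congr rfl fun i _ => by ring
  rw [e2]
  linarith [tel]
end

section
/- Let V be of O'Connell–Yor type. Then the function θ ↦ log Z(θ) = log ∫_ℝ exp(-θx - V(x)) dx is three times differentiable on (0, ∞), and its third derivative satisfies (d³/dθ³) log Z(θ) ≤ 0 for every θ > 0. (Equivalently, ψ₂^V(θ) ≤ 0, i.e. the third central moment of the probability measure on ℝ with density proportional to exp(-θx - V(x)) is nonnegative.) -/
open MeasureTheory ProbabilityTheory

lemma oy_skew_core (g : ℝ → ℝ) (h1 : Integrable g) (h3 : Integrable (fun y => y ^ 2 * g y))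
    (h0 : ∫ y, g y = 0)
    (hs : (∀ y, g y ≤ 0) ∨ ∃ t : ℝ, ∀ y, 0 ≤ (y ^ 2 - t ^ 2) * g y) :
    0 ≤ ∫ y, y ^ 2 * g y := by
  rcases hs with hs | ⟨t, ht⟩
  · have h : (fun y => - g y) =ᵐ[volume] 0 := by
      rw [← integral_eq_zero_iff_of_nonneg (fun y => by simpa using hs y) (show Integrable (fun y => - g y) volume from h1.neg)]
      rw [integral_neg, h0, neg_zero]
    have : ∫ y, y ^ 2 * g y = 0 := by
      apply integral_eq_zero_of_ae
      filter_upwards [h] with y hy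
      have : g y = 0 := by simpa using hy
      simp [this]
    rw [this]
  · have : ∫ y, y ^ 2 * g y = ∫ y, (y ^ 2 - t ^ 2) * g y := by
      have e : (fun y => (y ^ 2 - t ^ 2) * g y) = fun y => y ^ 2 * g y - t ^ 2 * g y := by
        funext y; ring
      rw [e, integral_sub h3 (h1.const_mul _), integral_const_mul, h0]; ring
    rw [this]
    exact integral_nonneg ht

lemma oy_sign (D : ℝ → ℝ) (hD : ConvexOn ℝ (Set.Ici 0) D) (hD0 : D 0 = 0) :
    (∀ y, 0 ≤ y → D y ≤ 0) ∨
      ∃ t : ℝ, 0 ≤ t ∧ (∀ y, 0 ≤ y → y < t → D y ≤ 0) ∧ ∀ y, t < y → 0 ≤ D y := by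
  by_cases h : ∀ y, 0 ≤ y → D y ≤ 0
  · exact Or.inl h
  right
  push Not at h
  obtain ⟨y0, hy0, hy0'⟩ := h
  have hbdd : BddBelow {t : ℝ | 0 ≤ t ∧ 0 < D t} := ⟨0, fun t ht => ht.1⟩
  have hne : {t : ℝ | 0 ≤ t ∧ 0 < D t}.Nonempty := ⟨y0, hy0, hy0'⟩
  refine ⟨sInf {t : ℝ | 0 ≤ t ∧ 0 < D t}, le_csInf hne fun t ht => ht.1, ?_, ?_⟩
  · intro y hy hyt
    by_contra hc
    push Not at hc
    exact absurd (csInf_le hbdd (show y ∈ {t : ℝ | 0 ≤ t ∧ 0 < D t} from ⟨hy, hc⟩)) (not_le.2 hyt)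
  · intro y hy
    obtain ⟨s, ⟨hs0, hs⟩, hsy⟩ := exists_lt_of_csInf_lt hne hy
    have hypos : 0 < y := lt_of_le_of_lt hs0 hsy
    have := hD.2 (show (0:ℝ) ∈ Set.Ici 0 by simp) (show y ∈ Set.Ici 0 from hypos.le)
      (show 0 ≤ 1 - s / y by rw [sub_nonneg, div_le_one hypos]; exact hsy.le)
      (show 0 ≤ s / y by positivity) (by ring)
    simp only [smul_eq_mul, mul_zero, zero_add, hD0] at this
    rw [div_mul_cancel₀ _ hypos.ne'] at this
    by_contra hc
    push Not at hc
    have : s / y * D y ≤ 0 := mul_nonpos_of_nonneg_of_nonpos (by positivity) hc.le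
    linarith

lemma oy_skew (U : ℝ → ℝ) (m : ℝ)
    (hD : ConvexOn ℝ (Set.Ici 0) fun t => U (m - t) - U (m + t))
    (i1 : Integrable fun x => (x - m) * Real.exp (-U x))
    (i3 : Integrable fun x => (x - m) ^ 3 * Real.exp (-U x))
    (h0 : ∫ x, (x - m) * Real.exp (-U x) = 0) :
    0 ≤ ∫ x, (x - m) ^ 3 * Real.exp (-U x) := by
  have key : ∀ h : ℝ → ℝ, Integrable (fun x => h (x - m) * Real.exp (-U x)) →
      (∀ y, h (-y) = - h y) →
      Integrable (fun y => h y * (Real.exp (-U (m + y)) - Real.exp (-U (m - y)))) ∧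
      ∫ y, h y * (Real.exp (-U (m + y)) - Real.exp (-U (m - y))) =
        2 * ∫ x, h (x - m) * Real.exp (-U x) := by
    intro h hi hodd
    have a : Integrable (fun y => h y * Real.exp (-U (m + y))) := by
      have := hi.comp_add_left m
      simpa using this
    have a' : ∫ y, h y * Real.exp (-U (m + y)) = ∫ x, h (x - m) * Real.exp (-U x) := by
      have := integral_add_left_eq_self (μ := volume) (fun x => h (x - m) * Real.exp (-U x)) m
      simpa using this
    have b : Integrable (fun y => h y * Real.exp (-U (m - y))) := by
      have := a.comp_neg.neg
      refine this.congr (Filter.Eventually.of_forall fun y => ?_)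
      simp [hodd, sub_eq_add_neg]
    have b' : ∫ y, h y * Real.exp (-U (m - y)) = - ∫ y, h y * Real.exp (-U (m + y)) := by
      rw [← integral_neg_eq_self, ← integral_neg]
      congr 1; funext y
      simp [hodd]
    have e : (fun y => h y * (Real.exp (-U (m + y)) - Real.exp (-U (m - y)))) =
        fun y => h y * Real.exp (-U (m + y)) - h y * Real.exp (-U (m - y)) := by
      funext y; ring
    rw [e]
    refine ⟨a.sub b, ?_⟩
    rw [integral_sub a b, b', a']; ring
  obtain ⟨k1, k1'⟩ := key (fun y => y) i1 (fun y => rfl)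
  obtain ⟨k3, k3'⟩ := key (fun y => y ^ 3) i3 (fun y => by ring)
  have e3 : (fun y : ℝ => y ^ 3 * (Real.exp (-U (m + y)) - Real.exp (-U (m - y)))) =
     fun y => y ^ 2 * (y * (Real.exp (-U (m + y)) - Real.exp (-U (m - y)))) := by
    funext y; ring
  rw [e3] at k3 k3'
  have := oy_skew_core _ k1 k3 (by rw [k1', h0, mul_zero]) ?_
  · rw [k3'] at this; linarith
  have even : ∀ y, y * (Real.exp (-U (m + y)) - Real.exp (-U (m - y))) =
      |y| * (Real.exp (-U (m + |y|)) - Real.exp (-U (m - |y|))) := by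
    intro y
    rcases abs_cases y with ⟨h, _⟩ | ⟨h, _⟩
    · rw [h]
    · rw [h, sub_neg_eq_add, ← sub_eq_add_neg]; ring
  have neg : ∀ y, U (m - y) - U (m + y) ≤ 0 →
      Real.exp (-U (m + y)) - Real.exp (-U (m - y)) ≤ 0 := by
    intro y hy
    have := Real.exp_le_exp.2 (show -U (m + y) ≤ -U (m - y) by linarith)
    linarith
  have pos : ∀ y, 0 ≤ U (m - y) - U (m + y) →
      0 ≤ Real.exp (-U (m + y)) - Real.exp (-U (m - y)) := by
    intro y hy
    have := Real.exp_le_exp.2 (show -U (m - y) ≤ -U (m + y) by linarith)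
    linarith
  rcases oy_sign _ hD (by simp) with h | ⟨t, ht, hl, hr⟩
  · left
    intro y
    rw [even]
    exact mul_nonpos_of_nonneg_of_nonpos (abs_nonneg y) (neg _ (h _ (abs_nonneg y)))
  · right
    refine ⟨t, fun y => ?_⟩
    rw [even, ← sq_abs]
    have h0 := abs_nonneg y
    generalize |y| = z at *
    rcases lt_trichotomy z t with hz | hz | hz
    · apply mul_nonneg_of_nonpos_of_nonpos
      · nlinarith
      · exact mul_nonpos_of_nonneg_of_nonpos h0 (neg _ (hl _ h0 hz))
    · simp [hz]
    · apply mul_nonneg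
      · nlinarith
      · exact mul_nonneg h0 (pos _ (hr _ hz))

lemma oy_convex (V : ℝ → ℝ) (hc : ContDiff ℝ (⊤ : ℕ∞) V)
    (h3 : ∀ x, deriv (deriv (deriv V)) x ≤ 0) (θ m : ℝ) :
    ConvexOn ℝ (Set.Ici 0) fun t => (θ * (m - t) + V (m - t)) - (θ * (m + t) + V (m + t)) := by
  have hc1 : ContDiff ℝ (⊤ : ℕ∞) (deriv V) := ((contDiff_infty_iff_deriv).1 hc).2
  have hc2 : ContDiff ℝ (⊤ : ℕ∞) (deriv (deriv V)) := ((contDiff_infty_iff_deriv).1 hc1).2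
  have d0 : ∀ x, HasDerivAt V (deriv V x) x := fun x =>
    (((contDiff_infty_iff_deriv).1 hc).1 x).hasDerivAt
  have d1 : ∀ x, HasDerivAt (deriv V) (deriv (deriv V) x) x := fun x =>
    (((contDiff_infty_iff_deriv).1 hc1).1 x).hasDerivAt
  have anti : Antitone (deriv (deriv V)) :=
    antitone_of_deriv_nonpos ((contDiff_infty_iff_deriv).1 hc2).1 h3
  have hp : ∀ t, HasDerivAt (fun t => m + t) 1 t := fun t => (hasDerivAt_id t).const_add m
  have hm : ∀ t, HasDerivAt (fun t => m - t) (-1) t := fun t => (hasDerivAt_id t).const_sub m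
  have D1 : ∀ t, HasDerivAt
      (fun t => (θ * (m - t) + V (m - t)) - (θ * (m + t) + V (m + t)))
      (-2 * θ - deriv V (m - t) - deriv V (m + t)) t := by
    intro t
    have := (((hm t).const_mul θ).add ((d0 (m - t)).comp t (hm t))).sub
      (((hp t).const_mul θ).add ((d0 (m + t)).comp t (hp t)))
    refine this.congr_deriv ?_
    ring
  have D2 : ∀ t, HasDerivAt (fun t => -2 * θ - deriv V (m - t) - deriv V (m + t))
      (deriv (deriv V) (m - t) - deriv (deriv V) (m + t)) t := by
    intro t
    have := (((d1 (m - t)).comp t (hm t)).const_sub (-2 * θ)).sub ((d1 (m + t)).comp t (hp t))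
    refine this.congr_deriv ?_
    ring
  have E1 := funext fun t => (D1 t).deriv
  apply convexOn_of_deriv2_nonneg' (convex_Ici 0)
  · exact fun t _ => (D1 t).differentiableAt.differentiableWithinAt
  · rw [E1]
    exact fun t _ => (D2 t).differentiableAt.differentiableWithinAt
  · intro t ht
    rw [Function.iterate_succ, Function.iterate_one, Function.comp_apply, E1, (D2 t).deriv,
      sub_nonneg]
    have : (0:ℝ) ≤ t := ht
    exact anti (by linarith)

lemma oy_integrable (V : ℝ → ℝ) (hc : Continuous V) (h0 : ∀ x, 0 ≤ V x)
    {c : ℝ} (hcpos : 0 < c) {C : ℝ} (hC : ∀ x : ℝ, x ≤ -C → c * x ^ 2 ≤ V x)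
    {θ : ℝ} (hθ : 0 < θ) : Integrable fun x => Real.exp (-(θ * x) - V x) := by
  have a : Integrable fun x : ℝ => Real.exp (θ ^ 2 / (2 * c)) * Real.exp (-(c / 2) * x ^ 2) :=
    (integrable_exp_neg_mul_sq (by positivity)).const_mul _
  have b : Integrable ((Set.Ioi (-C)).indicator fun x : ℝ => Real.exp (-θ * x)) :=
    (exp_neg_integrableOn_Ioi (-C) hθ).integrable_indicator measurableSet_Ioi
  refine (a.add b).mono' (by fun_prop) (Filter.Eventually.of_forall fun x => ?_)
  rw [Real.norm_of_nonneg (Real.exp_pos _).le, Pi.add_apply]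
  by_cases hx : x ≤ -C
  · rw [Set.indicator_of_notMem (by simpa using hx), add_zero, ← Real.exp_add]
    apply Real.exp_le_exp.2
    have := hC x hx
    have h2 : 0 ≤ (c * x + θ) ^ 2 / (2 * c) := by positivity
    have h3 : (c * x + θ) ^ 2 / (2 * c) = c / 2 * x ^ 2 + θ * x + θ ^ 2 / (2 * c) := by
      field_simp; ring
    linarith
  · rw [Set.indicator_of_mem (by simpa using hx)]
    have : Real.exp (-(θ * x) - V x) ≤ Real.exp (-θ * x) :=
      Real.exp_le_exp.2 (by linarith [h0 x])
    have := Real.exp_pos (θ ^ 2 / (2 * c))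
    have := Real.exp_pos (-(c / 2) * x ^ 2)
    nlinarith

lemma oy_moments (V : ℝ → ℝ) (hc : Continuous V)
    (hI : ∀ θ : ℝ, 0 < θ → Integrable fun x => Real.exp (-(θ * x) - V x))
    {θ : ℝ} (hθ : 0 < θ) (n : ℕ) :
    Integrable (fun x => (-x) ^ n * Real.exp (-(θ * x) - V x)) ∧
    HasDerivAt (fun θ => ∫ x, (-x) ^ n * Real.exp (-(θ * x) - V x))
      (∫ x, (-x) ^ (n + 1) * Real.exp (-(θ * x) - V x)) θ := by
  set w : ℝ → NNReal := fun x => Real.toNNReal (Real.exp (- V x)) with hw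
  have hwm : Measurable w := by
    have : Continuous w := by fun_prop
    exact this.measurable
  set μ : Measure ℝ := volume.withDensity fun x => (w x : ENNReal) with hμ
  have e : ∀ (n : ℕ) (θ : ℝ), (fun x : ℝ => w x • ((-x) ^ n * Real.exp (θ * (-x)))) =
      fun x => (-x) ^ n * Real.exp (-(θ * x) - V x) := by
    intro n θ; funext x
    rw [NNReal.smul_def, hw]
    simp only [Real.coe_toNNReal _ (Real.exp_pos _).le, smul_eq_mul]
    rw [sub_eq_add_neg, Real.exp_add]; ring_nf
  have hint : ∀ n θ, ∫ x, (-x) ^ n * Real.exp (θ * (-x)) ∂μ =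
      ∫ x, (-x) ^ n * Real.exp (-(θ * x) - V x) := by
    intro n θ
    rw [hμ, integral_withDensity_eq_integral_smul hwm, e]
  have hsub : Set.Ioi (0:ℝ) ⊆ integrableExpSet (fun x : ℝ => -x) μ := by
    intro t ht
    show Integrable _ μ
    rw [hμ, integrable_withDensity_iff_integrable_smul hwm]
    have := e 0 t
    simp only [pow_zero, one_mul] at this
    rw [this]
    exact hI t ht
  have hmem : θ ∈ interior (integrableExpSet (fun x : ℝ => -x) μ) :=
    interior_maximal hsub isOpen_Ioi hθ
  constructor
  · have := integrable_pow_mul_exp_of_mem_interior_integrableExpSet hmem n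
    rw [hμ, integrable_withDensity_iff_integrable_smul hwm, e] at this
    exact this
  · have := hasDerivAt_integral_pow_mul_exp_real hmem n
    simp only [hint] at this
    exact this

/-- `θ ↦ log Z(θ)` is three times differentiable on `(0,∞)` with
nonpositive third derivative, i.e. `ψ₂^V(θ) ≤ 0`. -/
theorem stmt_8 (V : ℝ → ℝ) (hV : OConnellYorType V)
    (ψ : ℝ → ℝ)
    (hψ : ∀ θ : ℝ, ψ θ = Real.log (∫ x : ℝ, Real.exp (-(θ * x) - V x))) :
    ∀ θ : ℝ, 0 < θ →
      DifferentiableAt ℝ ψ θ ∧ DifferentiableAt ℝ (deriv ψ) θ ∧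
      DifferentiableAt ℝ (deriv (deriv ψ)) θ ∧ deriv (deriv (deriv ψ)) θ ≤ 0 := by
  obtain ⟨hc, hV0, hV2, -, ⟨c, hcpos, C, -, hC⟩, ⟨c₀, hc₀, C', -, hC'⟩⟩ := hV
  have h3 : ∀ x, deriv (deriv (deriv V)) x ≤ 0 := by
    intro x
    have := (hC' x).1
    have := mul_nonneg hc₀.le (hV2 x)
    linarith
  have hI : ∀ θ : ℝ, 0 < θ → Integrable fun x => Real.exp (-(θ * x) - V x) :=
    fun θ hθ => oy_integrable V hc.continuous hV0 hcpos hC hθ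
  obtain ⟨M, hM⟩ : ∃ M : ℕ → ℝ → ℝ,
      M = fun n θ => ∫ x, (-x) ^ n * Real.exp (-(θ * x) - V x) := ⟨_, rfl⟩
  have hint : ∀ n θ, 0 < θ → Integrable (fun x => (-x) ^ n * Real.exp (-(θ * x) - V x)) :=
    fun n θ hθ => (oy_moments V hc.continuous hI hθ n).1
  have hd : ∀ n θ, 0 < θ → HasDerivAt (M n) (M (n + 1) θ) θ := by
    intro n θ hθ
    rw [hM]
    exact (oy_moments V hc.continuous hI hθ n).2
  have hM0 : ∀ θ, 0 < θ → 0 < M 0 θ := by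
    intro θ hθ
    rw [hM]
    simp only [pow_zero, one_mul]
    exact integral_exp_pos (hI θ hθ)
  have hψ0 : ψ = fun θ => Real.log (M 0 θ) := by
    funext θ
    rw [hψ, hM]; simp
  have D1 : ∀ θ, 0 < θ → HasDerivAt ψ (M 1 θ / M 0 θ) θ := by
    intro θ hθ
    rw [hψ0]
    exact (hd 0 θ hθ).log (hM0 θ hθ).ne'
  have E1 : ∀ θ, 0 < θ → deriv ψ =ᶠ[nhds θ] fun θ => M 1 θ / M 0 θ := by
    intro θ hθ
    filter_upwards [Ioi_mem_nhds hθ] with s hs using (D1 s hs).deriv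
  have D2 : ∀ θ, 0 < θ → HasDerivAt (deriv ψ)
      ((M 2 θ * M 0 θ - M 1 θ * M 1 θ) / M 0 θ ^ 2) θ := by
    intro θ hθ
    exact ((hd 1 θ hθ).div (hd 0 θ hθ) (hM0 θ hθ).ne').congr_of_eventuallyEq (E1 θ hθ)
  have E2 : ∀ θ, 0 < θ → deriv (deriv ψ) =ᶠ[nhds θ]
      fun θ => (M 2 θ * M 0 θ - M 1 θ * M 1 θ) / M 0 θ ^ 2 := by
    intro θ hθ
    filter_upwards [Ioi_mem_nhds hθ] with s hs using (D2 s hs).deriv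
  intro θ hθ
  have D3 := ((((hd 2 θ hθ).mul (hd 0 θ hθ)).sub ((hd 1 θ hθ).mul (hd 1 θ hθ))).div
    ((hd 0 θ hθ).pow 2) (pow_ne_zero 2 (hM0 θ hθ).ne')).congr_of_eventuallyEq (E2 θ hθ)
  refine ⟨(D1 θ hθ).differentiableAt, (D2 θ hθ).differentiableAt, D3.differentiableAt, ?_⟩
  rw [D3.deriv]
  have hpos := hM0 θ hθ
  obtain ⟨m, hm⟩ : ∃ m, m = - M 1 θ / M 0 θ := ⟨_, rfl⟩
  have hm1 : M 1 θ = - m * M 0 θ := by rw [hm]; field_simp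
  have eU : ∀ x, Real.exp (-(θ * x + V x)) = Real.exp (-(θ * x) - V x) := by
    intro x; congr 1; ring
  have i0 := hint 0 θ hθ
  have i1 := hint 1 θ hθ
  have i2 := hint 2 θ hθ
  have i3 := hint 3 θ hθ
  have e1 : (fun x => (x - m) * Real.exp (-(θ * x + V x))) = fun x =>
      (-1) * ((-x) ^ 1 * Real.exp (-(θ * x) - V x)) +
        (-m) * ((-x) ^ 0 * Real.exp (-(θ * x) - V x)) := by
    funext x; rw [eU]; ring
  have e3 : (fun x => (x - m) ^ 3 * Real.exp (-(θ * x + V x))) = fun x =>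
      (((-1) * ((-x) ^ 3 * Real.exp (-(θ * x) - V x)) +
        (-3 * m) * ((-x) ^ 2 * Real.exp (-(θ * x) - V x))) +
        (-3 * m ^ 2) * ((-x) ^ 1 * Real.exp (-(θ * x) - V x))) +
        (-m ^ 3) * ((-x) ^ 0 * Real.exp (-(θ * x) - V x)) := by
    funext x; rw [eU]; ring
  have j3 := i3.const_mul (-1)
  have j2 := i2.const_mul (-3 * m)
  have j1 := i1.const_mul (-3 * m ^ 2)
  have j0 := i0.const_mul (-m ^ 3)
  have hMn : ∀ n, ∫ x, (-x) ^ n * Real.exp (-(θ * x) - V x) = M n θ := by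
    intro n; rw [hM]
  have key := oy_skew (fun x => θ * x + V x) m (oy_convex V hc h3 θ m)
    (by rw [e1]; exact (i1.const_mul (-1)).add (i0.const_mul (-m)))
    (by rw [e3]; exact ((j3.add j2).add j1).add j0)
    (by
      rw [e1, integral_add (i1.const_mul (-1)) (i0.const_mul (-m))]
      rw [integral_const_mul, integral_const_mul, hMn, hMn, hm1]; ring)
  have j32 : Integrable (fun x => (-1) * ((-x) ^ 3 * Real.exp (-(θ * x) - V x)) +
        (-3 * m) * ((-x) ^ 2 * Real.exp (-(θ * x) - V x))) volume := j3.add j2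
  have j321 : Integrable (fun x => ((-1) * ((-x) ^ 3 * Real.exp (-(θ * x) - V x)) +
        (-3 * m) * ((-x) ^ 2 * Real.exp (-(θ * x) - V x))) +
        (-3 * m ^ 2) * ((-x) ^ 1 * Real.exp (-(θ * x) - V x))) volume := j32.add j1
  rw [e3, integral_add j321 j0, integral_add j32 j1, integral_add j3 j2] at key
  rw [integral_const_mul, integral_const_mul, integral_const_mul, integral_const_mul,
    hMn, hMn, hMn, hMn, hm1] at key
  apply div_nonpos_of_nonpos_of_nonneg _ (by positivity)
  simp only [Pi.mul_apply, Pi.sub_apply, Pi.pow_apply, Nat.cast_ofNat]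
  norm_num
  rw [hm1]
  have := mul_nonneg key (pow_pos hpos 3).le
  nlinarith
end

section
/- Let V : ℝ → ℝ be smooth and convex, let t > 0, N ≥ 1, and let u₁, …, u_N : [0, ∞) → ℝ be continuous. Let f : [0, ∞) → ℝ be continuous, set F(s) = ∫₀ˢ f(v) dv, and let h₁, …, h_N : [0, ∞) → ℝ be the continuous solutions of h₁(r) = ∫₀ʳ (-V''(u₁(s))·h₁(s) - f(s)) ds and h_j(r) = ∫₀ʳ (-V''(u_j(s))·h_j(s) + V''(u_{j-1}(s))·h_{j-1}(s)) ds for 2 ≤ j ≤ N (so h_j(0) = 0 for all j). Then the pseudo-Gibbs functional satisfies E_N(t)[F] = ∑_{j=1}^N h_j(t) + F(t). Moreover, if f is nonnegative then h_j(t) ≤ 0 for all j and all t ≥ 0. -/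
/-- The pseudo-Gibbs functional, defined recursively. -/
noncomputable def pgE (V : ℝ → ℝ) (u : ℕ → ℝ → ℝ) (F : ℝ → ℝ) : ℕ → ℝ → ℝ
  | 0, s => F s
  | n + 1, r => ∫ s in (0:ℝ)..r,
      Real.exp (-(∫ v in s..r, deriv (deriv V) (u (n + 1) v))) *
        (deriv (deriv V) (u (n + 1) s) * pgE V u F n s)

theorem aux_duhamel (a g y : ℝ → ℝ) (ha : Continuous a) (hg : Continuous g) (hy : Continuous y)
    (H : ∀ r : ℝ, 0 ≤ r → y r = ∫ s in (0:ℝ)..r, (-(a s * y s) + g s)) (r : ℝ) (hr : 0 ≤ r) :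
    y r = ∫ s in (0:ℝ)..r, Real.exp (-(∫ v in s..r, a v)) * g s := by
  have hk : Continuous fun s => -(a s * y s) + g s := by fun_prop
  have hA : ∀ x, HasDerivAt (fun x => ∫ v in (0:ℝ)..x, a v) (a x) x := fun x =>
    intervalIntegral.integral_hasDerivAt_right (ha.intervalIntegrable _ _)
      (ha.stronglyMeasurableAtFilter _ _) ha.continuousAt
  have hz : ∀ x, HasDerivAt (fun x => ∫ s in (0:ℝ)..x, (-(a s * y s) + g s))
      (-(a x * y x) + g x) x := fun x =>
    intervalIntegral.integral_hasDerivAt_right (hk.intervalIntegrable _ _)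
      (hk.stronglyMeasurableAtFilter _ _) hk.continuousAt
  have hAc : Continuous (fun x => ∫ v in (0:ℝ)..x, a v) :=
    continuous_iff_continuousAt.2 fun x => (hA x).continuousAt
  have key : ∫ s in (0:ℝ)..r, Real.exp (∫ v in (0:ℝ)..s, a v) * g s
      = Real.exp (∫ v in (0:ℝ)..r, a v) * y r := by
    rw [intervalIntegral.integral_eq_sub_of_hasDerivAt
      (f := fun x => Real.exp (∫ v in (0:ℝ)..x, a v) * ∫ s in (0:ℝ)..x, (-(a s * y s) + g s))]
    · simp [← H r hr]
    · intro x hx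
      rw [Set.uIcc_of_le hr] at hx
      have := (hA x).exp.mul (hz x)
      rw [← H x hx.1] at this
      refine HasDerivAt.congr_deriv this ?_
      ring
    · exact Continuous.intervalIntegrable (by fun_prop) _ _
  have e : ∀ s, Real.exp (-(∫ v in s..r, a v)) * g s
      = Real.exp (-(∫ v in (0:ℝ)..r, a v)) * (Real.exp (∫ v in (0:ℝ)..s, a v) * g s) := by
    intro s
    rw [← mul_assoc, ← Real.exp_add,
      ← intervalIntegral.integral_add_adjacent_intervals (ha.intervalIntegrable 0 s)
        (ha.intervalIntegrable s r)]
    congr 2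
    ring
  simp_rw [e]
  rw [intervalIntegral.integral_const_mul, key, ← mul_assoc, ← Real.exp_add]
  simp

/-- representation of the pseudo-Gibbs functional of `F(s) = ∫₀ˢ f` through
the solution of the triangular ODE system, and nonpositivity of the `h_j` for `f ≥ 0`. -/
theorem stmt_12 (V : ℝ → ℝ) (hV : ContDiff ℝ (⊤ : ℕ∞) V)
    (hconv : ∀ x : ℝ, 0 ≤ deriv (deriv V) x)
    (t : ℝ) (ht : 0 < t) (N : ℕ) (hN : 1 ≤ N)
    (u : ℕ → ℝ → ℝ) (hu : ∀ j, Continuous (u j))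
    (f : ℝ → ℝ) (hf : Continuous f)
    (F : ℝ → ℝ) (hF : ∀ s : ℝ, F s = ∫ v in (0:ℝ)..s, f v)
    (h : ℕ → ℝ → ℝ) (hcont : ∀ j, Continuous (h j))
    (h1 : ∀ r : ℝ, 0 ≤ r →
      h 1 r = ∫ s in (0:ℝ)..r, (-(deriv (deriv V) (u 1 s) * h 1 s) - f s))
    (hj : ∀ j : ℕ, 2 ≤ j → j ≤ N → ∀ r : ℝ, 0 ≤ r →
      h j r = ∫ s in (0:ℝ)..r,
        (-(deriv (deriv V) (u j s) * h j s)
          + deriv (deriv V) (u (j - 1) s) * h (j - 1) s)) :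
    pgE V u F N t = (∑ j ∈ Finset.Icc 1 N, h j t) + F t ∧
    ((∀ s : ℝ, 0 ≤ f s) → ∀ j ∈ Finset.Icc 1 N, ∀ r : ℝ, 0 ≤ r → h j r ≤ 0) := by
  have hV2 : Continuous (deriv (deriv V)) := by
    have h2 : ContDiff ℝ 2 V := contDiff_infty.1 hV 2
    have := h2.continuous_iteratedDeriv 2 le_rfl
    rwa [iteratedDeriv_succ, iteratedDeriv_one] at this
  have ha : ∀ j, Continuous fun s => deriv (deriv V) (u j s) := fun j => hV2.comp (hu j)
  have hFc : Continuous F := by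
    have : F = fun s => ∫ v in (0:ℝ)..s, f v := funext hF
    rw [this]
    exact intervalIntegral.continuous_primitive (fun _ _ => hf.intervalIntegrable _ _) 0
  have hSc : ∀ n, Continuous fun s => (∑ j ∈ Finset.Icc 1 n, h j s) + F s := fun n =>
    (continuous_finsetSum _ fun j _ => hcont j).add hFc
  have hS : ∀ n, n + 1 ≤ N → ∀ r : ℝ, 0 ≤ r →
      (∑ j ∈ Finset.Icc 1 (n+1), h j r) + F r
        = ∫ s in (0:ℝ)..r, -(deriv (deriv V) (u (n+1) s) * h (n+1) s) := by
    intro n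
    induction n with
    | zero =>
      intro _ r hr
      have c1 : Continuous fun s => -(deriv (deriv V) (u 1 s) * h 1 s) :=
        ((ha 1).mul (hcont 1)).neg
      simp only [zero_add, Finset.Icc_self, Finset.sum_singleton]
      rw [h1 r hr, hF r, intervalIntegral.integral_sub (c1.intervalIntegrable _ _)
        (hf.intervalIntegrable _ _)]
      ring
    | succ n ih =>
      intro hn r hr
      have c1 : Continuous fun s => -(deriv (deriv V) (u (n+1+1) s) * h (n+1+1) s) :=
        ((ha (n+1+1)).mul (hcont (n+1+1))).neg
      have c2 : Continuous fun s => deriv (deriv V) (u (n+1) s) * h (n+1) s :=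
        (ha (n+1)).mul (hcont (n+1))
      have e := hj (n+1+1) (by omega) hn r hr
      have e2 := ih (by omega) r hr
      rw [Nat.add_sub_cancel, intervalIntegral.integral_add (c1.intervalIntegrable _ _)
        (c2.intervalIntegrable _ _)] at e
      rw [intervalIntegral.integral_neg] at e2
      rw [Finset.sum_Icc_succ_top (by omega)]
      linarith
  have hE : ∀ n, n ≤ N → ∀ r : ℝ, 0 ≤ r →
      pgE V u F n r = (∑ j ∈ Finset.Icc 1 n, h j r) + F r := by
    intro n
    induction n with
    | zero => intro _ r _; simp [pgE]
    | succ n ih =>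
      intro hn r hr
      rw [aux_duhamel (fun s => deriv (deriv V) (u (n+1) s))
        (fun s => deriv (deriv V) (u (n+1) s) * ((∑ j ∈ Finset.Icc 1 n, h j s) + F s))
        (fun s => (∑ j ∈ Finset.Icc 1 (n+1), h j s) + F s) (ha _) ((ha _).mul (hSc n))
        (hSc _) ?_ r hr]
      · rw [pgE]
        apply intervalIntegral.integral_congr
        intro s hs
        rw [Set.uIcc_of_le hr] at hs
        simp only [ih (by omega) s hs.1]
      · intro r hr
        rw [hS n hn r hr]
        congr 1
        funext s
        rw [Finset.sum_Icc_succ_top (by omega)]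
        ring
  refine ⟨hE N le_rfl t ht.le, ?_⟩
  intro hf0
  have hneg : ∀ n, n + 1 ≤ N → ∀ r : ℝ, 0 ≤ r → h (n+1) r ≤ 0 := by
    intro n
    have fin : ∀ (b g : ℝ → ℝ) (r : ℝ), 0 ≤ r → (∀ s, 0 ≤ s → g s ≤ 0) →
        ∫ s in (0:ℝ)..r, Real.exp (-(∫ v in s..r, b v)) * g s ≤ 0 := by
      intro b g r hr hg
      rw [← neg_nonneg, ← intervalIntegral.integral_neg]
      apply intervalIntegral.integral_nonneg hr
      intro s hs
      have := mul_nonneg (Real.exp_pos (-(∫ v in s..r, b v))).le (neg_nonneg.2 (hg s hs.1))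
      linarith
    induction n with
    | zero =>
      intro _ r hr
      rw [zero_add, aux_duhamel _ (fun s => - f s) (h 1) (ha 1) hf.neg (hcont 1)
        (fun r hr => by simpa only [sub_eq_add_neg] using h1 r hr) r hr]
      exact fin _ _ r hr fun s _ => neg_nonpos.2 (hf0 s)
    | succ n ih =>
      intro hn r hr
      rw [aux_duhamel _ _ (h (n+1+1)) (ha (n+1+1)) ((ha (n+1)).mul (hcont (n+1))) (hcont _)
        (fun r hr => hj (n+1+1) (by omega) hn r hr) r hr]
      exact fin _ _ r hr fun s hs =>
        mul_nonpos_of_nonneg_of_nonpos (hconv _) (ih (by omega) s hs)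
  intro j hjm r hr
  obtain ⟨h1j, hjN⟩ := Finset.mem_Icc.1 hjm
  obtain ⟨k, rfl⟩ : ∃ k, j = k + 1 := ⟨j - 1, by omega⟩
  exact hneg k hjN r hr
end

section
/- Let V : ℝ → ℝ be smooth with V''(x) ≥ 0 for all x, and suppose there is c₀ > 0 with c₀·V''(x) ≤ -V'''(x) for all x. Let N ≥ 1 and let u₁, …, u_N : [0, ∞) → ℝ be continuous. Let h_j, k_j, m_j : [0, ∞) → ℝ (1 ≤ j ≤ N) be continuous solutions, in integral form, of: h₁' = -V''(u₁)h₁ - 1 and h_j' = -V''(u_j)h_j + V''(u_{j-1})h_{j-1} with h_j(0) = 0; k₁' = -V''(u₁)k₁ and k_j' = -V''(u_j)k_j + V''(u_{j-1})k_{j-1} with k_j(0) ≤ 0; m₁' = -V''(u₁)m₁ - V'''(u₁)h₁k₁ and m_j' = -V''(u_j)m_j + V''(u_{j-1})m_{j-1} - V'''(u_j)h_jk_j + V'''(u_{j-1})h_{j-1}k_{j-1} with m_j(0) = 0. Then for every n ≤ N and every t ≥ 0, the quantity Aₙ(t) := ∑_{j=1}^n m_j(t) + c₀·(t + ∑_{j=1}^n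 h_j(t))·(∑_{j=1}^n k_j(t)) satisfies Aₙ(t) ≥ 0; consequently 0 ≤ -(∑_{j=1}^n k_j(t))·(t + ∑_{j=1}^n h_j(t)) ≤ (1/c₀)·∑_{j=1}^n m_j(t). -/
theorem aux_deriv (f F : ℝ → ℝ) (C : ℝ) (hF : Continuous F)
    (hf : ∀ r : ℝ, 0 ≤ r → f r = C + ∫ s in (0:ℝ)..r, F s) :
    ∀ t : ℝ, 0 < t → HasDerivAt f (F t) t := by
  intro t ht
  have h1 : HasDerivAt (fun r => C + ∫ s in (0:ℝ)..r, F s) (F t) t :=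
    (intervalIntegral.integral_hasDerivAt_right (hF.intervalIntegrable _ _)
      (hF.stronglyMeasurableAtFilter _ _) hF.continuousAt).const_add C
  refine h1.congr_of_eventuallyEq ?_
  filter_upwards [Ioi_mem_nhds ht] with r hr
  exact hf r (le_of_lt hr)

theorem aux_cmp (f a g : ℝ → ℝ) (ha : Continuous a) (hf : Continuous f) (h0 : 0 ≤ f 0)
    (hd : ∀ t : ℝ, 0 < t → HasDerivAt f (-(a t * f t) + g t) t)
    (hg : ∀ t : ℝ, 0 < t → 0 ≤ g t) : ∀ t : ℝ, 0 ≤ t → 0 ≤ f t := by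
  have hE : ∀ t : ℝ, HasDerivAt (fun r => ∫ s in (0:ℝ)..r, a s) (a t) t := fun t =>
    intervalIntegral.integral_hasDerivAt_right (ha.intervalIntegrable _ _)
      (ha.stronglyMeasurableAtFilter _ _) ha.continuousAt
  have hEc : Continuous (fun r => ∫ s in (0:ℝ)..r, a s) :=
    continuous_iff_continuousAt.2 fun t => (hE t).continuousAt
  have hmono : MonotoneOn (fun r => Real.exp (∫ s in (0:ℝ)..r, a s) * f r) (Set.Ici 0) := by
    have hder : ∀ t : ℝ, 0 < t →
        HasDerivAt (fun r => Real.exp (∫ s in (0:ℝ)..r, a s) * f r)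
          (Real.exp (∫ s in (0:ℝ)..t, a s) * g t) t := by
      intro t ht
      refine HasDerivAt.congr_deriv (((hE t).exp).mul (hd t ht)) ?_
      ring
    apply monotoneOn_of_deriv_nonneg (convex_Ici 0)
    · exact ((Real.continuous_exp.comp hEc).mul hf).continuousOn
    · intro t ht
      rw [interior_Ici] at ht
      exact (hder t ht).differentiableAt.differentiableWithinAt
    · intro t ht
      rw [interior_Ici] at ht
      rw [(hder t ht).deriv]
      exact mul_nonneg (Real.exp_pos _).le (hg t ht)
  intro t ht
  have h1 := hmono (Set.mem_Ici.2 le_rfl) (Set.mem_Ici.2 ht) ht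
  simp only [intervalIntegral.integral_same, Real.exp_zero, one_mul] at h1
  exact nonneg_of_mul_nonneg_right (h0.trans h1) (Real.exp_pos _)

/-- pathwise nonnegativity of
`Aₙ(t) = ∑ m_j(t) + c₀·(t + ∑ h_j(t))·(∑ k_j(t))` and the consequent two-sided bound
`0 ≤ -(∑k)(t+∑h) ≤ (1/c₀)∑m` for the triangular derivative systems. -/
theorem stmt_13 (V : ℝ → ℝ) (hV : ContDiff ℝ (⊤ : ℕ∞) V)
    (hconv : ∀ x : ℝ, 0 ≤ deriv (deriv V) x)
    (c₀ : ℝ) (hc₀ : 0 < c₀)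
    (hV3 : ∀ x : ℝ, c₀ * deriv (deriv V) x ≤ -(deriv (deriv (deriv V)) x))
    (N : ℕ) (hN : 1 ≤ N) (u h k m : ℕ → ℝ → ℝ)
    (hu : ∀ j, Continuous (u j)) (hh : ∀ j, Continuous (h j))
    (hk : ∀ j, Continuous (k j)) (hm : ∀ j, Continuous (m j))
    (hh1 : ∀ r : ℝ, 0 ≤ r →
      h 1 r = ∫ s in (0:ℝ)..r, (-(deriv (deriv V) (u 1 s) * h 1 s) - 1))
    (hhj : ∀ j : ℕ, 2 ≤ j → j ≤ N → ∀ r : ℝ, 0 ≤ r →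
      h j r = ∫ s in (0:ℝ)..r,
        (-(deriv (deriv V) (u j s) * h j s)
          + deriv (deriv V) (u (j - 1) s) * h (j - 1) s))
    (hk0 : ∀ j : ℕ, 1 ≤ j → j ≤ N → k j 0 ≤ 0)
    (hk1 : ∀ r : ℝ, 0 ≤ r →
      k 1 r = k 1 0 + ∫ s in (0:ℝ)..r, (-(deriv (deriv V) (u 1 s) * k 1 s)))
    (hkj : ∀ j : ℕ, 2 ≤ j → j ≤ N → ∀ r : ℝ, 0 ≤ r →
      k j r = k j 0 + ∫ s in (0:ℝ)..r,
        (-(deriv (deriv V) (u j s) * k j s)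
          + deriv (deriv V) (u (j - 1) s) * k (j - 1) s))
    (hm1 : ∀ r : ℝ, 0 ≤ r →
      m 1 r = ∫ s in (0:ℝ)..r,
        (-(deriv (deriv V) (u 1 s) * m 1 s)
          - deriv (deriv (deriv V)) (u 1 s) * (h 1 s * k 1 s)))
    (hmj : ∀ j : ℕ, 2 ≤ j → j ≤ N → ∀ r : ℝ, 0 ≤ r →
      m j r = ∫ s in (0:ℝ)..r,
        (-(deriv (deriv V) (u j s) * m j s)
          + deriv (deriv V) (u (j - 1) s) * m (j - 1) s
          - deriv (deriv (deriv V)) (u j s) * (h j s * k j s)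
          + deriv (deriv (deriv V)) (u (j - 1) s) * (h (j - 1) s * k (j - 1) s))) :
    ∀ n : ℕ, 1 ≤ n → n ≤ N → ∀ t : ℝ, 0 ≤ t →
      (0 ≤ (∑ j ∈ Finset.Icc 1 n, m j t)
          + c₀ * ((t + ∑ j ∈ Finset.Icc 1 n, h j t) * (∑ j ∈ Finset.Icc 1 n, k j t))) ∧
      (0 ≤ -((∑ j ∈ Finset.Icc 1 n, k j t) * (t + ∑ j ∈ Finset.Icc 1 n, h j t))) ∧
      (-((∑ j ∈ Finset.Icc 1 n, k j t) * (t + ∑ j ∈ Finset.Icc 1 n, h j t))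
        ≤ (1 / c₀) * ∑ j ∈ Finset.Icc 1 n, m j t) := by
  have c1 : ContDiff ℝ (⊤ : ℕ∞) (deriv V) := (contDiff_infty_iff_deriv.1 hV).2
  have c2 : ContDiff ℝ (⊤ : ℕ∞) (deriv (deriv V)) := (contDiff_infty_iff_deriv.1 c1).2
  have c3 : ContDiff ℝ (⊤ : ℕ∞) (deriv (deriv (deriv V))) := (contDiff_infty_iff_deriv.1 c2).2
  have hV2c := c2.continuous
  have hV3c := c3.continuous
  clear c1 c2 c3 hV
  generalize deriv (deriv (deriv V)) = B at *
  generalize deriv (deriv V) = A at *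
  have ca : ∀ j, Continuous (fun s => A (u j s)) := fun j => hV2c.comp (hu j)
  have cb : ∀ j, Continuous (fun s => B (u j s)) := fun j => hV3c.comp (hu j)
  -- derivatives
  have dh1 := aux_deriv (h 1) _ 0 (((ca 1).mul (hh 1)).neg.sub continuous_const)
    (fun r hr => by rw [zero_add]; exact hh1 r hr)
  have dhj := fun j h2 hj => aux_deriv (h j) _ 0
    (((ca j).mul (hh j)).neg.add ((ca (j-1)).mul (hh (j-1))))
    (fun r hr => by rw [zero_add]; exact hhj j h2 hj r hr)
  have dk1 := aux_deriv (k 1) _ (k 1 0) (((ca 1).mul (hk 1)).neg) (fun r hr => hk1 r hr)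
  have dkj := fun j h2 hj => aux_deriv (k j) _ (k j 0)
    (((ca j).mul (hk j)).neg.add ((ca (j-1)).mul (hk (j-1))))
    (fun r hr => hkj j h2 hj r hr)
  have dm1 := aux_deriv (m 1) _ 0
    (((ca 1).mul (hm 1)).neg.sub ((cb 1).mul ((hh 1).mul (hk 1))))
    (fun r hr => by rw [zero_add]; exact hm1 r hr)
  have dmj := fun j h2 hj => aux_deriv (m j) _ 0
    (((((ca j).mul (hm j)).neg.add ((ca (j-1)).mul (hm (j-1)))).sub
      ((cb j).mul ((hh j).mul (hk j)))).add ((cb (j-1)).mul ((hh (j-1)).mul (hk (j-1)))))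
    (fun r hr => by rw [zero_add]; exact hmj j h2 hj r hr)
  -- initial values
  have h0 : ∀ j, 1 ≤ j → j ≤ N → h j 0 = 0 := by
    intro j h1 hj
    rcases h1.eq_or_lt with rfl | h2
    · simpa using hh1 0 le_rfl
    · simpa using hhj j h2 hj 0 le_rfl
  have m0 : ∀ j, 1 ≤ j → j ≤ N → m j 0 = 0 := by
    intro j h1 hj
    rcases h1.eq_or_lt with rfl | h2
    · simpa using hm1 0 le_rfl
    · simpa using hmj j h2 hj 0 le_rfl
  -- signs
  have sh : ∀ j, 1 ≤ j → j ≤ N → ∀ t : ℝ, 0 ≤ t → 0 ≤ -h j t := by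
    intro j h1
    induction j, h1 using Nat.le_induction with
    | base =>
      intro hj
      refine aux_cmp (fun t => -h 1 t) _ (fun _ => 1) (ca 1) (hh 1).neg (by simp [h0 1 le_rfl hj])
        (fun t ht => ?_) (fun t ht => zero_le_one)
      refine HasDerivAt.congr_deriv ((dh1 t ht).neg) ?_
      simp
      try ring
    | succ j h1 ih =>
      intro hj
      refine aux_cmp (fun t => -h (j+1) t) _ (fun t => A (u j t) * (-h j t)) (ca (j+1))
        (hh (j+1)).neg (by simp [h0 (j+1) (by omega) hj])
        (fun t ht => ?_) (fun t ht => mul_nonneg (hconv _) (ih (by omega) t ht.le))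
      refine HasDerivAt.congr_deriv ((dhj (j+1) (by omega) hj t ht).neg) ?_
      simp
      try ring
  have sk : ∀ j, 1 ≤ j → j ≤ N → ∀ t : ℝ, 0 ≤ t → 0 ≤ -k j t := by
    intro j h1
    induction j, h1 using Nat.le_induction with
    | base =>
      intro hj
      refine aux_cmp (fun t => -k 1 t) _ (fun _ => 0) (ca 1) (hk 1).neg
        (by have := hk0 1 le_rfl hj; simpa using this)
        (fun t ht => ?_) (fun t ht => le_rfl)
      refine HasDerivAt.congr_deriv ((dk1 t ht).neg) ?_
      simp
      try ring
    | succ j h1 ih =>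
      intro hj
      refine aux_cmp (fun t => -k (j+1) t) _ (fun t => A (u j t) * (-k j t)) (ca (j+1))
        (hk (j+1)).neg (by have := hk0 (j+1) (by omega) hj; simpa using this)
        (fun t ht => ?_) (fun t ht => mul_nonneg (hconv _) (ih (by omega) t ht.le))
      refine HasDerivAt.congr_deriv ((dkj (j+1) (by omega) hj t ht).neg) ?_
      simp
      try ring
  -- partial sums
  obtain ⟨H, hH⟩ : ∃ H : ℕ → ℝ → ℝ, H = fun n t => t + ∑ j ∈ Finset.Icc 1 n, h j t := ⟨_, rfl⟩
  obtain ⟨K, hK⟩ : ∃ K : ℕ → ℝ → ℝ, K = fun n t => ∑ j ∈ Finset.Icc 1 n, k j t := ⟨_, rfl⟩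
  obtain ⟨M, hM⟩ : ∃ M : ℕ → ℝ → ℝ, M = fun n t => ∑ j ∈ Finset.Icc 1 n, m j t := ⟨_, rfl⟩
  have Hz : ∀ t, H 0 t = t := by intro t; simp [hH]
  have Kz : ∀ t, K 0 t = 0 := by intro t; simp [hK]
  have Mz : ∀ t, M 0 t = 0 := by intro t; simp [hM]
  have Hs : ∀ n t, H (n+1) t = H n t + h (n+1) t := by
    intro n t; simp only [hH]; rw [Finset.sum_Icc_succ_top (by omega)]; ring
  have Ks : ∀ n t, K (n+1) t = K n t + k (n+1) t := by
    intro n t; simp only [hK]; rw [Finset.sum_Icc_succ_top (by omega)]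
  have Ms : ∀ n t, M (n+1) t = M n t + m (n+1) t := by
    intro n t; simp only [hM]; rw [Finset.sum_Icc_succ_top (by omega)]
  have Hc : ∀ n, Continuous (H n) := by
    intro n; rw [hH]; exact continuous_id.add (continuous_finsetSum _ fun j _ => hh j)
  have Kc : ∀ n, Continuous (K n) := by
    intro n; rw [hK]; exact continuous_finsetSum _ fun j _ => hk j
  have Mc : ∀ n, Continuous (M n) := by
    intro n; rw [hM]; exact continuous_finsetSum _ fun j _ => hm j
  have H0 : ∀ n, n ≤ N → H n 0 = 0 := by
    intro n
    induction n with
    | zero => intro _; exact Hz 0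
    | succ n ih => intro hn; rw [Hs, ih (by omega), h0 (n+1) (by omega) hn, add_zero]
  have M0 : ∀ n, n ≤ N → M n 0 = 0 := by
    intro n
    induction n with
    | zero => intro _; exact Mz 0
    | succ n ih => intro hn; rw [Ms, ih (by omega), m0 (n+1) (by omega) hn, add_zero]
  have Hd : ∀ n, n + 1 ≤ N → ∀ t : ℝ, 0 < t →
      HasDerivAt (H (n+1)) (-(A (u (n+1) t) * h (n+1) t)) t := by
    intro n
    induction n with
    | zero =>
      intro hn t ht
      have e : H (0+1) = fun t => t + h 1 t := by funext t; rw [Hs, Hz]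
      rw [e]
      refine HasDerivAt.congr_deriv ((hasDerivAt_id t).add (dh1 t ht)) ?_
      simp
    | succ n ih =>
      intro hn t ht
      have e : H (n+1+1) = fun t => H (n+1) t + h (n+1+1) t := by funext t; rw [Hs]
      rw [e]
      refine HasDerivAt.congr_deriv ((ih (by omega) t ht).add (dhj (n+1+1) (by omega) hn t ht)) ?_
      simp
  have Kd : ∀ n, n + 1 ≤ N → ∀ t : ℝ, 0 < t →
      HasDerivAt (K (n+1)) (-(A (u (n+1) t) * k (n+1) t)) t := by
    intro n
    induction n with
    | zero =>
      intro hn t ht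
      have e : K (0+1) = k 1 := by funext t; rw [Ks, Kz, zero_add]
      rw [e]
      exact dk1 t ht
    | succ n ih =>
      intro hn t ht
      have e : K (n+1+1) = fun t => K (n+1) t + k (n+1+1) t := by funext t; rw [Ks]
      rw [e]
      refine HasDerivAt.congr_deriv ((ih (by omega) t ht).add (dkj (n+1+1) (by omega) hn t ht)) ?_
      simp
  have Md : ∀ n, n + 1 ≤ N → ∀ t : ℝ, 0 < t →
      HasDerivAt (M (n+1)) (-(A (u (n+1) t) * m (n+1) t)
        - B (u (n+1) t) * (h (n+1) t * k (n+1) t)) t := by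
    intro n
    induction n with
    | zero =>
      intro hn t ht
      have e : M (0+1) = m 1 := by funext t; rw [Ms, Mz, zero_add]
      rw [e]
      exact dm1 t ht
    | succ n ih =>
      intro hn t ht
      have e : M (n+1+1) = fun t => M (n+1) t + m (n+1+1) t := by funext t; rw [Ms]
      rw [e]
      refine HasDerivAt.congr_deriv ((ih (by omega) t ht).add (dmj (n+1+1) (by omega) hn t ht)) ?_
      simp
      ring
  have Hpos : ∀ n, n ≤ N → ∀ t : ℝ, 0 ≤ t → 0 ≤ H n t := by
    intro n
    induction n with
    | zero => intro _ t ht; rw [Hz]; exact ht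
    | succ n ih =>
      intro hn
      refine aux_cmp (H (n+1)) _ (fun t => A (u (n+1) t) * H n t) (ca (n+1)) (Hc _)
        (H0 _ hn).ge (fun t ht => ?_) (fun t ht => mul_nonneg (hconv _) (ih (by omega) t ht.le))
      refine HasDerivAt.congr_deriv (Hd n hn t ht) ?_
      simp only [Hs]
      ring
  have Kneg : ∀ n, n ≤ N → ∀ t : ℝ, 0 ≤ t → K n t ≤ 0 := by
    intro n
    induction n with
    | zero => intro _ t ht; rw [Kz]
    | succ n ih =>
      intro hn t ht
      have := ih (by omega) t ht
      have := sk (n+1) (by omega) hn t ht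
      rw [Ks]; linarith
  have Apos : ∀ n, n ≤ N → ∀ t : ℝ, 0 ≤ t → 0 ≤ M n t + c₀ * (H n t * K n t) := by
    intro n
    induction n with
    | zero => intro _ t ht; rw [Mz, Kz]; simp
    | succ n ih =>
      intro hn
      refine aux_cmp (fun t => M (n+1) t + c₀ * (H (n+1) t * K (n+1) t)) _
        (fun t => A (u (n+1) t) * (M n t + c₀ * (H n t * K n t))
          + (-(B (u (n+1) t)) - c₀ * A (u (n+1) t)) * ((-h (n+1) t) * (-k (n+1) t)))
        (ca (n+1)) ((Mc _).add (continuous_const.mul ((Hc _).mul (Kc _))))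
        (by simp [H0 _ hn, M0 _ hn]) (fun t ht => ?_) (fun t ht => ?_)
      · refine HasDerivAt.congr_deriv ((Md n hn t ht).add (((Hd n hn t ht).mul (Kd n hn t ht)).const_mul c₀)) ?_
        simp only [Hs, Ks, Ms]
        ring
      · exact add_nonneg (mul_nonneg (hconv _) (ih (by omega) t ht.le))
          (mul_nonneg (by linarith [hV3 (u (n+1) t)])
            (mul_nonneg (sh (n+1) (by omega) hn t ht.le) (sk (n+1) (by omega) hn t ht.le)))
  intro n _ hn t ht
  have a1 := Apos n hn t ht
  have a2 := Hpos n hn t ht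
  have a3 := Kneg n hn t ht
  simp only [hH, hK, hM] at a1 a2 a3
  refine ⟨a1, ?_, ?_⟩
  · have := mul_nonneg (neg_nonneg.2 a3) a2
    linarith
  · rw [one_div, inv_mul_eq_div, le_div_iff₀ hc₀]
    linarith
end

section
/- Let V be of O'Connell–Yor type and let η₀ > 0. Then there is a constant C > 0 such that for every η ∈ [η₀/2, 2η₀] and every q ∈ (0, 1), the map η ↦ H_η(q) is twice differentiable and satisfies |∂_η H_η(q)| ≤ C·(1 + |H_η(q)|) and |∂_η² H_η(q)| ≤ C·(1 + |H_η(q)|²)·(1 + V(H_η(q))). -/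
open MeasureTheory Set Filter Topology

noncomputable def OYM (V : ℝ → ℝ) (k : ℕ) (s : Set ℝ) (η : ℝ) : ℝ :=
  ∫ y in s, y ^ k * Real.exp (-(η * y) - V y)

noncomputable def OYw (V : ℝ → ℝ) (η x : ℝ) : ℝ := Real.exp (-(η * x) - V x)

lemma OY_tangent {V : ℝ → ℝ} (hd : Differentiable ℝ V) (hm : Monotone (deriv V)) (x y : ℝ) :
    V x + deriv V x * (y - x) ≤ V y := by
  have hc : ConvexOn ℝ univ V := (hm.convexOn_univ_of_deriv hd)
  rcases lt_trichotomy x y with h | h | h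
  · have := hc.deriv_le_slope (mem_univ x) (mem_univ y) h (hd x)
    rw [slope_def_field, le_div_iff₀ (by linarith)] at this
    linarith
  · subst h; simp
  · have := hc.slope_le_deriv (mem_univ y) (mem_univ x) h (hd x)
    rw [slope_def_field, div_le_iff₀ (by linarith)] at this
    nlinarith

/-- the derivative is very negative to the left -/
lemma OY_exists_K {V : ℝ → ℝ} (hd : Differentiable ℝ V) (hm : Monotone (deriv V))
    (h0 : ∀ x, 0 ≤ V x)
    (hq : ∃ c > (0:ℝ), ∃ C > (0:ℝ), ∀ x : ℝ, x ≤ -C → c * x ^ 2 ≤ V x) (L : ℝ) :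
    ∃ K > (0:ℝ), deriv V (-K) ≤ -L := by
  obtain ⟨c, hc, C, hC, h⟩ := hq
  set K := max (max C 1) ((V 0 + |L|) / c) with hK
  have h1 : C ≤ K := (le_max_left _ _).trans (le_max_left _ _)
  have h2 : 1 ≤ K := (le_max_right _ _).trans (le_max_left _ _)
  have h3 : (V 0 + |L|) / c ≤ K := le_max_right _ _
  rw [div_le_iff₀ hc] at h3
  refine ⟨K, by linarith, ?_⟩
  have h4 := OY_tangent hd hm (-K) 0
  have h5 := h (-K) (by linarith)
  have h6 := h0 0
  have h7 := le_abs_self L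
  by_contra hcon
  push Not at hcon
  have h8 : -|L| * K ≤ deriv V (-K) * K := by
    apply mul_le_mul_of_nonneg_right _ (by linarith)
    linarith
  nlinarith [mul_le_mul_of_nonneg_right h3 (by linarith : 0 ≤ K)]

lemma OY_integrable_aux {V : ℝ → ℝ} (hd : Differentiable ℝ V) (hm : Monotone (deriv V))
    (h0 : ∀ x, 0 ≤ V x)
    (hq : ∃ c > (0:ℝ), ∃ C > (0:ℝ), ∀ x : ℝ, x ≤ -C → c * x ^ 2 ≤ V x) {η : ℝ} (hη : 0 < η) :
    Integrable (fun y => Real.exp (-(η * y) - V y)) := by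
  obtain ⟨K, hK, hKd⟩ := OY_exists_K hd hm h0 hq (η + 1)
  have hcont : Continuous (fun y => Real.exp (-(η * y) - V y)) := by
    have := hd.continuous
    fun_prop
  rw [← integrableOn_univ, ← Iic_union_Ioi (a := -K)]
  apply IntegrableOn.union
  · have := (integrableOn_exp_mul_Iic (a := 1) one_pos (-K)).const_mul
      (Real.exp (-V (-K) + (η + 1) * K))
    refine Integrable.mono' this hcont.aestronglyMeasurable ?_
    refine (ae_restrict_iff' measurableSet_Iic).2 (ae_of_all _ fun y hy => ?_)
    rw [Real.norm_of_nonneg (Real.exp_pos _).le, ← Real.exp_add]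
    apply Real.exp_le_exp.2
    have := OY_tangent hd hm (-K) y
    have hy' : y ≤ -K := hy
    nlinarith
  · have := (integrableOn_exp_mul_Ioi (a := -η) (by linarith) (-K))
    refine Integrable.mono' this hcont.aestronglyMeasurable ?_
    refine (ae_restrict_iff' measurableSet_Ioi).2 (ae_of_all _ fun y hy => ?_)
    rw [Real.norm_of_nonneg (Real.exp_pos _).le]
    apply Real.exp_le_exp.2
    have := h0 y
    linarith

lemma OY_M_hasDeriv {V : ℝ → ℝ} (hV : Continuous V)
    (hi : ∀ η : ℝ, 0 < η → Integrable (fun y => Real.exp (-(η * y) - V y)))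
    (k : ℕ) {η : ℝ} (hη : 0 < η) :
    Integrable (fun y => y ^ k * Real.exp (-(η * y) - V y)) ∧
    ∀ s : Set ℝ, MeasurableSet s → 
      HasDerivAt (OYM V k s) (- OYM V (k + 1) s η) η := by
  set d : ℝ → ENNReal := fun y => ENNReal.ofReal (Real.exp (-V y)) with hd
  have hdm : Measurable d := by
    have := hV.measurable
    fun_prop
  have hdt : ∀ y, d y < ⊤ := fun y => ENNReal.ofReal_lt_top
  set μ := (volume : Measure ℝ).withDensity d with hμ
  have hint : ∀ g : ℝ → ℝ, Integrable g μ ↔ Integrable (fun y => Real.exp (-V y) * g y) := by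
    intro g
    rw [hμ, integrable_withDensity_iff_integrable_smul' hdm (ae_of_all _ hdt)]
    simp [hd, Real.exp_nonneg]
  have hsub : Iio (0:ℝ) ⊆ ProbabilityTheory.integrableExpSet (fun y => y) μ := by
    intro t ht
    have ht' : t < 0 := ht
    show Integrable _ _
    rw [hint]
    refine (hi (-t) (by linarith)).congr (ae_of_all _ fun y => ?_)
    simp only
    rw [← Real.exp_add]; congr 1; ring
  have hsub' : ∀ s : Set ℝ, Iio (0:ℝ) ⊆ 
      interior (ProbabilityTheory.integrableExpSet (fun y => y) (μ.restrict s)) := by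
    intro s
    apply interior_maximal _ isOpen_Iio
    intro t ht
    exact Integrable.integrableOn (hsub ht)
  have hconv : ∀ (k : ℕ) (s : Set ℝ), MeasurableSet s → ∀ t : ℝ, 
     ∫ y in s, y ^ k * Real.exp (t * y) ∂μ = OYM V k s (-t) := by
    intro k s hs t
    rw [hμ, setIntegral_withDensity_eq_setIntegral_toReal_smul hdm (ae_of_all _ hdt) _ hs, OYM]
    apply integral_congr_ae (ae_of_all _ fun y => ?_)
    simp only [hd, smul_eq_mul]
    rw [ENNReal.toReal_ofReal (Real.exp_nonneg _), mul_left_comm, ← Real.exp_add]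
    congr 2; ring
  constructor
  · have h1 := ProbabilityTheory.integrable_pow_mul_exp_of_mem_interior_integrableExpSet
      (hsub' univ (show -η ∈ Iio (0:ℝ) by simpa using hη)) k
    rw [Measure.restrict_univ, hint] at h1
    refine h1.congr (ae_of_all _ fun y => ?_)
    simp only
    rw [mul_left_comm, ← Real.exp_add]; congr 2; ring
  · intro s hs
    have h1 := ProbabilityTheory.hasDerivAt_integral_pow_mul_exp_real
      (hsub' s (show -η ∈ Iio (0:ℝ) by simpa using hη)) k
    simp only [hconv _ s hs] at h1
    rw [neg_neg] at h1
    have h2 := HasDerivAt.scomp (𝕜 := ℝ) η (h := fun x : ℝ => -x) (h' := -1) h1 (hasDerivAt_neg η)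
    convert! h2 using 1
    · ext x; simp
    · simp

lemma OY_M_Iic_eq {V : ℝ → ℝ} 
    (hi : ∀ k : ℕ, ∀ η : ℝ, 0 < η → Integrable (fun y => y ^ k * Real.exp (-(η * y) - V y)))
    (k : ℕ) {η : ℝ} (hη : 0 < η) (x : ℝ) :
    OYM V k (Iic x) η = OYM V k (Iic 0) η + ∫ y in (0:ℝ)..x, y ^ k * Real.exp (-(η * y) - V y) := by
  rw [← intervalIntegral.integral_Iic_sub_Iic (hi k η hη).integrableOn (hi k η hη).integrableOn]
  simp [OYM]

noncomputable def OYN (V : ℝ → ℝ) (q : ℝ) (k : ℕ) (η x : ℝ) : ℝ :=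
  OYM V k (Iic x) η - q * OYM V k univ η

section
variable {V : ℝ → ℝ} (hV : Continuous V)
    (hi : ∀ η : ℝ, 0 < η → Integrable (fun y => Real.exp (-(η * y) - V y)))
include hV hi

lemma OY_N_d1 (q : ℝ) (k : ℕ) {η : ℝ} (hη : 0 < η) (x : ℝ) :
    HasDerivAt (fun e => OYN V q k e x) (- OYN V q (k + 1) η x) η := by
  have h1 := (OY_M_hasDeriv hV hi k hη).2 (Iic x) measurableSet_Iic
  have h2 := (OY_M_hasDeriv hV hi k hη).2 univ MeasurableSet.univ
  convert! h1.sub (h2.const_mul q) using 1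
  simp only [OYN]; ring

lemma OY_N_d2 (q : ℝ) (k : ℕ) {η : ℝ} (hη : 0 < η) (x : ℝ) :
    HasDerivAt (fun y => OYN V q k η y) (x ^ k * OYw V η x) x := by
  have hi' := fun k η hη => (OY_M_hasDeriv hV hi k (η := η) hη).1
  have hc : Continuous (fun y => y ^ k * Real.exp (-(η * y) - V y)) := by fun_prop
  have h1 := hc.integral_hasStrictDerivAt 0 x
  have h2 := (h1.hasDerivAt.const_add (OYM V k (Iic 0) η)).sub_const (q * OYM V k univ η)
  convert! h2 using 1
  ext y
  simp only [OYN]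
  rw [OY_M_Iic_eq hi' k hη]
  

lemma OY_N_cont (q : ℝ) (k : ℕ) {η : ℝ} (hη : 0 < η) (x : ℝ) :
    ContinuousAt (fun p : ℝ × ℝ => OYN V q k p.1 p.2) (η, x) := by
  have hi' := fun k η hη => (OY_M_hasDeriv hV hi k (η := η) hη).1
  have h1 : ContinuousAt (fun e => OYM V k (Iic 0) e - q * OYM V k univ e) η := by
    have h1 := (OY_M_hasDeriv hV hi k hη).2 (Iic 0) measurableSet_Iic
    have h2 := (OY_M_hasDeriv hV hi k hη).2 univ MeasurableSet.univ
    exact (h1.sub (h2.const_mul q)).continuousAt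
  have h2 : Continuous (fun p : ℝ × ℝ => ∫ y in (0:ℝ)..p.2, y ^ k * Real.exp (-(p.1 * y) - V y)) := by
    apply intervalIntegral.continuous_parametric_intervalIntegral_of_continuous
    · fun_prop
    · fun_prop
  have h3 : ContinuousAt (fun p : ℝ × ℝ => (OYM V k (Iic 0) p.1 - q * OYM V k univ p.1) + 
      ∫ y in (0:ℝ)..p.2, y ^ k * Real.exp (-(p.1 * y) - V y)) (η, x) := by
    refine ContinuousAt.add ?_ h2.continuousAt
    exact ContinuousAt.comp (f := Prod.fst) (x := (η, x)) h1 continuousAt_fst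
  refine h3.congr ?_
  have : ∀ᶠ p : ℝ × ℝ in 𝓝 (η, x), 0 < p.1 :=
    continuousAt_fst.eventually (lt_mem_nhds hη)
  filter_upwards [this] with p hp
  simp only [OYN]
  rw [OY_M_Iic_eq hi' k hp p.2]
  ring

lemma OY_N_strict (q : ℝ) (k : ℕ) {η : ℝ} (hη : 0 < η) (x : ℝ) :
    HasStrictFDerivAt (fun p : ℝ × ℝ => OYN V q k p.1 p.2) 
      (((- OYN V q (k + 1) η x) • (1 : ℝ →L[ℝ] ℝ)).coprod 
        ((x ^ k * OYw V η x) • (1 : ℝ →L[ℝ] ℝ))) (η, x) := by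
  have hpos : ∀ᶠ p : ℝ × ℝ in 𝓝 (η, x), 0 < p.1 :=
    continuousAt_fst.eventually (lt_mem_nhds hη)
  refine hasStrictFDerivAt_uncurry_coprod (u := (η, x)) (f := OYN V q k)
    (f₁ := fun η x => (- OYN V q (k + 1) η x) • (1 : ℝ →L[ℝ] ℝ)) 
    (f₂ := fun η x => (x ^ k * OYw V η x) • (1 : ℝ →L[ℝ] ℝ)) ?_ ?_ ?_ ?_
  · filter_upwards [hpos] with p hp
    have := (OY_N_d1 hV hi q k hp p.2).hasFDerivAt
    convert! this using 1
    ext; simp [Function.HasUncurry.uncurry]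
  · filter_upwards [hpos] with p hp
    have := (OY_N_d2 hV hi q k hp p.2).hasFDerivAt
    convert! this using 1
    ext; simp [Function.HasUncurry.uncurry]
  · exact (OY_N_cont hV hi q (k+1) hη x).neg.smul continuousAt_const
  · refine ContinuousAt.smul (f := fun p : ℝ × ℝ => p.2 ^ k * OYw V p.1 p.2) ?_ continuousAt_const
    unfold OYw
    fun_prop

lemma OY_N_chain (q : ℝ) (k : ℕ) {η : ℝ} (hη : 0 < η) {h : ℝ → ℝ} {h' : ℝ}
    (hh : HasDerivAt h h' η) :
    HasDerivAt (fun e => OYN V q k e (h e)) 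
      (- OYN V q (k + 1) η (h η) + (h η) ^ k * OYw V η (h η) * h') η := by
  have h1 := (OY_N_strict hV hi q k hη (h η)).hasFDerivAt
  have h2 := h1.comp_hasDerivAt η ((hasDerivAt_id η).prodMk hh)
  convert! h2 using 1
  simp

lemma OY_N_mono (q : ℝ) {η : ℝ} (hη : 0 < η) : StrictMono (fun y => OYN V q 0 η y) := by
  apply strictMono_of_deriv_pos
  intro x
  rw [(OY_N_d2 hV hi q 0 hη x).deriv]
  simp [OYw, Real.exp_pos]

lemma OY_h_deriv (q : ℝ) {h : ℝ → ℝ} (hh : ∀ e, 0 < e → OYN V q 0 e (h e) = 0) 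
    {η : ℝ} (hη : 0 < η) : 
    HasDerivAt h (OYN V q 1 η (h η) / OYw V η (h η)) η := by
  have hs := OY_N_strict hV hi q 0 hη (h η)
  have hw : OYw V η (h η) ≠ 0 := (Real.exp_pos _).ne'
  have hinv : ((((- OYN V q (0 + 1) η (h η)) • (1 : ℝ →L[ℝ] ℝ)).coprod 
        (((h η) ^ 0 * OYw V η (h η)) • (1 : ℝ →L[ℝ] ℝ))) ∘L .inr ℝ ℝ ℝ).IsInvertible := by
    refine ⟨ContinuousLinearEquiv.unitsEquivAut ℝ (Units.mk0 _ hw), ?_⟩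
    ext; simp
  have hev := hs.eventually_apply_implicitFunctionOfProdDomain hinv
  have hst := hs.hasStrictFDerivAt_implicitFunctionOfProdDomain hinv
  set φ := hs.implicitFunctionOfProdDomain hinv with hφ
  have heq : h =ᶠ[𝓝 η] φ := by
    filter_upwards [hev, lt_mem_nhds hη] with e he hpos
    apply (OY_N_mono hV hi q hpos).injective
    simp only at he ⊢
    rw [he, hh e hpos, hh η hη]
  have hφd : DifferentiableAt ℝ φ η := hst.hasFDerivAt.differentiableAt
  have hd : DifferentiableAt ℝ h η := hφd.congr_of_eventuallyEq heq
  have h1 := OY_N_chain hV hi q 0 hη hd.hasDerivAt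
  have h2 : HasDerivAt (fun e => OYN V q 0 e (h e)) 0 η := by
    refine (hasDerivAt_const η (0:ℝ)).congr_of_eventuallyEq ?_
    filter_upwards [lt_mem_nhds hη] with e he using hh e he
  have h3 := h1.unique h2
  convert! hd.hasDerivAt using 1
  rw [div_eq_iff hw]
  simp at h3
  linarith

lemma OY_h_deriv2 (hVd : Differentiable ℝ V) 
    (q : ℝ) {h : ℝ → ℝ} (hh : ∀ e, 0 < e → OYN V q 0 e (h e) = 0) 
    {η : ℝ} (hη : 0 < η) : 
    HasDerivAt (deriv h) (- OYN V q 2 η (h η) / OYw V η (h η) + 2 * h η * deriv h η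
      + (η + deriv V (h η)) * (deriv h η) ^ 2) η := by
  have h1 := OY_h_deriv hV hi q hh hη
  have hw : OYw V η (h η) ≠ 0 := (Real.exp_pos _).ne'
  have h2 := OY_N_chain hV hi q 1 hη h1
  have h3 : HasDerivAt (fun e => OYw V e (h e)) (OYw V η (h η) * 
     (-(h η + η * deriv h η) - deriv V (h η) * deriv h η)) η := by
    have a1 := (hVd (h η)).hasDerivAt.comp η h1
    have a2 := (((hasDerivAt_id η).mul h1).neg.sub a1).exp
    rw [h1.deriv]
    convert! a2 using 1
    simp [OYw]
  have h4 := h2.div h3 hw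
  have heq : deriv h =ᶠ[𝓝 η] fun e => OYN V q 1 e (h e) / OYw V e (h e) := by
    filter_upwards [lt_mem_nhds hη] with e he using (OY_h_deriv hV hi q hh he).deriv
  refine HasDerivAt.congr_of_eventuallyEq ?_ heq
  convert! h4 using 1
  rw [h1.deriv]
  field_simp
  ring

end

lemma OY_smooth {V : ℝ → ℝ} (hV : OConnellYorType V) :
    Differentiable ℝ V ∧ Differentiable ℝ (deriv V) ∧ Differentiable ℝ (deriv (deriv V)) ∧
    Monotone (deriv V) := by
  have h1 := contDiff_infty_iff_deriv.1 hV.1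
  have h2 := contDiff_infty_iff_deriv.1 h1.2
  have h3 := contDiff_infty_iff_deriv.1 h2.2
  exact ⟨h1.1, h2.1, h3.1, monotone_of_deriv_nonneg h2.1 hV.2.2.1⟩

lemma OY_dV_bound {V : ℝ → ℝ} (hV : OConnellYorType V) :
    ∃ C > (0:ℝ), ∀ x, |deriv V x| ≤ C * (1 + V x) := by
  obtain ⟨d1, d2, d3, hm⟩ := OY_smooth hV
  obtain ⟨-, h0, hconv, hdec, ⟨c, hc, C2, hC2, hq⟩, ⟨c₀, hc₀, C, hC, h3⟩⟩ := hV
  set g : ℝ → ℝ := fun x => deriv (deriv V) x + 1 / c₀ * deriv V x with hg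
  have hgd : Differentiable ℝ g := d3.add (d2.const_mul _)
  have hgm : MonotoneOn g (Iic (-C)) := by
    apply monotoneOn_of_deriv_nonneg (convex_Iic _) hgd.continuous.continuousOn
      hgd.differentiableOn
    intro x hx
    rw [interior_Iic] at hx
    have hx' : x < -C := hx
    have e : HasDerivAt g (deriv (deriv (deriv V)) x + 1 / c₀ * deriv (deriv V) x) x :=
      (d3 x).hasDerivAt.add ((d2 x).hasDerivAt.const_mul _)
    rw [e.deriv]
    have := (h3 x).2
    rw [if_neg (by linarith)] at this
    linarith
  set K1 := |g (-C)| with hK1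
  have hg1 : ∀ x ≤ -C, g x ≤ K1 := fun x hx =>
    (hgm hx (le_refl (-C)) hx).trans (le_abs_self _)
  set p : ℝ → ℝ := fun x => deriv V x + 1 / c₀ * V x - K1 * x with hp
  have hpe : ∀ x, HasDerivAt p (deriv (deriv V) x + 1 / c₀ * deriv V x - K1 * 1) x := fun x =>
      ((d2 x).hasDerivAt.add ((d1 x).hasDerivAt.const_mul _)).sub ((hasDerivAt_id x).const_mul _)
  have hpd : Differentiable ℝ p := fun x => (hpe x).differentiableAt
  have hpm : AntitoneOn p (Iic (-C)) := by
    apply antitoneOn_of_deriv_nonpos (convex_Iic _) hpd.continuous.continuousOn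
      hpd.differentiableOn
    intro x hx
    rw [interior_Iic] at hx
    have hx' : x < -C := hx
    rw [(hpe x).deriv]
    have := hg1 x hx'.le
    simp only [hg] at this
    linarith
  have hK10 : 0 ≤ K1 := abs_nonneg _
  have hic : 0 < 1 / c := by positivity
  have hic0 : 0 < 1 / c₀ := by positivity
  refine ⟨|deriv V (-C)| + |p (-C)| + 1 / c₀ + K1 * (C2 + 1 + 1 / c) + 1, by positivity, fun x => ?_⟩
  rw [abs_of_nonpos (hdec x)]
  have hv := h0 x
  have n1 := abs_nonneg (deriv V (-C))
  have n2 := abs_nonneg (p (-C))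
  have n3 : 0 ≤ K1 * (C2 + 1 + 1 / c) := by positivity
  rcases le_total x (-C) with hx | hx
  · have a1 : p (-C) ≤ p x := hpm hx (le_refl (-C)) hx
    have a2 := neg_abs_le (p (-C))
    have a3 : -x ≤ C2 + 1 + 1 / c * V x := by
      rcases le_total x (-C2) with h | h
      · have h5 := hq x h
        have h6 : x ^ 2 ≤ 1 / c * V x := by
          rw [one_div, inv_mul_eq_div, le_div_iff₀ hc]; linarith
        nlinarith [sq_nonneg (x + 1)]
      · have : 0 ≤ 1 / c * V x := by positivity
        linarith
    have a4 : K1 * -x ≤ K1 * ((C2 + 1 + 1 / c) * (1 + V x)) := by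
      apply mul_le_mul_of_nonneg_left _ hK10
      nlinarith
    simp only [hp] at a1 a2 n2 ⊢
    nlinarith
  · have := hm hx
    have a2 := neg_abs_le (deriv V (-C))
    nlinarith

lemma OY_exp_int {b : ℝ} (hb : 0 < b) : Integrable (fun y : ℝ => Real.exp (-(b * |y|))) := by
  rw [← integrableOn_univ, ← Iic_union_Ioi (a := (0:ℝ))]
  apply IntegrableOn.union
  · refine (integrableOn_exp_mul_Iic hb 0).congr_fun (fun y hy => ?_) measurableSet_Iic
    simp only
    rw [abs_of_nonpos hy]; ring_nf
  · refine (integrableOn_exp_mul_Ioi (a := -b) (by linarith) 0).congr_fun (fun y hy => ?_)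
      measurableSet_Ioi
    simp only
    rw [abs_of_pos hy]; ring_nf

lemma OY_set_bound (V : ℝ → ℝ) {b : ℝ} (hb : 0 < b) (k : ℕ) (s : Set ℝ) (hs : MeasurableSet s)
    (η x D : ℝ) (hD : 0 ≤ D)
    (h : ∀ y ∈ s, |y| ^ k * Real.exp (-(η * y) - V y) ≤ D * Real.exp (-(b * |y - x|))) :
    |OYM V k s η| ≤ D * ∫ y : ℝ, Real.exp (-(b * |y|)) := by
  have hi : Integrable (fun y : ℝ => D * Real.exp (-(b * |y - x|))) :=
    ((OY_exp_int hb).comp_sub_right x).const_mul D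
  calc |OYM V k s η| ≤ ∫ y in s, D * Real.exp (-(b * |y - x|)) := by
        rw [OYM, ← Real.norm_eq_abs]
        apply norm_integral_le_of_norm_le hi.integrableOn
        refine (ae_restrict_iff' hs).2 (ae_of_all _ fun y hy => ?_)
        rw [norm_mul, norm_pow, Real.norm_eq_abs, Real.norm_of_nonneg (Real.exp_pos _).le]
        exact h y hy
    _ ≤ ∫ y, D * Real.exp (-(b * |y - x|)) := by
        apply setIntegral_le_integral hi
        exact ae_of_all _ fun y => by positivity
    _ = D * ∫ y : ℝ, Real.exp (-(b * |y|)) := by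
        rw [integral_const_mul, integral_sub_right_eq_self (fun y : ℝ => Real.exp (-(b * |y|))) x]

lemma OY_poly_exp {b : ℝ} (hb : 0 < b) {k : ℕ} (hk : k ≤ 2) {t : ℝ} (ht : 0 ≤ t) :
    (1 + t) ^ k ≤ (1 + 2 / b) ^ 2 * Real.exp (b * t) := by
  have h1 : (1 + t) ^ k ≤ (1 + t) ^ 2 := pow_le_pow_right₀ (by linarith) hk
  have h2 : 1 + t ≤ (1 + 2 / b) * Real.exp (b * t / 2) := by
    have := Real.add_one_le_exp (b * t / 2)
    have h3 : t = 2 / b * (b * t / 2) := by field_simp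
    have h4 : 0 < 2 / b := by positivity
    have h5 : 0 ≤ b * t / 2 := by positivity
    nlinarith
  calc (1 + t) ^ k ≤ (1 + t) ^ 2 := h1
    _ ≤ ((1 + 2 / b) * Real.exp (b * t / 2)) ^ 2 := pow_le_pow_left₀ (by linarith) h2 2
    _ = _ := by rw [mul_pow, ← Real.exp_nat_mul]; congr 2; push_cast; ring

lemma OY_tail_pt {V : ℝ → ℝ} {a B η x y : ℝ} (ha : 0 < a) {k : ℕ} (hk : k ≤ 2)
    (h : -(η * y) - V y ≤ B + (-(η * x) - V x) - a * |y - x|) :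
    |y| ^ k * Real.exp (-(η * y) - V y) ≤
      (Real.exp B * (1 + 2 / (a / 2)) ^ 2 * ((1 + |x|) ^ k * OYw V η x)) *
        Real.exp (-(a / 2 * |y - x|)) := by
  have h1 : |y| ^ k ≤ (1 + |x|) ^ k * (1 + |y - x|) ^ k := by
    rw [← mul_pow]
    apply pow_le_pow_left₀ (abs_nonneg _)
    have := abs_sub_abs_le_abs_sub y x
    nlinarith [abs_nonneg x, abs_nonneg (y - x)]
  have h2 := OY_poly_exp (b := a / 2) (by linarith) hk (abs_nonneg (y - x))
  have h3 : Real.exp (-(η * y) - V y) ≤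
      Real.exp B * OYw V η x * Real.exp (-(a * |y - x|)) := by
    rw [OYw, ← Real.exp_add, ← Real.exp_add]
    apply Real.exp_le_exp.2; linarith
  have h4 : Real.exp (a / 2 * |y - x|) * Real.exp (-(a * |y - x|)) =
      Real.exp (-(a / 2 * |y - x|)) := by
    rw [← Real.exp_add]; congr 1; ring
  have hw : 0 < OYw V η x := Real.exp_pos _
  calc |y| ^ k * Real.exp (-(η * y) - V y)
      ≤ ((1 + |x|) ^ k * ((1 + 2 / (a / 2)) ^ 2 * Real.exp (a / 2 * |y - x|))) *
        (Real.exp B * OYw V η x * Real.exp (-(a * |y - x|))) := by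
        apply mul_le_mul _ h3 (Real.exp_pos _).le (by positivity)
        exact h1.trans (mul_le_mul_of_nonneg_left h2 (by positivity))
    _ = _ := by rw [← h4]; ring

lemma OY_tails {V : ℝ → ℝ} (hV : OConnellYorType V) {η₀ : ℝ} (hη₀ : 0 < η₀) :
    ∃ K > (0:ℝ), ∃ D > (0:ℝ), ∀ η ∈ Icc (η₀ / 2) (2 * η₀), ∀ k ≤ 2,
      (∀ x ≤ -K, |OYM V k (Iic x) η| ≤ D * ((1 + |x|) ^ k * OYw V η x)) ∧
      (∀ x, -K ≤ x → |OYM V k (Ioi x) η| ≤ D * ((1 + |x|) ^ k * OYw V η x)) := by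
  obtain ⟨d1, d2, d3, hm⟩ := OY_smooth hV
  obtain ⟨K, hK, hKd⟩ := OY_exists_K d1 hm hV.2.1 hV.2.2.2.2.1 (2 * η₀ + 1)
  have hanti : Antitone V := antitone_of_deriv_nonpos d1 hV.2.2.2.1
  set a := min 1 (η₀ / 2) with ha
  have ha0 : 0 < a := by positivity
  have ha1 : a ≤ 1 := min_le_left _ _
  have ha2 : a ≤ η₀ / 2 := min_le_right _ _
  have hJ : 0 < ∫ y : ℝ, Real.exp (-(a / 2 * |y|)) :=
    integral_exp_pos (OY_exp_int (by linarith))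
  refine ⟨K, hK, Real.exp (V (-K)) * (1 + 2 / (a / 2)) ^ 2 *
    ∫ y : ℝ, Real.exp (-(a / 2 * |y|)), by positivity, fun η hη k hk => ⟨fun x hx => ?_, fun x hx => ?_⟩⟩
  all_goals
    have hw : 0 < OYw V η x := Real.exp_pos _
    have hVK := hV.2.1 (-K)
    obtain ⟨hη1, hη2⟩ := hη
  · refine (OY_set_bound V (b := a / 2) (by linarith) k (Iic x) measurableSet_Iic η x _ ?_
      (fun y hy => OY_tail_pt (a := a) (B := V (-K)) ha0 hk ?_)).trans (le_of_eq (by ring))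
    · positivity
    · have hy' : y ≤ x := hy
      rw [abs_of_nonpos (by linarith)]
      have h1 := OY_tangent d1 hm x y
      have h2 := hm hx
      nlinarith [mul_nonneg (by linarith : 0 ≤ x - y) (by linarith : 0 ≤ -a - η - deriv V x)]
  · refine (OY_set_bound V (b := a / 2) (by linarith) k (Ioi x) measurableSet_Ioi η x _ ?_
      (fun y hy => OY_tail_pt (a := a) (B := V (-K)) ha0 hk ?_)).trans (le_of_eq (by ring))
    · positivity
    · have hy' : x < y := hy
      rw [abs_of_nonneg (by linarith)]
      have h1 := hanti hx
      have h2 := hV.2.1 y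
      nlinarith

lemma OY_E_bound {V : ℝ → ℝ} (hV : Continuous V)
    (hi : ∀ η : ℝ, 0 < η → Integrable (fun y => Real.exp (-(η * y) - V y)))
    {η₀ : ℝ} (hη₀ : 0 < η₀) (k : ℕ) :
    ∃ E > (0:ℝ), ∀ η ∈ Icc (η₀ / 2) (2 * η₀), |OYM V k univ η| ≤ E * OYM V 0 univ η := by
  have hpos : ∀ η, 0 < η → 0 < OYM V 0 univ η := by
    intro η hη
    simpa [OYM] using integral_exp_pos (hi η hη)
  have hc : ContinuousOn (fun η => OYM V k univ η / OYM V 0 univ η) (Icc (η₀ / 2) (2 * η₀)) := by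
    intro η hη
    have hη' : 0 < η := by linarith [hη.1]
    exact (((OY_M_hasDeriv hV hi k hη').2 univ MeasurableSet.univ).continuousAt.div
      ((OY_M_hasDeriv hV hi 0 hη').2 univ MeasurableSet.univ).continuousAt
        (hpos η hη').ne').continuousWithinAt
  obtain ⟨E, hE⟩ := isCompact_Icc.exists_bound_of_continuousOn hc
  refine ⟨|E| + 1, by positivity, fun η hη => ?_⟩
  have hη' := hpos η (by linarith [hη.1])
  have := hE η hη
  rw [norm_div, Real.norm_eq_abs, Real.norm_of_nonneg hη'.le, div_le_iff₀ hη'] at this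
  nlinarith [le_abs_self E]

lemma OY_N_bound {V : ℝ → ℝ} (hV : OConnellYorType V) 
    (hi : ∀ η : ℝ, 0 < η → Integrable (fun y => Real.exp (-(η * y) - V y)))
    {η₀ : ℝ} (hη₀ : 0 < η₀) (k : ℕ) (hk : k ≤ 2) :
    ∃ D > (0:ℝ), ∀ η ∈ Icc (η₀ / 2) (2 * η₀), ∀ q ∈ Ioo (0:ℝ) 1, ∀ x, OYN V q 0 η x = 0 →
      |OYN V q k η x / OYw V η x| ≤ D * (1 + |x|) ^ k := by
  obtain ⟨d1, -⟩ := OY_smooth hV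
  obtain ⟨K, hK, D, hD, ht⟩ := OY_tails hV hη₀
  obtain ⟨E, hE, hEb⟩ := OY_E_bound d1.continuous hi hη₀ k
  refine ⟨D * (1 + E), by positivity, fun η hη q hq x h0 => ?_⟩
  have hw : 0 < OYw V η x := Real.exp_pos _
  rw [abs_div, abs_of_pos hw, div_le_iff₀ hw]
  have hη' : 0 < η := by linarith [hη.1]
  have h1 : 1 ≤ (1 + |x|) ^ k := one_le_pow₀ (by linarith [abs_nonneg x])
  have hsplit : ∀ j, OYM V j univ η = OYM V j (Iic x) η + OYM V j (Ioi x) η := by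
    intro j
    have hint := (OY_M_hasDeriv d1.continuous hi j hη').1
    rw [OYM, OYM, OYM, ← setIntegral_union (by
      rw [Set.disjoint_left]; intro a ha hb; exact absurd (mem_Iic.1 ha) (not_le.2 (mem_Ioi.1 hb))) measurableSet_Ioi
        hint.integrableOn hint.integrableOn, Iic_union_Ioi]
  have hwE := mul_le_mul_of_nonneg_left h1 (by positivity : 0 ≤ E * D * OYw V η x)
  have hEη := hEb η hη
  have s0 := hsplit 0
  have sk := hsplit k
  unfold OYN at h0 ⊢
  rcases le_total x (-K) with hx | hx
  · have a1 := (ht η hη k hk).1 x hx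
    have a2 := (abs_le.1 ((ht η hη 0 (by norm_num)).1 x hx)).2
    have a3 : |q * OYM V k univ η| ≤ E * (D * OYw V η x) := by
      rw [abs_mul, abs_of_pos hq.1]
      calc q * |OYM V k univ η| ≤ q * (E * OYM V 0 univ η) :=
            mul_le_mul_of_nonneg_left hEη hq.1.le
        _ = E * OYM V 0 (Iic x) η := by rw [sub_eq_zero.1 h0]; ring
        _ ≤ _ := mul_le_mul_of_nonneg_left (by simpa using a2) hE.le
    calc _ ≤ |OYM V k (Iic x) η| + |q * OYM V k univ η| := abs_sub _ _
      _ ≤ _ := by nlinarith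
  · have a1 := (ht η hη k hk).2 x hx
    have a2 := (abs_le.1 ((ht η hη 0 (by norm_num)).2 x hx)).2
    have a3 : |(1 - q) * OYM V k univ η| ≤ E * (D * OYw V η x) := by
      rw [abs_mul, abs_of_pos (by linarith [hq.2])]
      calc (1 - q) * |OYM V k univ η| ≤ (1 - q) * (E * OYM V 0 univ η) :=
            mul_le_mul_of_nonneg_left hEη (by linarith [hq.2])
        _ = E * OYM V 0 (Ioi x) η := by
          have : OYM V 0 (Ioi x) η = (1 - q) * OYM V 0 univ η := by linarith
          rw [this]; ring
        _ ≤ _ := mul_le_mul_of_nonneg_left (by simpa using a2) hE.le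
    have e : OYM V k (Iic x) η - q * OYM V k univ η =
      (1 - q) * OYM V k univ η - OYM V k (Ioi x) η := by linarith
    rw [e]
    calc _ ≤ |(1 - q) * OYM V k univ η| + |OYM V k (Ioi x) η| := abs_sub _ _
      _ ≤ _ := by nlinarith

/-- bounds on the first two `η`-derivatives of the inverse distribution
function `H_η(q) = F_η⁻¹(q)` of the tilted measure `ν_η`, uniformly for `η ∈ [η₀/2, 2η₀]`. -/
theorem stmt_17 (V : ℝ → ℝ) (hV : OConnellYorType V) (η₀ : ℝ) (hη₀ : 0 < η₀)
    (Z : ℝ → ℝ) (hZ : ∀ θ : ℝ, Z θ = ∫ x : ℝ, Real.exp (-(θ * x) - V x))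
    (F : ℝ → ℝ → ℝ)
    (hF : ∀ θ x : ℝ, F θ x = (Z θ)⁻¹ * ∫ y in Set.Iic x, Real.exp (-(θ * y) - V y))
    (H : ℝ → ℝ → ℝ)
    (hH : ∀ η : ℝ, 0 < η → ∀ q ∈ Set.Ioo (0:ℝ) 1, F η (H η q) = q) :
    ∃ C > (0:ℝ), ∀ η ∈ Set.Icc (η₀ / 2) (2 * η₀), ∀ q ∈ Set.Ioo (0:ℝ) 1,
      DifferentiableAt ℝ (fun e => H e q) η ∧
      DifferentiableAt ℝ (deriv (fun e => H e q)) η ∧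
      |deriv (fun e => H e q) η| ≤ C * (1 + |H η q|) ∧
      |deriv (deriv (fun e => H e q)) η| ≤ C * (1 + |H η q| ^ 2) * (1 + V (H η q)) := by
  obtain ⟨d1, d2, d3, hm⟩ := OY_smooth hV
  have hi : ∀ η : ℝ, 0 < η → Integrable (fun y => Real.exp (-(η * y) - V y)) :=
    fun η hη => OY_integrable_aux d1 hm hV.2.1 hV.2.2.2.2.1 hη
  obtain ⟨D1, hD1, hb1⟩ := OY_N_bound hV hi hη₀ 1 (by norm_num)
  obtain ⟨D2, hD2, hb2⟩ := OY_N_bound hV hi hη₀ 2 le_rfl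
  obtain ⟨Cv, hCv, hbv⟩ := OY_dV_bound hV
  refine ⟨D1 + 2 * (D2 + 2 * D1 + (2 * η₀ + Cv) * D1 ^ 2), by positivity, fun η hη q hq => ?_⟩
  have hη' : 0 < η := by linarith [hη.1]
  have hh : ∀ e, 0 < e → OYN V q 0 e (H e q) = 0 := by
    intro e he
    have h1 := hH e he q hq
    have hZp : 0 < Z e := by rw [hZ]; exact integral_exp_pos (hi e he)
    rw [hF, inv_mul_eq_div, div_eq_iff hZp.ne', hZ] at h1
    simp [OYN, OYM, h1]
  have g1 := OY_h_deriv d1.continuous hi q (h := fun e => H e q) hh hη'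
  have g2 := OY_h_deriv2 d1.continuous hi d1 q (h := fun e => H e q) hh hη'
  refine ⟨g1.differentiableAt, g2.differentiableAt, ?_⟩
  have b1 : |deriv (fun e => H e q) η| ≤ D1 * (1 + |H η q|) := by
    rw [g1.deriv]
    simpa using hb1 η hη q hq _ (hh η hη')
  have b2 := hb2 η hη q hq _ (hh η hη')
  have b3 := hbv (H η q)
  have hv0 := hV.2.1 (H η q)
  rw [g2.deriv]
  set x := H η q with hx
  set p := deriv (fun e => H e q) η with hp
  have hx0 := abs_nonneg x
  constructor
  · have : 0 < 2 * (D2 + 2 * D1 + (2 * η₀ + Cv) * D1 ^ 2) := by positivity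
    nlinarith
  set S := (1 + |x|) ^ 2 with hS
  have hS0 : 0 ≤ S := by positivity
  have hS1 : S ≤ 2 * (1 + |x| ^ 2) := by nlinarith [sq_nonneg (|x| - 1)]
  have t1 : |(-OYN V q 2 η x / OYw V η x)| ≤ D2 * S := by rw [neg_div, abs_neg]; exact b2
  have t2 : |2 * x * p| ≤ 2 * D1 * S := by
    rw [abs_mul, abs_mul, abs_two]
    have : |x| * |p| ≤ (1 + |x|) * (D1 * (1 + |x|)) := by gcongr; linarith
    nlinarith
  have t3 : |(η + deriv V x) * p ^ 2| ≤ (2 * η₀ + Cv) * D1 ^ 2 * (S * (1 + V x)) := by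
    rw [abs_mul, abs_pow]
    have u1 : |η + deriv V x| ≤ (2 * η₀ + Cv) * (1 + V x) := by
      have := abs_add_le η (deriv V x)
      rw [abs_of_pos hη'] at this
      nlinarith [hη.2]
    have u2 : |p| ^ 2 ≤ (D1 * (1 + |x|)) ^ 2 := by gcongr
    calc _ ≤ ((2 * η₀ + Cv) * (1 + V x)) * (D1 * (1 + |x|)) ^ 2 := by gcongr
      _ = _ := by rw [hS]; ring
  have t4 : S ≤ S * (1 + V x) := by nlinarith
  have t5 : S * (1 + V x) ≤ 2 * (1 + |x| ^ 2) * (1 + V x) := by gcongr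
  have t6 := abs_add_three (-OYN V q 2 η x / OYw V η x) (2 * x * p) ((η + deriv V x) * p ^ 2)
  set W := (1 + |x| ^ 2) * (1 + V x) with hW
  have hW0 : 0 ≤ W := by positivity
  have t7 : D2 * S ≤ D2 * (2 * W) := by gcongr; linarith
  have t8 : 2 * D1 * S ≤ 2 * D1 * (2 * W) := by gcongr; linarith
  have t9 : (2 * η₀ + Cv) * D1 ^ 2 * (S * (1 + V x)) ≤ (2 * η₀ + Cv) * D1 ^ 2 * (2 * W) := by
    apply mul_le_mul_of_nonneg_left _ (by positivity); linarith
  have t10 : 0 ≤ D1 * W := by positivity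
  refine t6.trans ?_
  have t11 : (D1 + 2 * (D2 + 2 * D1 + (2 * η₀ + Cv) * D1 ^ 2)) * (1 + |x| ^ 2) * (1 + V x) =
      D1 * W + D2 * (2 * W) + 2 * D1 * (2 * W) + (2 * η₀ + Cv) * D1 ^ 2 * (2 * W) := by
    rw [hW]; ring
  rw [t11]
  linarith
end

section
/- Let V be of O'Connell–Yor type, let 0 < η₁ < η₂ and set I = [η₁, η₂]. Then for every p ≥ 1 and each k ∈ {0, 1, 2} there is a constant C_p > 0 such that ∫₀¹ sup_{η ∈ I} |∂_η^k H_η(q)|^p dq ≤ C_p, where ∂_η^0 H_η(q) = H_η(q); in other words, if q is uniformly distributed on (0, 1), then E[sup_{η ∈ I} |∂_η^k H_η(q)|^p] is finite for k = 0, 1, 2 and all p ≥ 1. -/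
open MeasureTheory Set Filter Topology

structure VP (V : ℝ → ℝ) : Prop where
  cont : Continuous V
  nonneg : ∀ x, 0 ≤ V x
  diff : ∀ x, HasDerivAt V (deriv V x) x
  contd : Continuous (deriv V)
  mono : Monotone (deriv V)
  npos : ∀ x, deriv V x ≤ 0
  growth : ∃ c > (0:ℝ), ∃ C > (0:ℝ), ∀ x : ℝ, x ≤ -C → c * x ^ 2 ≤ V x

namespace VP
variable {V : ℝ → ℝ}

lemma of_type (h1 : ContDiff ℝ (⊤ : ℕ∞) V) (h2 : ∀ x, 0 ≤ V x)
    (h3 : ∀ x, 0 ≤ deriv (deriv V) x) (h4 : ∀ x, deriv V x ≤ 0)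
    (h5 : ∃ c > (0:ℝ), ∃ C > (0:ℝ), ∀ x : ℝ, x ≤ -C → c * x ^ 2 ≤ V x) : VP V where
  cont := h1.continuous
  nonneg := h2
  diff x := (h1.differentiable (by simp) x).hasDerivAt
  contd := h1.continuous_deriv (by simp)
  mono := by
    have h : ContDiff ℝ 2 V := contDiff_infty.1 h1 2
    have h' : Differentiable ℝ (deriv V) := h.differentiable_deriv_two
    exact monotone_of_deriv_nonneg h' h3
  npos := h4
  growth := h5

lemma anti (h : VP V) : Antitone V :=
  antitone_of_deriv_nonpos (fun x => (h.diff x).differentiableAt) h.npos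

lemma tangent (h : VP V) (x y : ℝ) : V x + deriv V x * (y - x) ≤ V y := by
  have hc : ConvexOn ℝ univ V := by
    apply MonotoneOn.convexOn_of_deriv convex_univ h.cont.continuousOn
      (fun x _ => (h.diff x).differentiableAt.differentiableWithinAt) (h.mono.monotoneOn _)
  rcases lt_trichotomy x y with hl | rfl | hl
  · have := hc.le_slope_of_hasDerivAt (mem_univ x) (mem_univ y) hl (h.diff x)
    rw [slope_def_field, le_div_iff₀ (by linarith)] at this
    linarith
  · simp
  · have := hc.slope_le_of_hasDerivAt (mem_univ y) (mem_univ x) hl (h.diff x)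
    rw [slope_def_field, div_le_iff₀ (by linarith)] at this
    linarith

/-- slope is very negative at the far left -/
lemma slope (h : VP V) (b : ℝ) : ∃ R > (0:ℝ), ∀ x ≤ -R, deriv V x ≤ -b := by
  obtain ⟨c, hc, C, hC, hg⟩ := h.growth
  have h0 := h.nonneg 0
  refine ⟨max 1 (max C ((|b| + V 0) / c)), by positivity, fun x hx => ?_⟩
  have h1 : 1 ≤ -x := le_trans (le_max_left _ _) (by linarith)
  have h2 : C ≤ -x := le_trans (le_trans (le_max_left _ _) (le_max_right _ _)) (by linarith)
  have h3 : (|b| + V 0) / c ≤ -x :=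
    le_trans (le_trans (le_max_right _ _) (le_max_right _ _)) (by linarith)
  rw [div_le_iff₀ hc] at h3
  have h4 := hg x (by linarith)
  have h5 := h.tangent x 0
  have h6 := le_abs_self b
  by_contra hcon
  push Not at hcon
  nlinarith [mul_pos (sub_pos.2 hcon) (by linarith : 0 < -x), mul_nonneg h0 (by linarith : 0 ≤ -x - 1)]
end VP

noncomputable def ww (V : ℝ → ℝ) (η y : ℝ) : ℝ := Real.exp (-(η * y) - V y)

lemma ww_pos (V : ℝ → ℝ) (η y : ℝ) : 0 < ww V η y := Real.exp_pos _

lemma one_add_le_exp {ε t : ℝ} (hε : 0 < ε) (ht : 0 ≤ t) :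
    1 + t ≤ (1 + 1 / ε) * Real.exp (ε * t) := by
  have h1 := Real.add_one_le_exp (ε * t)
  have : (1 + 1 / ε) * (ε * t + 1) ≤ (1 + 1 / ε) * Real.exp (ε * t) := by gcongr
  refine le_trans ?_ this
  have : (1 + 1 / ε) * (ε * t + 1) = 1 + t + ε * t + 1 / ε := by field_simp; ring
  rw [this]
  have : 0 ≤ ε * t := by positivity
  have : 0 < 1 / ε := by positivity
  linarith

lemma exp_pow_bound {s : ℝ} (hs : 0 < s) (j : ℕ) :
    ∃ K > (0:ℝ), ∀ t, 0 ≤ t → (1 + t) ^ j ≤ K * Real.exp (s * t) := by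
  refine ⟨(1 + 1 / (s / (j + 1))) ^ j, by positivity, fun t ht => ?_⟩
  have := one_add_le_exp (ε := s / (j + 1)) (by positivity) ht
  calc (1 + t) ^ j ≤ ((1 + 1 / (s / (j + 1))) * Real.exp (s / (j + 1) * t)) ^ j := by gcongr
    _ = (1 + 1 / (s / (j + 1))) ^ j * Real.exp (j * (s / (j + 1) * t)) := by
        rw [mul_pow, ← Real.exp_nat_mul]
    _ ≤ _ := by
        refine mul_le_mul_of_nonneg_left (Real.exp_le_exp.2 ?_) (by positivity)
        have : (j : ℝ) * (s / (j + 1) * t) = (j / (j + 1)) * (s * t) := by field_simp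
        rw [this]
        have h2 : (j : ℝ) / (j + 1) ≤ 1 := by rw [div_le_one (by positivity)]; linarith
        exact mul_le_of_le_one_left (mul_nonneg hs.le ht) h2

lemma integrable_exp_abs {s : ℝ} (hs : 0 < s) :
    Integrable (fun y : ℝ => Real.exp (-(s * |y|))) := by
  rw [← integrableOn_univ, ← Iic_union_Ioi (a := (0:ℝ))]
  refine IntegrableOn.union ?_ ?_
  · refine (integrableOn_exp_mul_Iic hs 0).congr_fun (fun y hy => ?_) measurableSet_Iic
    simp only [mem_Iic] at hy
    simp [abs_of_nonpos hy]
  · refine (integrableOn_exp_mul_Ioi (a := -s) (by linarith) 0).congr_fun (fun y hy => ?_)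
      measurableSet_Ioi
    simp only [mem_Ioi] at hy
    simp [abs_of_pos hy]

lemma integral_exp_abs {s : ℝ} (hs : 0 < s) :
    ∫ y : ℝ, Real.exp (-(s * |y|)) = 2 / s := by
  rw [integral_comp_abs (f := fun y => Real.exp (-(s * y)))]
  have := integral_exp_mul_Ioi (a := -s) (by linarith) 0
  simp only [neg_mul] at this
  rw [this]; simp; field_simp

namespace VP
variable {V : ℝ → ℝ}

lemma ww_bound (h : VP V) {a b : ℝ} (ha : 0 < a) :
    ∃ K > (0:ℝ), ∃ δ > (0:ℝ), ∀ η ∈ Icc a b, ∀ y, ww V η y ≤ K * Real.exp (-(δ * |y|)) := by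
  obtain ⟨R, hR, hs⟩ := h.slope (b + a)
  refine ⟨Real.exp ((|b| + a) * R), Real.exp_pos _, a, ha, fun η hη y => ?_⟩
  have hb : b ≤ |b| := le_abs_self b
  rw [ww, ← Real.exp_add, Real.exp_le_exp]
  have h0 := h.nonneg y
  have hb0 := abs_nonneg b
  rcases le_total 0 y with hy | hy
  · rw [abs_of_nonneg hy]
    have : a * y ≤ η * y := by gcongr; exact hη.1
    nlinarith [mul_nonneg (add_nonneg hb0 ha.le) hR.le]
  · rw [abs_of_nonpos hy]
    have h1 : -(η * y) ≤ -(b * y) := by nlinarith [hη.2]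
    rcases le_total (-R) y with hy2 | hy2
    · nlinarith [mul_nonneg (add_nonneg hb0 ha.le) (by linarith : 0 ≤ R + y)]
    · have h2 := h.tangent (-R) y
      have h3 := hs (-R) le_rfl
      have h4 := h.nonneg (-R)
      nlinarith [mul_nonneg (by linarith : 0 ≤ -(b + a) - deriv V (-R)) (by linarith : 0 ≤ -R - y)]

lemma ww_cont (h : VP V) : Continuous (fun p : ℝ × ℝ => ww V p.1 p.2) := by
  unfold ww
  have := h.cont
  fun_prop

lemma ww_cont' (h : VP V) (η : ℝ) : Continuous (ww V η) := by
  unfold ww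
  have := h.cont
  fun_prop

lemma integrable_dom (K : ℝ) {δ : ℝ} (hδ : 0 < δ) (j : ℕ) :
    Integrable (fun y : ℝ => (1 + |y|) ^ j * (K * Real.exp (-(δ * |y|)))) := by
  obtain ⟨L, hL, hb⟩ := exp_pow_bound (half_pos hδ) j
  refine Integrable.mono' ((integrable_exp_abs (half_pos hδ)).const_mul (L * |K|))
    (by fun_prop) (Eventually.of_forall fun y => ?_)
  rw [norm_mul, norm_mul, Real.norm_of_nonneg (Real.exp_pos _).le, Real.norm_of_nonneg (by positivity), Real.norm_eq_abs]
  calc (1 + |y|) ^ j * (|K| * Real.exp (-(δ * |y|)))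
      ≤ (L * Real.exp (δ / 2 * |y|)) * (|K| * Real.exp (-(δ * |y|))) := by
        gcongr; exact hb _ (abs_nonneg y)
    _ = L * |K| * (Real.exp (δ / 2 * |y|) * Real.exp (-(δ * |y|))) := by ring
    _ = L * |K| * Real.exp (-(δ / 2 * |y|)) := by rw [← Real.exp_add]; ring_nf

lemma pow_abs_le (y : ℝ) (j : ℕ) : |y| ^ j ≤ (1 + |y|) ^ j := by
  gcongr; linarith [abs_nonneg y]

lemma integrable_pow (h : VP V) {η : ℝ} (hη : 0 < η) (j : ℕ) :
    Integrable (fun y : ℝ => y ^ j * ww V η y) := by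
  obtain ⟨K, hK, δ, hδ, hb⟩ := h.ww_bound (b := η) hη
  refine Integrable.mono' (integrable_dom K hδ j)
    (by have := h.ww_cont' η; fun_prop) (Eventually.of_forall fun y => ?_)
  rw [norm_mul, norm_pow, Real.norm_of_nonneg (ww_pos V η y).le, Real.norm_eq_abs]
  gcongr
  · exact (ww_pos V η y).le
  · linarith
  · exact hb η ⟨le_rfl, le_rfl⟩ y

lemma hasDerivAt_set (h : VP V) {η : ℝ} (hη : 0 < η) (j : ℕ) (S : Set ℝ) :
    HasDerivAt (fun e => ∫ y in S, y ^ j * ww V e y) (-∫ y in S, y ^ (j + 1) * ww V η y) η := by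
  obtain ⟨K, hK, δ, hδ, hb⟩ := h.ww_bound (a := η / 2) (b := 2 * η) (half_pos hη)
  rw [← integral_neg]
  refine (hasDerivAt_integral_of_dominated_loc_of_deriv_le
    (F := fun e y => y ^ j * ww V e y) (F' := fun e y => -(y ^ (j + 1) * ww V e y))
    (bound := fun y => (1 + |y|) ^ (j + 1) * (K * Real.exp (-(δ * |y|))))
    (s := Icc (η / 2) (2 * η)) (Icc_mem_nhds (by linarith) (by linarith)) ?_ ?_ ?_ ?_ ?_ ?_).2
  · exact Eventually.of_forall fun e => by have := h.ww_cont' e; fun_prop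
  · exact (h.integrable_pow hη j).integrableOn
  · have := h.ww_cont' η; fun_prop
  · refine Eventually.of_forall fun y e he => ?_
    rw [norm_neg, norm_mul, norm_pow, Real.norm_of_nonneg (ww_pos V e y).le, Real.norm_eq_abs]
    gcongr
    · exact (ww_pos V e y).le
    · linarith
    · exact hb e he y
  · exact (integrable_dom K hδ (j + 1)).integrableOn
  · refine Eventually.of_forall fun y e he => ?_
    have : HasDerivAt (fun e => ww V e y) (ww V e y * (-y)) e := by
      unfold ww
      have := (((hasDerivAt_id e).mul_const y).neg.sub_const (V y)).exp
      simpa using this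
    exact (this.const_mul (y ^ j)).congr_deriv (by ring)
end VP

noncomputable def MM (V : ℝ → ℝ) (j : ℕ) (η x : ℝ) : ℝ := ∫ y in Iic x, y ^ j * ww V η y
noncomputable def SS (V : ℝ → ℝ) (j : ℕ) (η : ℝ) : ℝ := ∫ y, y ^ j * ww V η y
noncomputable def mm (V : ℝ → ℝ) (η : ℝ) : ℝ := SS V 1 η / SS V 0 η
noncomputable def mm' (V : ℝ → ℝ) (η : ℝ) : ℝ :=
  (-SS V 2 η * SS V 0 η + SS V 1 η ^ 2) / SS V 0 η ^ 2
noncomputable def DD (V : ℝ → ℝ) (η x : ℝ) : ℝ :=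
  (MM V 1 η x - mm V η * MM V 0 η x) / ww V η x
noncomputable def EE (V : ℝ → ℝ) (η x : ℝ) : ℝ :=
  (-MM V 2 η x + mm V η * MM V 1 η x - mm' V η * MM V 0 η x) / ww V η x
    + (x - mm V η) * DD V η x + DD V η x * (x + (η + deriv V x) * DD V η x)
noncomputable def FF (V : ℝ → ℝ) (η x : ℝ) : ℝ := MM V 0 η x / SS V 0 η

lemma ioi_open : IsOpen (Ioi (0:ℝ) ×ˢ (univ : Set ℝ)) := isOpen_Ioi.prod isOpen_univ

lemma pd_of_partials {f f1 f2 : ℝ → ℝ → ℝ}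
    (h1 : ∀ η x, 0 < η → HasDerivAt (fun e => f e x) (f1 η x) η)
    (h2 : ∀ η x, 0 < η → HasDerivAt (fun z => f η z) (f2 η x) x)
    (c1 : ContinuousOn (fun p : ℝ × ℝ => f1 p.1 p.2) (Ioi 0 ×ˢ univ))
    (c2 : ContinuousOn (fun p : ℝ × ℝ => f2 p.1 p.2) (Ioi 0 ×ˢ univ))
    {η x : ℝ} (hη : 0 < η) :
    HasFDerivAt (fun p : ℝ × ℝ => f p.1 p.2)
      (f1 η x • ContinuousLinearMap.fst ℝ ℝ ℝ + f2 η x • ContinuousLinearMap.snd ℝ ℝ ℝ) (η, x) := by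
  have hm : Ioi (0:ℝ) ×ˢ (univ : Set ℝ) ∈ 𝓝 (η, x) := ioi_open.mem_nhds ⟨hη, mem_univ _⟩
  have key := hasStrictFDerivAt_uncurry_coprod (u := (η, x)) (f := f)
    (f₁ := fun a b => ContinuousLinearMap.toSpanSingleton ℝ (f1 a b))
    (f₂ := fun a b => ContinuousLinearMap.toSpanSingleton ℝ (f2 a b)) (𝕜 := ℝ) ?_ ?_ ?_ ?_
  · have := key.hasFDerivAt
    refine HasFDerivAt.congr_fderiv this ?_
    ext <;> simp [Function.HasUncurry.uncurry]
  · filter_upwards [hm] with v hv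
    exact (h1 v.1 v.2 hv.1).hasFDerivAt
  · filter_upwards [hm] with v hv
    exact (h2 v.1 v.2 hv.1).hasFDerivAt
  · have := (c1.continuousAt hm)
    exact ((ContinuousLinearMap.toSpanSingletonCLE (𝕜 := ℝ) (E := ℝ)).continuous.continuousAt).comp this
  · have := (c2.continuousAt hm)
    exact ((ContinuousLinearMap.toSpanSingletonCLE (𝕜 := ℝ) (E := ℝ)).continuous.continuousAt).comp this

namespace VP
variable {V : ℝ → ℝ}

lemma MM_eta (h : VP V) (j : ℕ) (η x : ℝ) (hη : 0 < η) :
    HasDerivAt (fun e => MM V j e x) (-MM V (j + 1) η x) η := h.hasDerivAt_set hη j (Iic x)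

lemma SS_eta (h : VP V) (j : ℕ) (η : ℝ) (hη : 0 < η) :
    HasDerivAt (fun e => SS V j e) (-SS V (j + 1) η) η := by
  have := h.hasDerivAt_set hη j univ
  simp only [Measure.restrict_univ] at this
  exact this

lemma MM_split (h : VP V) (j : ℕ) (η x : ℝ) (hη : 0 < η) :
    MM V j η x = MM V j η 0 + ∫ y in (0:ℝ)..x, y ^ j * ww V η y := by
  rw [← intervalIntegral.integral_Iic_sub_Iic (h.integrable_pow hη j).integrableOn
    (h.integrable_pow hη j).integrableOn]
  simp [MM]

lemma MM_x (h : VP V) (j : ℕ) (η x : ℝ) (hη : 0 < η) :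
    HasDerivAt (fun z => MM V j η z) (x ^ j * ww V η x) x := by
  have hc : Continuous (fun y => y ^ j * ww V η y) := by have := h.ww_cont' η; fun_prop
  have := (hc.integral_hasStrictDerivAt 0 x).hasDerivAt.const_add (MM V j η 0)
  refine this.congr_of_eventuallyEq (Eventually.of_forall fun z => ?_)
  exact h.MM_split j η z hη

lemma SS_cont (h : VP V) (j : ℕ) : ContinuousOn (fun p : ℝ × ℝ => SS V j p.1) (Ioi 0 ×ˢ univ) := by
  have : ContinuousOn (SS V j) (Ioi 0) := fun η hη =>
    (h.SS_eta j η hη).continuousAt.continuousWithinAt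
  exact this.comp continuousOn_fst (fun p hp => hp.1)

lemma MM_cont (h : VP V) (j : ℕ) :
    ContinuousOn (fun p : ℝ × ℝ => MM V j p.1 p.2) (Ioi 0 ×ˢ univ) := by
  have h1 : ContinuousOn (fun e => MM V j e 0) (Ioi 0) := fun η hη =>
    (h.MM_eta j η 0 hη).continuousAt.continuousWithinAt
  have h2 : ContinuousOn (fun p : ℝ × ℝ => MM V j p.1 0) (Ioi 0 ×ˢ univ) :=
    h1.comp continuousOn_fst (fun p hp => hp.1)
  have h3 : Continuous (fun p : ℝ × ℝ => ∫ y in (0:ℝ)..p.2, y ^ j * ww V p.1 y) := by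
    apply intervalIntegral.continuous_parametric_intervalIntegral_of_continuous
      (f := fun (p : ℝ × ℝ) y => y ^ j * ww V p.1 y) ?_ continuous_snd
    have := h.ww_cont
    have h4 : Continuous (fun q : (ℝ × ℝ) × ℝ => ww V q.1.1 q.2) :=
      this.comp (by fun_prop : Continuous fun q : (ℝ × ℝ) × ℝ => (q.1.1, q.2))
    exact (continuous_snd.pow j).mul h4
  exact (h2.add h3.continuousOn).congr fun p hp => h.MM_split j p.1 p.2 hp.1

lemma SS_pos (h : VP V) {η : ℝ} (hη : 0 < η) : 0 < SS V 0 η := by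
  unfold SS
  have hi := h.integrable_pow hη 0
  simp only [pow_zero, one_mul] at hi ⊢
  exact integral_exp_pos (f := fun y => -(η * y) - V y) hi

lemma mm_cont (h : VP V) : ContinuousOn (fun p : ℝ × ℝ => mm V p.1) (Ioi 0 ×ˢ univ) :=
  (h.SS_cont 1).div (h.SS_cont 0) fun _ hp => (h.SS_pos hp.1).ne'

lemma mm'_cont (h : VP V) : ContinuousOn (fun p : ℝ × ℝ => mm' V p.1) (Ioi 0 ×ˢ univ) :=
  (((h.SS_cont 2).neg.mul (h.SS_cont 0)).add ((h.SS_cont 1).pow 2)).div ((h.SS_cont 0).pow 2)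
    fun _ hp => pow_ne_zero _ (h.SS_pos hp.1).ne'

lemma mm_eta (h : VP V) {η : ℝ} (hη : 0 < η) : HasDerivAt (mm V) (mm' V η) η :=
  ((h.SS_eta 1 η hη).div (h.SS_eta 0 η hη) (h.SS_pos hη).ne').congr_deriv (by
    simp [mm']; ring)

lemma DD_cont (h : VP V) : ContinuousOn (fun p : ℝ × ℝ => DD V p.1 p.2) (Ioi 0 ×ˢ univ) :=
  ((h.MM_cont 1).sub (h.mm_cont.mul (h.MM_cont 0))).div h.ww_cont.continuousOn
    fun _ _ => (ww_pos _ _ _).ne'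

lemma EE_cont (h : VP V) : ContinuousOn (fun p : ℝ × ℝ => EE V p.1 p.2) (Ioi 0 ×ˢ univ) := by
  have h2 : ContinuousOn (fun p : ℝ × ℝ => deriv V p.2) (Ioi 0 ×ˢ univ) :=
    (h.contd.comp continuous_snd).continuousOn
  refine ContinuousOn.add (ContinuousOn.add ?_ ?_) ?_
  · exact ((((h.MM_cont 2).neg).add (h.mm_cont.mul (h.MM_cont 1))).sub
      (h.mm'_cont.mul (h.MM_cont 0))).div h.ww_cont.continuousOn fun _ _ => (ww_pos _ _ _).ne'
  · exact (continuousOn_snd.sub h.mm_cont).mul h.DD_cont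
  · exact h.DD_cont.mul (continuousOn_snd.add ((continuousOn_fst.add h2).mul h.DD_cont))

lemma FF_x (h : VP V) (η x : ℝ) (hη : 0 < η) :
    HasDerivAt (fun z => FF V η z) (ww V η x / SS V 0 η) x := by
  have := (h.MM_x 0 η x hη).div_const (SS V 0 η)
  simpa [FF] using this

lemma FF_eta (h : VP V) (η x : ℝ) (hη : 0 < η) :
    HasDerivAt (fun e => FF V e x) (-(MM V 1 η x - mm V η * MM V 0 η x) / SS V 0 η) η := by
  have hp := (h.SS_pos hη).ne'
  refine ((h.MM_eta 0 η x hη).div (h.SS_eta 0 η hη) hp).congr_deriv ?_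
  simp only [mm, zero_add]
  field_simp
  ring

lemma FF_fderiv (h : VP V) {η x : ℝ} (hη : 0 < η) :
    HasFDerivAt (fun p : ℝ × ℝ => FF V p.1 p.2)
      ((-(MM V 1 η x - mm V η * MM V 0 η x) / SS V 0 η) • ContinuousLinearMap.fst ℝ ℝ ℝ +
        (ww V η x / SS V 0 η) • ContinuousLinearMap.snd ℝ ℝ ℝ) (η, x) := by
  refine pd_of_partials h.FF_eta h.FF_x ?_ ?_ hη
  · exact ((h.MM_cont 1).sub (h.mm_cont.mul (h.MM_cont 0))).neg.div (h.SS_cont 0)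
      fun _ hp => (h.SS_pos hp.1).ne'
  · exact h.ww_cont.continuousOn.div (h.SS_cont 0) fun _ hp => (h.SS_pos hp.1).ne'

lemma FF_mono (h : VP V) {η : ℝ} (hη : 0 < η) : StrictMono (FF V η) :=
  strictMono_of_hasDerivAt_pos (fun x => h.FF_x η x hη)
    (fun _ => div_pos (ww_pos _ _ _) (h.SS_pos hη))

lemma MM_curve (h : VP V) (j : ℕ) {η : ℝ} (hη : 0 < η) {g : ℝ → ℝ} {g' : ℝ}
    (hg : HasDerivAt g g' η) :
    HasDerivAt (fun e => MM V j e (g e))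
      (-MM V (j + 1) η (g η) + g η ^ j * ww V η (g η) * g') η := by
  have h1 : HasFDerivAt (fun p : ℝ × ℝ => MM V j p.1 p.2) _ (η, g η) :=
    pd_of_partials (h.MM_eta j) (h.MM_x j) (h.MM_cont (j + 1)).neg
      ((continuousOn_snd.pow j).mul h.ww_cont.continuousOn) hη
  have h2 := h1.comp_hasDerivAt η ((hasDerivAt_id η).prodMk hg)
  refine h2.congr_deriv ?_
  simp

/-- second derivative along a solution curve -/
lemma DD_curve (h : VP V) {η : ℝ} (hη : 0 < η) {g : ℝ → ℝ}
    (hg : HasDerivAt g (DD V η (g η)) η) :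
    HasDerivAt (fun e => DD V e (g e)) (EE V η (g η)) η := by
  have hw : HasDerivAt (fun e => ww V e (g e))
      (ww V η (g η) * (-(g η) - (η + deriv V (g η)) * DD V η (g η))) η := by
    unfold ww
    have := ((((hasDerivAt_id η).mul hg).neg).sub ((h.diff (g η)).comp η hg)).exp
    refine this.congr_deriv ?_
    simp; ring
  have hwp := (ww_pos V η (g η)).ne'
  refine (((h.MM_curve 1 hη hg).sub ((h.mm_eta hη).mul (h.MM_curve 0 hη hg))).div hw hwp).congr_deriv ?_
  have hD : DD V η (g η) * ww V η (g η) = MM V 1 η (g η) - mm V η * MM V 0 η (g η) := by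
    rw [DD]; field_simp
  simp only [Pi.sub_apply, Pi.mul_apply, EE]
  rw [← hD]
  field_simp
  ring
end VP

section HH
variable {V : ℝ → ℝ} {H : ℝ → ℝ → ℝ}

lemma H_cont (h : VP V) (hH : ∀ η : ℝ, 0 < η → ∀ q ∈ Ioo (0:ℝ) 1, FF V η (H η q) = q) :
    ContinuousOn (fun p : ℝ × ℝ => H p.1 p.2) (Ioi 0 ×ˢ Ioo 0 1) := by
  have ho : IsOpen (Ioi (0:ℝ) ×ˢ Ioo (0:ℝ) 1) := isOpen_Ioi.prod isOpen_Ioo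
  rintro ⟨η, q⟩ ⟨hη, hq⟩
  simp only [mem_Ioi] at hη
  apply ContinuousAt.continuousWithinAt
  have hm : Ioi (0:ℝ) ×ˢ Ioo (0:ℝ) 1 ∈ 𝓝 (η, q) := ho.mem_nhds ⟨hη, hq⟩
  have hF : ∀ a, Tendsto (fun p : ℝ × ℝ => FF V p.1 a - p.2) (𝓝 (η, q)) (𝓝 (FF V η a - q)) := by
    intro a
    have h1 : ContinuousAt (fun e => FF V e a) η := (h.FF_eta η a hη).continuousAt
    have h2 : ContinuousAt (fun p : ℝ × ℝ => FF V p.1 a) (η, q) :=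
      ContinuousAt.comp (f := Prod.fst) (x := (η, q)) h1 continuousAt_fst
    exact h2.sub continuousAt_snd
  refine tendsto_order.2 ⟨fun a ha => ?_, fun a ha => ?_⟩
  · have h3 : FF V η a - q < 0 := by
      have := h.FF_mono hη ha
      simp only [hH η hη q hq] at this
      linarith
    filter_upwards [hm, (hF a).eventually_lt_const h3] with p hp hlt
    rw [← (h.FF_mono hp.1).lt_iff_lt, hH p.1 hp.1 p.2 hp.2]
    linarith
  · have h3 : 0 < FF V η a - q := by
      have := h.FF_mono hη ha
      simp only [hH η hη q hq] at this
      linarith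
    filter_upwards [hm, (hF a).eventually_const_lt h3] with p hp hlt
    rw [← (h.FF_mono hp.1).lt_iff_lt, hH p.1 hp.1 p.2 hp.2]
    linarith

/-- shear equivalence -/
noncomputable def shear (α β : ℝ) (hβ : β ≠ 0) : (ℝ × ℝ) ≃L[ℝ] (ℝ × ℝ) :=
  ContinuousLinearEquiv.equivOfInverse
    ((ContinuousLinearMap.fst ℝ ℝ ℝ).prod
      (α • ContinuousLinearMap.fst ℝ ℝ ℝ + β • ContinuousLinearMap.snd ℝ ℝ ℝ))
    ((ContinuousLinearMap.fst ℝ ℝ ℝ).prod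
      ((-α / β) • ContinuousLinearMap.fst ℝ ℝ ℝ + (1 / β) • ContinuousLinearMap.snd ℝ ℝ ℝ))
    (fun p => by ext <;> simp; field_simp; ring)
    (fun p => by ext <;> simp; field_simp; ring)

lemma H_deriv (h : VP V) (hH : ∀ η : ℝ, 0 < η → ∀ q ∈ Ioo (0:ℝ) 1, FF V η (H η q) = q)
    {η q : ℝ} (hη : 0 < η) (hq : q ∈ Ioo (0:ℝ) 1) :
    HasDerivAt (fun e => H e q) (DD V η (H η q)) η := by
  have ho : IsOpen (Ioi (0:ℝ) ×ˢ Ioo (0:ℝ) 1) := isOpen_Ioi.prod isOpen_Ioo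
  have hm : Ioi (0:ℝ) ×ˢ Ioo (0:ℝ) 1 ∈ 𝓝 (η, q) := ho.mem_nhds ⟨hη, hq⟩
  have hc : ContinuousAt (fun p : ℝ × ℝ => H p.1 p.2) (η, q) := (H_cont h hH).continuousAt hm
  have hβ : ww V η (H η q) / SS V 0 η ≠ 0 := (div_pos (ww_pos _ _ _) (h.SS_pos hη)).ne'
  have hg : ContinuousAt (fun p : ℝ × ℝ => (p.1, H p.1 p.2)) (η, q) := continuousAt_fst.prodMk hc
  have hf := (hasFDerivAt_fst (𝕜 := ℝ) (p := (η, H η q))).prodMk (h.FF_fderiv (x := H η q) hη)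
  have key := HasFDerivAt.of_local_left_inverse (f := fun p : ℝ × ℝ => (p.1, FF V p.1 p.2))
    (f' := shear _ _ hβ) (g := fun p : ℝ × ℝ => (p.1, H p.1 p.2)) (a := (η, q)) hg hf
    (by
      filter_upwards [hm] with p hp
      simp only [hH p.1 hp.1 p.2 hp.2])
  have k2 := (key.snd).comp_hasDerivAt η ((hasDerivAt_id η).prodMk (hasDerivAt_const η q))
  refine k2.congr_deriv ?_
  have hS := (h.SS_pos hη).ne'
  have hw := (ww_pos V η (H η q)).ne'
  have : ∀ (α β : ℝ) (hβ : β ≠ 0), ((shear α β hβ).symm (1, 0)).2 = -α / β := by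
    intro α β hβ
    simp [shear]
  simp only [ContinuousLinearMap.comp_apply]
  refine (this _ _ hβ).trans ?_
  rw [DD]
  field_simp

lemma H_iter (h : VP V) (hH : ∀ η : ℝ, 0 < η → ∀ q ∈ Ioo (0:ℝ) 1, FF V η (H η q) = q)
    {η q : ℝ} (hη : 0 < η) (hq : q ∈ Ioo (0:ℝ) 1) :
    deriv^[0] (fun e => H e q) η = H η q ∧ deriv^[1] (fun e => H e q) η = DD V η (H η q) ∧
    deriv^[2] (fun e => H e q) η = EE V η (H η q) := by
  refine ⟨rfl, (H_deriv h hH hη hq).deriv, ?_⟩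
  have h1 : deriv (fun e => H e q) =ᶠ[𝓝 η] fun e => DD V e (H e q) := by
    filter_upwards [Ioi_mem_nhds hη] with e he
    exact (H_deriv h hH he hq).deriv
  change deriv (deriv fun e => H e q) η = _
  rw [h1.deriv_eq]
  exact (h.DD_curve (g := fun e => H e q) hη (H_deriv h hH hη hq)).deriv
end HH

lemma poly_tail {s0 : ℝ} (hs0 : 0 < s0) : ∃ L > (0:ℝ), ∀ (V : ℝ → ℝ) (η x s K B c0 c1 c2 : ℝ)
    (S : Set ℝ), MeasurableSet S → s0 ≤ s → 0 ≤ K → |c0| ≤ B → |c1| ≤ B → |c2| ≤ B →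
    (∀ y ∈ S, ww V η y ≤ K * ww V η x * Real.exp (-(s * |y - x|))) →
    |∫ y in S, (c0 + c1 * y + c2 * y ^ 2) * ww V η y| ≤ B * K * L * (1 + |x|) ^ 2 * ww V η x / s := by
  obtain ⟨L, hL, hb⟩ := exp_pow_bound (half_pos hs0) 2
  refine ⟨12 * L, by positivity, fun V η x s K B c0 c1 c2 S hS hs hK h0 h1 h2 hw => ?_⟩
  have hsp : 0 < s := by linarith
  have hB : 0 ≤ B := (abs_nonneg _).trans h0
  have hwx := ww_pos V η x
  set A : ℝ := 3 * B * (1 + |x|) ^ 2 * (K * ww V η x) * L with hA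
  have hA0 : 0 ≤ A := by positivity
  have hgi : Integrable (fun y => A * Real.exp (-(s / 2 * |y - x|))) :=
    ((integrable_exp_abs (half_pos hsp)).comp_sub_right x).const_mul A
  have hint : ∫ y, A * Real.exp (-(s / 2 * |y - x|)) = A * (4 / s) := by
    rw [integral_const_mul, integral_sub_right_eq_self (fun y => Real.exp (-(s / 2 * |y|))) x,
      integral_exp_abs (half_pos hsp)]
    field_simp; norm_num
  have key : ‖∫ y in S, (c0 + c1 * y + c2 * y ^ 2) * ww V η y‖ ≤
      ∫ y in S, A * Real.exp (-(s / 2 * |y - x|)) := by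
    refine norm_integral_le_of_norm_le hgi.integrableOn ?_
    filter_upwards [ae_restrict_mem hS] with y hy
    have hp : |c0 + c1 * y + c2 * y ^ 2| ≤ 3 * B * (1 + |y|) ^ 2 := by
      have e1 : |c0 + c1 * y + c2 * y ^ 2| ≤ |c0| + |c1| * |y| + |c2| * |y| ^ 2 := by
        refine (abs_add_le _ _).trans (add_le_add ((abs_add_le _ _).trans ?_) ?_)
        · rw [abs_mul]
        · rw [abs_mul, abs_pow]
      have e2 : |c0| + |c1| * |y| + |c2| * |y| ^ 2 ≤ B + B * |y| + B * |y| ^ 2 := by gcongr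
      have hy0 := abs_nonneg y
      nlinarith [mul_nonneg hB hy0, mul_nonneg hB (sq_nonneg |y|)]
    have hyx : 1 + |y| ≤ (1 + |x|) * (1 + |y - x|) := by
      have : |y| ≤ |x| + |y - x| := by
        have := abs_add_le x (y - x); simpa using this
      nlinarith [mul_nonneg (abs_nonneg x) (abs_nonneg (y - x))]
    have hu : (1 + |y - x|) ^ 2 ≤ L * Real.exp (s / 2 * |y - x|) := by
      refine (hb _ (abs_nonneg (y - x))).trans ?_
      gcongr
    rw [norm_mul, Real.norm_of_nonneg (ww_pos V η y).le, Real.norm_eq_abs]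
    calc |c0 + c1 * y + c2 * y ^ 2| * ww V η y
        ≤ (3 * B * (1 + |y|) ^ 2) * (K * ww V η x * Real.exp (-(s * |y - x|))) :=
          mul_le_mul hp (hw y hy) (ww_pos _ _ _).le (by positivity)
      _ ≤ (3 * B * ((1 + |x|) * (1 + |y - x|)) ^ 2) * (K * ww V η x * Real.exp (-(s * |y - x|))) := by
          gcongr
      _ = 3 * B * (1 + |x|) ^ 2 * (K * ww V η x * Real.exp (-(s * |y - x|))) * (1 + |y - x|) ^ 2 := by
          ring
      _ ≤ 3 * B * (1 + |x|) ^ 2 * (K * ww V η x * Real.exp (-(s * |y - x|))) *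
            (L * Real.exp (s / 2 * |y - x|)) := by gcongr
      _ = A * (Real.exp (-(s * |y - x|)) * Real.exp (s / 2 * |y - x|)) := by rw [hA]; ring
      _ = A * Real.exp (-(s / 2 * |y - x|)) := by rw [← Real.exp_add]; ring_nf
  rw [← Real.norm_eq_abs]
  refine key.trans ((setIntegral_le_integral hgi (Eventually.of_forall fun y => by positivity)).trans ?_)
  rw [hint, hA]
  apply le_of_eq
  field_simp
  ring

namespace VP
variable {V : ℝ → ℝ}

lemma integrable_poly (h : VP V) {η : ℝ} (hη : 0 < η) (c0 c1 c2 : ℝ) :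
    Integrable (fun y => (c0 + c1 * y + c2 * y ^ 2) * ww V η y) := by
  have := (((h.integrable_pow hη 0).const_mul c0).add ((h.integrable_pow hη 1).const_mul c1)).add
    ((h.integrable_pow hη 2).const_mul c2)
  refine this.congr (Eventually.of_forall fun y => ?_)
  simp; ring

lemma poly_set (h : VP V) {η : ℝ} (hη : 0 < η) (c0 c1 c2 : ℝ) (S : Set ℝ) :
    ∫ y in S, (c0 + c1 * y + c2 * y ^ 2) * ww V η y =
      c0 * (∫ y in S, y ^ 0 * ww V η y) + c1 * (∫ y in S, y ^ 1 * ww V η y)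
        + c2 * (∫ y in S, y ^ 2 * ww V η y) := by
  have i0 := ((h.integrable_pow hη 0).integrableOn (s := S)).const_mul c0
  have i1 := ((h.integrable_pow hη 1).integrableOn (s := S)).const_mul c1
  have i2 := ((h.integrable_pow hη 2).integrableOn (s := S)).const_mul c2
  rw [← integral_const_mul, ← integral_const_mul, ← integral_const_mul, ← integral_add i0 i1,
    ← integral_add (f := fun y => c0 * (y ^ 0 * ww V η y) + c1 * (y ^ 1 * ww V η y)) (i0.add i1) i2]
  congr 1; ext y; ring

lemma key_bound (h : VP V) {a b : ℝ} (ha : 0 < a) : ∃ L > (0:ℝ), ∀ η ∈ Icc a b, ∀ x B c0 c1 c2 : ℝ,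
    |c0| ≤ B → |c1| ≤ B → |c2| ≤ B →
    c0 * SS V 0 η + c1 * SS V 1 η + c2 * SS V 2 η = 0 →
    |c0 * MM V 0 η x + c1 * MM V 1 η x + c2 * MM V 2 η x| / ww V η x ≤ L * B * (1 + |x|) ^ 2 ∧
    |c0 * MM V 0 η x + c1 * MM V 1 η x + c2 * MM V 2 η x| / ww V η x * |deriv V x|
      ≤ L * B * (1 + |x|) ^ 2 := by
  obtain ⟨R, hR, hs⟩ := h.slope (2 * b + 2)
  obtain ⟨L1, hL1, H1⟩ := poly_tail (s0 := 1) one_pos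
  obtain ⟨L2, hL2, H2⟩ := poly_tail ha
  refine ⟨2 * L1 + Real.exp (V (-R)) * L2 / a * (1 + |deriv V (-R)|), by positivity,
    fun η hη x B c0 c1 c2 h0 h1 h2 htot => ?_⟩
  have hη0 : 0 < η := ha.trans_le hη.1
  have hB : 0 ≤ B := (abs_nonneg _).trans h0
  have hwx := ww_pos V η x
  have hT : 0 ≤ B * (1 + |x|) ^ 2 := by positivity
  have hq1 : 0 ≤ L1 * (B * (1 + |x|) ^ 2) := by positivity
  have hq2 : 0 ≤ Real.exp (V (-R)) * L2 / a * (B * (1 + |x|) ^ 2) := by positivity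
  have hq3 : 0 ≤ Real.exp (V (-R)) * L2 / a * (B * (1 + |x|) ^ 2) * |deriv V (-R)| := by positivity
  have hM := h.poly_set hη0 c0 c1 c2 (Iic x)
  change _ = c0 * MM V 0 η x + c1 * MM V 1 η x + c2 * MM V 2 η x at hM
  rw [← hM]
  rcases le_total x (-R) with hx | hx
  · have hd := hs x hx
    have hs1 : 1 ≤ -deriv V x - η := by linarith [hη.2, hη.1]
    have := H1 V η x (-deriv V x - η) 1 B c0 c1 c2 (Iic x) measurableSet_Iic hs1 zero_le_one h0 h1 h2
      (by
        intro y hy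
        simp only [mem_Iic] at hy
        rw [one_mul, ww, ww, ← Real.exp_add, Real.exp_le_exp, abs_of_nonpos (by linarith)]
        have := h.tangent x y
        nlinarith)
    have hq : |∫ y in Iic x, (c0 + c1 * y + c2 * y ^ 2) * ww V η y| / ww V η x ≤
        L1 * (B * (1 + |x|) ^ 2) / (-deriv V x - η) := by
      rw [div_le_iff₀ hwx]
      refine this.trans (le_of_eq ?_)
      field_simp
    constructor
    · have : L1 * (B * (1 + |x|) ^ 2) / (-deriv V x - η) ≤ L1 * (B * (1 + |x|) ^ 2) :=
        div_le_self hq1 hs1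
      nlinarith
    · have e1 : |deriv V x| ≤ 2 * (-deriv V x - η) := by
        rw [abs_of_nonpos (h.npos x)]; linarith [hη.2]
      have : L1 * (B * (1 + |x|) ^ 2) / (-deriv V x - η) * |deriv V x| ≤
          L1 * (B * (1 + |x|) ^ 2) / (-deriv V x - η) * (2 * (-deriv V x - η)) := by gcongr
      have e2 : L1 * (B * (1 + |x|) ^ 2) / (-deriv V x - η) * (2 * (-deriv V x - η)) =
          2 * (L1 * (B * (1 + |x|) ^ 2)) := by
        have : -deriv V x - η ≠ 0 := by linarith
        field_simp
      have e3 := mul_le_mul_of_nonneg_right hq (abs_nonneg (deriv V x))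
      nlinarith
  · have hneg : ∫ y in Iic x, (c0 + c1 * y + c2 * y ^ 2) * ww V η y =
        -∫ y in Ioi x, (c0 + c1 * y + c2 * y ^ 2) * ww V η y := by
      have e1 := intervalIntegral.integral_Iic_add_Ioi (b := x)
        (h.integrable_poly hη0 c0 c1 c2).integrableOn
        (h.integrable_poly hη0 c0 c1 c2).integrableOn
      have e2 := h.poly_set hη0 c0 c1 c2 univ
      simp only [Measure.restrict_univ] at e2
      change _ = c0 * SS V 0 η + c1 * SS V 1 η + c2 * SS V 2 η at e2
      rw [htot] at e2
      linarith
    rw [hneg, abs_neg]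
    have := H2 V η x a (Real.exp (V (-R))) B c0 c1 c2 (Ioi x) measurableSet_Ioi le_rfl
      (Real.exp_pos _).le h0 h1 h2
      (by
        intro y hy
        simp only [mem_Ioi] at hy
        rw [ww, ww, ← Real.exp_add, ← Real.exp_add, Real.exp_le_exp, abs_of_pos (by linarith)]
        have e1 := h.anti hx
        have e2 := h.nonneg y
        nlinarith [hη.1])
    have hq : |∫ y in Ioi x, (c0 + c1 * y + c2 * y ^ 2) * ww V η y| / ww V η x ≤
        Real.exp (V (-R)) * L2 / a * (B * (1 + |x|) ^ 2) := by
      rw [div_le_iff₀ hwx]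
      refine this.trans (le_of_eq ?_)
      field_simp
    constructor
    · nlinarith
    · have e1 : |deriv V x| ≤ |deriv V (-R)| := by
        rw [abs_of_nonpos (h.npos x), abs_of_nonpos (h.npos _)]
        linarith [h.mono hx]
      have := mul_le_mul hq e1 (abs_nonneg _) hq2
      nlinarith

lemma mm_bound (h : VP V) {a b : ℝ} (ha : 0 < a) :
    ∃ B ≥ (1:ℝ), ∀ η ∈ Icc a b, |mm V η| ≤ B ∧ |mm' V η| ≤ B := by
  have hsub : ∀ η ∈ Icc a b, (η, (0:ℝ)) ∈ Ioi (0:ℝ) ×ˢ (univ : Set ℝ) :=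
    fun η hη => ⟨ha.trans_le hη.1, mem_univ _⟩
  have hc : Continuous (fun η : ℝ => (η, (0:ℝ))) := by fun_prop
  obtain ⟨B1, hB1⟩ := (isCompact_Icc (a := a) (b := b)).exists_bound_of_continuousOn
    (h.mm_cont.comp hc.continuousOn hsub)
  obtain ⟨B2, hB2⟩ := (isCompact_Icc (a := a) (b := b)).exists_bound_of_continuousOn
    (h.mm'_cont.comp hc.continuousOn hsub)
  refine ⟨max 1 (max B1 B2), le_max_left _ _, fun η hη => ⟨?_, ?_⟩⟩
  · exact (hB1 η hη).trans ((le_max_left _ _).trans (le_max_right _ _))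
  · exact (hB2 η hη).trans ((le_max_right _ _).trans (le_max_right _ _))

lemma DE_bound (h : VP V) {a b : ℝ} (ha : 0 < a) : ∃ K > (0:ℝ), ∀ η ∈ Icc a b, ∀ x : ℝ,
    |DD V η x| ≤ K * (1 + |x|) ^ 4 ∧ |EE V η x| ≤ K * (1 + |x|) ^ 4 := by
  obtain ⟨L, hL, hk⟩ := h.key_bound (b := b) ha
  obtain ⟨B, hB, hmm⟩ := h.mm_bound (b := b) ha
  have hBp : 0 < B := by linarith
  set C : ℝ := L * B with hC
  have hC0 : 0 < C := by positivity
  refine ⟨C + (1 + B) * C + C * (1 + |b| * C + C), by positivity, fun η hη x => ?_⟩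
  have hη0 : 0 < η := ha.trans_le hη.1
  have hS := h.SS_pos hη0
  have hwx := ww_pos V η x
  obtain ⟨hm1, hm2⟩ := hmm η hη
  obtain ⟨d1, d2⟩ := hk η hη x B (-mm V η) 1 0 (by rwa [abs_neg]) (by simpa using hB)
    (by simpa using hBp.le) (by rw [mm]; field_simp; ring)
  have eD : |(-mm V η) * MM V 0 η x + 1 * MM V 1 η x + 0 * MM V 2 η x| / ww V η x = |DD V η x| := by
    rw [DD, abs_div, abs_of_pos hwx]; congr 2; ring
  rw [eD] at d1 d2
  obtain ⟨n1, -⟩ := hk η hη x B (-mm' V η) (mm V η) (-1) (by rwa [abs_neg]) hm1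
    (by simpa using hB) (by rw [mm, mm']; field_simp; ring)
  have eN : |(-mm' V η) * MM V 0 η x + mm V η * MM V 1 η x + (-1) * MM V 2 η x| / ww V η x =
      |(-MM V 2 η x + mm V η * MM V 1 η x - mm' V η * MM V 0 η x) / ww V η x| := by
    rw [abs_div, abs_of_pos hwx]; congr 2; ring
  rw [eN] at n1
  set T : ℝ := (1 + |x|) ^ 2 with hT
  have hx0 := abs_nonneg x
  have hT1 : 1 ≤ T := by rw [hT]; nlinarith
  have hxT : |x| ≤ T := by rw [hT]; nlinarith
  have hT4 : (1 + |x|) ^ 4 = T ^ 2 := by rw [hT]; ring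
  have hTT : T ≤ T ^ 2 := by nlinarith
  rw [hT4]
  have hb0 := abs_nonneg b
  constructor
  · have : C * T ≤ C * T ^ 2 := by gcongr
    have : 0 ≤ ((1 + B) * C + C * (1 + |b| * C + C)) * T ^ 2 := by positivity
    nlinarith
  · have hd0 := abs_nonneg (DD V η x)
    have b1 : |(x - mm V η) * DD V η x| ≤ (T + B) * (C * T) := by
      rw [abs_mul]
      have : |x - mm V η| ≤ T + B := (abs_sub _ _).trans (add_le_add hxT hm1)
      gcongr
    have b2 : |DD V η x * (x + (η + deriv V x) * DD V η x)| ≤ (C * T) * (T + (|b| * (C * T) + C * T)) := by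
      rw [abs_mul]
      have e1 : |(η + deriv V x) * DD V η x| ≤ |b| * (C * T) + C * T := by
        rw [add_mul]
        refine (abs_add_le _ _).trans (add_le_add ?_ ?_)
        · rw [abs_mul]
          have : |η| ≤ |b| := by
            rw [abs_of_pos hη0]; exact hη.2.trans (le_abs_self b)
          gcongr
        · rw [abs_mul, mul_comm]; exact d2
      have e2 : |x + (η + deriv V x) * DD V η x| ≤ T + (|b| * (C * T) + C * T) :=
        (abs_add_le _ _).trans (add_le_add hxT e1)
      gcongr
    have b3 : |EE V η x| ≤ C * T + (T + B) * (C * T) + (C * T) * (T + (|b| * (C * T) + C * T)) := by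
      rw [EE]
      exact (abs_add_le _ _).trans (add_le_add ((abs_add_le _ _).trans (add_le_add n1 b1)) b2)
    refine b3.trans ?_
    have c1 : C * T ≤ C * T ^ 2 := by gcongr
    have c2 : B * (C * T) ≤ B * (C * T ^ 2) := by gcongr
    nlinarith

lemma exp_bound (h : VP V) {a b : ℝ} (ha : 0 < a) (hab : a ≤ b) : ∃ κ > (0:ℝ), ∃ K > (0:ℝ),
    ∀ η ∈ Icc a b, ∀ x : ℝ, ∀ q ∈ Ioo (0:ℝ) 1, FF V η x = q →
      Real.exp (κ * |x|) ≤ K * (1 / q + 1 / (1 - q)) := by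
  obtain ⟨K, hK, δ, hδ, hb⟩ := h.ww_bound (b := b) ha
  have hc : ContinuousOn (SS V 0) (Icc a b) := fun η hη =>
    (h.SS_eta 0 η (ha.trans_le hη.1)).continuousAt.continuousWithinAt
  obtain ⟨η₀, hη₀, hmin⟩ := isCompact_Icc.exists_isMinOn (nonempty_Icc.2 hab) hc
  have hσ := h.SS_pos (ha.trans_le hη₀.1)
  set σ := SS V 0 η₀
  refine ⟨δ / 2, half_pos hδ, K * (4 / δ) / σ, by positivity, fun η hη x q hq hF => ?_⟩
  have hη0 : 0 < η := ha.trans_le hη.1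
  have hS := h.SS_pos hη0
  have hSσ : σ ≤ SS V 0 η := hmin hη
  have gi : Integrable (fun y : ℝ => K * Real.exp (-(δ / 2 * |y|))) :=
    (integrable_exp_abs (half_pos hδ)).const_mul K
  have core : ∀ S : Set ℝ, MeasurableSet S → (∀ y ∈ S, |x| ≤ |y|) →
      Real.exp (δ / 2 * |x|) * ∫ y in S, y ^ 0 * ww V η y ≤ K * (4 / δ) := by
    intro S hSm hy
    rw [← integral_const_mul]
    calc ∫ y in S, Real.exp (δ / 2 * |x|) * (y ^ 0 * ww V η y)
        ≤ ∫ y in S, K * Real.exp (-(δ / 2 * |y|)) := by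
          refine setIntegral_mono_on ((h.integrable_pow hη0 0).const_mul _).integrableOn
            gi.integrableOn hSm fun y hyS => ?_
          rw [pow_zero, one_mul]
          calc Real.exp (δ / 2 * |x|) * ww V η y
              ≤ Real.exp (δ / 2 * |y|) * (K * Real.exp (-(δ * |y|))) := by
                have := hy y hyS
                gcongr
                · exact (ww_pos _ _ _).le
                · exact hb η hη y
            _ = K * (Real.exp (δ / 2 * |y|) * Real.exp (-(δ * |y|))) := by ring
            _ = K * Real.exp (-(δ / 2 * |y|)) := by rw [← Real.exp_add]; ring_nf
      _ ≤ ∫ y, K * Real.exp (-(δ / 2 * |y|)) :=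
          setIntegral_le_integral gi (Eventually.of_forall fun y => by positivity)
      _ = K * (4 / δ) := by
          rw [integral_const_mul, integral_exp_abs (half_pos hδ)]; field_simp; norm_num
  have fin : ∀ r > 0, Real.exp (δ / 2 * |x|) * (r * SS V 0 η) ≤ K * (4 / δ) →
      Real.exp (δ / 2 * |x|) ≤ K * (4 / δ) / σ * (1 / r) := by
    intro r hr hle
    have : Real.exp (δ / 2 * |x|) * (r * σ) ≤ K * (4 / δ) := le_trans (by gcongr) hle
    rw [← le_div_iff₀ (by positivity)] at this
    refine this.trans (le_of_eq ?_)
    field_simp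
  have hMq : MM V 0 η x = q * SS V 0 η := by
    rw [← hF, FF]; field_simp
  have hq1 : 0 < 1 - q := by linarith [hq.2]
  have hq0 := hq.1
  have hKσ : 0 < K * (4 / δ) / σ := by positivity
  have p1 : 0 < K * (4 / δ) / σ * (1 / q) := by positivity
  have p2 : 0 < K * (4 / δ) / σ * (1 / (1 - q)) := by positivity
  rw [mul_add]
  rcases le_total x 0 with hx | hx
  · have := core (Iic x) measurableSet_Iic (by
      intro y hy
      simp only [mem_Iic] at hy
      rw [abs_of_nonpos hx, abs_of_nonpos (by linarith)]; linarith)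
    change _ * MM V 0 η x ≤ _ at this
    rw [hMq] at this
    linarith [fin q hq.1 this]
  · have := core (Ioi x) measurableSet_Ioi (by
      intro y hy
      simp only [mem_Ioi] at hy
      rw [abs_of_nonneg hx, abs_of_nonneg (by linarith)]; linarith)
    have e1 := intervalIntegral.integral_Iic_add_Ioi (b := x)
        (h.integrable_pow hη0 0).integrableOn (h.integrable_pow hη0 0).integrableOn
    change MM V 0 η x + _ = SS V 0 η at e1
    have e2 : ∫ y in Ioi x, y ^ 0 * ww V η y = (1 - q) * SS V 0 η := by
      rw [hMq] at e1; linarith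
    rw [e2] at this
    linarith [fin (1 - q) hq1 this]
end VP

lemma biSup_eq {a b : ℝ} (hab : a ≤ b) {f : ℝ → ℝ} (hf : ContinuousOn f (Icc a b)) :
    (⨆ η ∈ Icc a b, |f η|) = sSup ((fun η => |f η|) '' Icc a b) := by
  have hbd : BddAbove ((fun η => |f η|) '' Icc a b) :=
    (isCompact_Icc.image_of_continuousOn hf.abs).bddAbove
  have hle : ∀ η ∈ Icc a b, |f η| ≤ sSup ((fun η => |f η|) '' Icc a b) :=
    fun η hη => le_csSup hbd (mem_image_of_mem _ hη)
  have h0 : 0 ≤ sSup ((fun η => |f η|) '' Icc a b) :=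
    (abs_nonneg _).trans (hle a ⟨le_rfl, hab⟩)
  have hin : ∀ η, (⨆ _ : η ∈ Icc a b, |f η|) ≤ sSup ((fun η => |f η|) '' Icc a b) :=
    fun η => Real.iSup_le (hle η) h0
  apply le_antisymm
  · exact Real.iSup_le hin h0
  · refine csSup_le ((nonempty_Icc.2 hab).image _) ?_
    rintro _ ⟨η, hη, rfl⟩
    have : (⨆ _ : η ∈ Icc a b, |f η|) = |f η| := ciSup_pos hη
    dsimp only
    rw [← this]
    exact le_ciSup (f := fun η => ⨆ _ : η ∈ Icc a b, |f η|)
      ⟨_, by rintro _ ⟨η, rfl⟩; exact hin η⟩ η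

lemma sup_cont {a b : ℝ} {φ : ℝ → ℝ → ℝ}
    (hφ : ContinuousOn (fun p : ℝ × ℝ => φ p.1 p.2) (Icc a b ×ˢ Ioo 0 1)) :
    ContinuousOn (fun q => sSup ((fun η => |φ η q|) '' Icc a b)) (Ioo 0 1) := by
  rw [continuousOn_iff_continuous_domRestrict]
  have h1 : Continuous (fun z : (Ioo (0:ℝ) 1) × (Icc a b) => |φ z.2 z.1|) := by
    have := hφ.comp_continuous
      (f := fun z : (Ioo (0:ℝ) 1) × (Icc a b) => ((z.2 : ℝ), (z.1 : ℝ))) (by fun_prop)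
      (fun z => ⟨z.2.2, z.1.2⟩)
    exact this.abs
  have h2 := (isCompact_univ (X := Icc a b)).continuous_sSup
    (f := fun (q : Ioo (0:ℝ) 1) (η : Icc a b) => |φ η q|) h1
  convert h2 using 2 with q
  simp only [Set.domRestrict_apply]
  congr 1
  ext z
  simp

lemma dom_int : IntegrableOn (fun q : ℝ => (1 / q + 1 / (1 - q)) ^ (1 / 2 : ℝ)) (Ioo 0 1) := by
  have h1 : IntegrableOn (fun q : ℝ => q ^ (-(1 / 2) : ℝ)) (Ioo 0 1) := by
    rw [intervalIntegral.integrableOn_Ioo_rpow_iff one_pos]; norm_num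
  have h2 : IntegrableOn (fun q : ℝ => (1 - q) ^ (-(1 / 2) : ℝ)) (Ioo 0 1) := by
    have := (intervalIntegrable_iff_integrableOn_Ioo_of_le (zero_le_one (α := ℝ))).2 h1
    have h3 := this.comp_sub_left 1
    simp only [sub_zero, sub_self] at h3
    exact (intervalIntegrable_iff_integrableOn_Ioo_of_le (zero_le_one (α := ℝ))).1 h3.symm
  refine Integrable.mono' (h1.add h2) ?_ ?_
  · apply Measurable.aestronglyMeasurable
    fun_prop
  · filter_upwards [ae_restrict_mem measurableSet_Ioo] with q hq
    have e0 := hq.1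
    have e1 : 0 < 1 - q := by linarith [hq.2]
    rw [Real.norm_of_nonneg (by positivity)]
    refine (Real.rpow_add_le_add_rpow (by positivity) (by positivity) (by norm_num) (by norm_num)).trans ?_
    simp only [Pi.add_apply]
    rw [one_div q, one_div (1 - q), Real.inv_rpow e0.le, Real.inv_rpow e1.le, ← Real.rpow_neg e0.le,
      ← Real.rpow_neg e1.le]

lemma final_int {a b : ℝ} (hab : a ≤ b) {φ H : ℝ → ℝ → ℝ}
    (hφ : ContinuousOn (fun p : ℝ × ℝ => φ p.1 p.2) (Icc a b ×ˢ Ioo 0 1))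
    {K : ℝ} (hK : 0 < K) (hb : ∀ η ∈ Icc a b, ∀ q ∈ Ioo (0:ℝ) 1, |φ η q| ≤ K * (1 + |H η q|) ^ 4)
    {κ : ℝ} (hκ : 0 < κ) {K2 : ℝ} (hK2 : 0 < K2)
    (he : ∀ η ∈ Icc a b, ∀ q ∈ Ioo (0:ℝ) 1, Real.exp (κ * |H η q|) ≤ K2 * (1 / q + 1 / (1 - q)))
    {p : ℝ} (hp : 1 ≤ p) :
    IntegrableOn (fun q : ℝ => (⨆ η ∈ Icc a b, |φ η q|) ^ p) (Ioo 0 1) := by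
  have hp0 : 0 < p := by linarith
  have hsec : ∀ q ∈ Ioo (0:ℝ) 1, ContinuousOn (fun η => φ η q) (Icc a b) := fun q hq =>
    hφ.comp (f := fun η : ℝ => (η, q)) (by fun_prop) (fun η hη => ⟨hη, hq⟩)
  obtain ⟨L, hL, hLb⟩ := exp_pow_bound (s := κ / (2 * p)) (by positivity) 4
  have hc : ContinuousOn (fun q : ℝ => (⨆ η ∈ Icc a b, |φ η q|) ^ p) (Ioo 0 1) := by
    refine ContinuousOn.rpow_const ?_ (fun _ _ => Or.inr hp0.le)
    exact (sup_cont hφ).congr fun q hq => biSup_eq hab (hsec q hq)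
  refine Integrable.mono' (dom_int.const_mul ((K * L) ^ p * K2 ^ (1 / 2 : ℝ)))
    (hc.aestronglyMeasurable measurableSet_Ioo) ?_
  filter_upwards [ae_restrict_mem measurableSet_Ioo] with q hq
  have e0 := hq.1
  have e1 : 0 < 1 - q := by linarith [hq.2]
  set Q : ℝ := 1 / q + 1 / (1 - q) with hQ
  have hQ0 : 0 < Q := by positivity
  have hsup0 : 0 ≤ ⨆ η ∈ Icc a b, |φ η q| :=
    Real.iSup_nonneg fun η => Real.iSup_nonneg fun _ => abs_nonneg _
  have hM : (⨆ η ∈ Icc a b, |φ η q|) ≤ K * L * (K2 * Q) ^ (1 / (2 * p)) := by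
    refine Real.iSup_le (fun η => Real.iSup_le (fun hη => ?_) (by positivity)) (by positivity)
    refine (hb η hη q hq).trans ?_
    rw [mul_assoc]
    refine mul_le_mul_of_nonneg_left ((hLb _ (abs_nonneg (H η q))).trans ?_) hK.le
    refine mul_le_mul_of_nonneg_left ?_ hL.le
    have : Real.exp (κ / (2 * p) * |H η q|) = Real.exp (κ * |H η q|) ^ (1 / (2 * p)) := by
      rw [← Real.exp_mul]; congr 1; ring
    rw [this]
    exact Real.rpow_le_rpow (Real.exp_pos _).le (he η hη q hq) (by positivity)
  rw [Real.norm_of_nonneg (by positivity)]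
  refine (Real.rpow_le_rpow hsup0 hM hp0.le).trans (le_of_eq ?_)
  rw [Real.mul_rpow (by positivity) (by positivity), ← Real.rpow_mul (by positivity)]
  have : 1 / (2 * p) * p = 1 / 2 := by field_simp
  rw [this, Real.mul_rpow hK2.le hQ0.le]
  ring

/-- all moments of `sup_{η ∈ [η₁,η₂]} |∂_η^k H_η(q)|`, `k = 0, 1, 2`, are
finite when `q` is uniform on `(0,1)`. -/
theorem stmt_19 (V : ℝ → ℝ) (hV : OConnellYorType V) (η₁ η₂ : ℝ)
    (hη₁ : 0 < η₁) (hη₁₂ : η₁ < η₂)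
    (Z : ℝ → ℝ) (hZ : ∀ θ : ℝ, Z θ = ∫ x : ℝ, Real.exp (-(θ * x) - V x))
    (F : ℝ → ℝ → ℝ)
    (hF : ∀ θ x : ℝ, F θ x = (Z θ)⁻¹ * ∫ y in Set.Iic x, Real.exp (-(θ * y) - V y))
    (H : ℝ → ℝ → ℝ)
    (hH : ∀ η : ℝ, 0 < η → ∀ q ∈ Set.Ioo (0:ℝ) 1, F η (H η q) = q) :
    ∀ k : ℕ, k ≤ 2 → ∀ p : ℝ, 1 ≤ p → ∃ C > (0:ℝ),
      MeasureTheory.IntegrableOn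
        (fun q : ℝ =>
          (⨆ η ∈ Set.Icc η₁ η₂, |deriv^[k] (fun e => H e q) η|) ^ p)
        (Set.Ioo 0 1) ∧
      (∫ q in Set.Ioo (0:ℝ) 1,
          (⨆ η ∈ Set.Icc η₁ η₂, |deriv^[k] (fun e => H e q) η|) ^ p) ≤ C := by
  intro k hk p hp
  obtain ⟨v1, v2, v3, v4, v5, -⟩ := hV
  have h : VP V := VP.of_type v1 v2 v3 v4 v5
  have hFF : ∀ θ x, F θ x = FF V θ x := by
    intro θ x
    rw [hF, hZ, FF, MM, SS]
    simp only [pow_zero, one_mul, ww]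
    rw [div_eq_inv_mul]
  have hH' : ∀ η : ℝ, 0 < η → ∀ q ∈ Ioo (0:ℝ) 1, FF V η (H η q) = q := by
    intro η hη q hq
    rw [← hFF]; exact hH η hη q hq
  suffices hI : IntegrableOn (fun q : ℝ =>
      (⨆ η ∈ Set.Icc η₁ η₂, |deriv^[k] (fun e => H e q) η|) ^ p) (Set.Ioo 0 1) from
    ⟨|∫ q in Set.Ioo (0:ℝ) 1, (⨆ η ∈ Set.Icc η₁ η₂, |deriv^[k] (fun e => H e q) η|) ^ p| + 1,
      by positivity, hI, (le_abs_self _).trans (by linarith)⟩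
  obtain ⟨K, hK, hDE⟩ := h.DE_bound (b := η₂) hη₁
  obtain ⟨κ, hκ, K2, hK2, he⟩ := h.exp_bound hη₁ hη₁₂.le
  have hcH : ContinuousOn (fun r : ℝ × ℝ => H r.1 r.2) (Icc η₁ η₂ ×ˢ Ioo 0 1) :=
    (H_cont h hH').mono (prod_mono (fun e he => hη₁.trans_le he.1) subset_rfl)
  have hcP : ContinuousOn (fun r : ℝ × ℝ => (r.1, H r.1 r.2)) (Icc η₁ η₂ ×ˢ Ioo 0 1) :=
    continuousOn_fst.prodMk hcH
  have hmaps : MapsTo (fun r : ℝ × ℝ => (r.1, H r.1 r.2)) (Icc η₁ η₂ ×ˢ Ioo 0 1)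
      (Ioi (0:ℝ) ×ˢ univ) := fun r hr => ⟨hη₁.trans_le hr.1.1, mem_univ _⟩
  refine final_int (φ := fun η q => deriv^[k] (fun e => H e q) η) (H := H) (K := K + 1) hη₁₂.le
    ?_ (by linarith) ?_ hκ hK2 (fun η hη q hq => he η hη _ q hq (hH' η (hη₁.trans_le hη.1) q hq)) hp
  · interval_cases k
    · exact hcH
    · exact (h.DD_cont.comp hcP hmaps).congr fun r hr =>
        (H_iter h hH' (hη₁.trans_le hr.1.1) hr.2).2.1
    · exact (h.EE_cont.comp hcP hmaps).congr fun r hr =>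
        (H_iter h hH' (hη₁.trans_le hr.1.1) hr.2).2.2
  · intro η hη q hq
    obtain ⟨i0, i1, i2⟩ := H_iter h hH' (hη₁.trans_le hη.1) hq
    obtain ⟨d1, d2⟩ := hDE η hη (H η q)
    have ht : 0 ≤ (1 + |H η q|) ^ 4 := by positivity
    have hx0 := abs_nonneg (H η q)
    interval_cases k
    · have : |H η q| ≤ (1 + |H η q|) ^ 4 := by
        have := le_self_pow₀ (by linarith : 1 ≤ 1 + |H η q|) (by norm_num : 4 ≠ 0)
        linarith
      change |H η q| ≤ _
      nlinarith
    · rw [i1]; nlinarith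
    · rw [i2]; nlinarith
end
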